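/- Let N be the dimension of ℙ(H_d), 𝒟 = d_1⋯d_n, and D = max_i d_i. For every σ ∈ (0,1] and every t ≥ (4n𝒟² + 1)·N/σ, the supremum over f ∈ ℙ(H_d) of the probability, for g uniformly distributed in the projective ball B(f,σ), that κ̃(g) ≥ t, is at most 13·n²·D·𝒟·N / (σ·t). -/

import Mathlib

open MvPolynomial Finset ENNReal

/-- Bombieri–Weyl inner product of two polynomials (intended for homogeneous
polynomials of the same degree `d`): `⟨Σ aⱼ xʲ, Σ bⱼ xʲ⟩_W = Σ aⱼ bⱼ / binom(d, j)`
where `binom(d, j) = d! / (j₀! ⋯ jₙ!)`. -/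
noncomputable def bwInner {m : ℕ} (p q : MvPolynomial (Fin m) ℝ) : ℝ :=
  ∑ j ∈ p.support ∪ q.support,
    (p.coeff j * q.coeff j) / (Nat.multinomial Finset.univ j : ℝ)

/-- Bombieri–Weyl norm of one polynomial. -/
noncomputable def bwNorm {m : ℕ} (p : MvPolynomial (Fin m) ℝ) : ℝ :=
  Real.sqrt (bwInner p p)

/-- Bombieri–Weyl norm `‖f‖_W` of a system `f = (f_1, …, f_n)`. -/
noncomputable def bwNormSys {n : ℕ} (f : Fin n → MvPolynomial (Fin (n + 1)) ℝ) : ℝ :=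
  Real.sqrt (∑ i, bwInner (f i) (f i))

/-- Distance (w.r.t. the Bombieri–Weyl norm) from a system `f` to a set `S` of systems. -/
noncomputable def bwDist {n : ℕ} (f : Fin n → MvPolynomial (Fin (n + 1)) ℝ)
    (S : Set (Fin n → MvPolynomial (Fin (n + 1)) ℝ)) : ℝ :=
  sInf ((fun g => bwNormSys (f - g)) '' S)

/-- The unit sphere `Sⁿ ⊆ ℝ^{n+1}`. -/
def unitSphere (n : ℕ) : Set (Fin (n + 1) → ℝ) := {x | ∑ k, x k ^ 2 = 1}

/-- `f` belongs to `H_d`: each component is homogeneous of degree `d i`. -/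
def IsSystem {n : ℕ} (d : Fin n → ℕ) (f : Fin n → MvPolynomial (Fin (n + 1)) ℝ) : Prop :=
  ∀ i, (f i).IsHomogeneous (d i)

/-- The derivative `Df(x)` restricted to the tangent space `T_x Sⁿ = x^⊥` is singular,
i.e. it kills some nonzero tangent vector `v`. -/
def SingularAt {n : ℕ} (f : Fin n → MvPolynomial (Fin (n + 1)) ℝ)
    (x : Fin (n + 1) → ℝ) : Prop :=
  ∃ v : Fin (n + 1) → ℝ, v ≠ 0 ∧ (∑ k, v k * x k = 0) ∧
    ∀ i, ∑ k, MvPolynomial.eval x (MvPolynomial.pderiv k (f i)) * v k = 0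

/-- `Σ_ℝ(x)`: the systems in `H_d` having `x` as a multiple zero. -/
def SigmaRx {n : ℕ} (d : Fin n → ℕ) (x : Fin (n + 1) → ℝ) :
    Set (Fin n → MvPolynomial (Fin (n + 1)) ℝ) :=
  {g | IsSystem d g ∧ (∀ i, MvPolynomial.eval x (g i) = 0) ∧ SingularAt g x}

/-- `Σ_ℝ = ⋃_{x ∈ Sⁿ} Σ_ℝ(x)`: the systems in `H_d` with a multiple zero on `Sⁿ`. -/
def SigmaR {n : ℕ} (d : Fin n → ℕ) : Set (Fin n → MvPolynomial (Fin (n + 1)) ℝ) :=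
  ⋃ x ∈ unitSphere n, SigmaRx d x

/-- The smallest singular value of `diag(1/√dᵢ) · Df(x)|_{T_x Sⁿ}`, i.e.
`inf {‖diag(1/√dᵢ)·Df(x) v‖₂ : v ⊥ x, ‖v‖₂ = 1}`.  This equals
`‖f‖_W · μ̃_norm(f,x)⁻¹`, where `μ̃_norm(f,x) = ‖f‖_W ‖(Df(x)|_{T_x Sⁿ})⁻¹ diag(√dᵢ)‖`
(spectral norm, `+∞` when `Df(x)|_{T_x Sⁿ}` is singular); it is `0` exactly
when `μ̃_norm(f,x) = +∞`. -/
noncomputable def sigmaMin {n : ℕ} (d : Fin n → ℕ)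
    (f : Fin n → MvPolynomial (Fin (n + 1)) ℝ) (x : Fin (n + 1) → ℝ) : ℝ :=
  sInf ((fun v => Real.sqrt (∑ i,
      ((∑ k, MvPolynomial.eval x (MvPolynomial.pderiv k (f i)) * v k) / Real.sqrt (d i)) ^ 2)) ''
    {v : Fin (n + 1) → ℝ | (∑ k, v k * x k = 0) ∧ ∑ k, v k ^ 2 = 1})

/-- `κ̃(f, x) = ‖f‖_W / (‖f‖_W² μ̃_norm(f,x)⁻² + ‖f(x)‖₂²)^{1/2}` as an extended
nonnegative real (value `+∞` when `f` has `x` as multiple zero), using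
`‖f‖_W² μ̃_norm(f,x)⁻² = (sigmaMin d f x)²`. -/
noncomputable def kappaAt {n : ℕ} (d : Fin n → ℕ)
    (f : Fin n → MvPolynomial (Fin (n + 1)) ℝ) (x : Fin (n + 1) → ℝ) : ℝ≥0∞ :=
  ENNReal.ofReal (bwNormSys f) /
    ENNReal.ofReal (Real.sqrt (sigmaMin d f x ^ 2 + ∑ i, (MvPolynomial.eval x (f i)) ^ 2))

/-- `κ̃(f) = max_{x ∈ Sⁿ} κ̃(f, x)`. -/
noncomputable def kappa {n : ℕ} (d : Fin n → ℕ)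
    (f : Fin n → MvPolynomial (Fin (n + 1)) ℝ) : ℝ≥0∞ :=
  ⨆ x ∈ unitSphere n, kappaAt d f x


open MeasureTheory Metric RealInnerProductSpace

namespace SmoothedKappa

section CommRing
variable {S : Type*} [CommRing S] {m : ℕ}

/-- The linear form `X ↦ ⟨X, x⟩`. -/
noncomputable def linForm (x : Fin m → S) : MvPolynomial (Fin m) S := ∑ k, C (x k) * X k

/-- The derivative of `p` at `x` in the direction `v`. -/
noncomputable def dEval (p : MvPolynomial (Fin m) S) (x v : Fin m → S) : S :=
  ∑ k, eval x (pderiv k p) * v k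

lemma isHomogeneous_linForm (x : Fin m → S) : (linForm x).IsHomogeneous 1 := by
  refine IsHomogeneous.sum _ _ _ fun k _ => ?_
  simpa using (isHomogeneous_C (Fin m) (x k)).mul (isHomogeneous_X S k)

lemma eval_linForm (x y : Fin m → S) : eval y (linForm x) = ∑ k, x k * y k := by
  simp [linForm]

lemma dEval_linForm (x y v : Fin m → S) : dEval (linForm x) y v = ∑ k, x k * v k := by
  unfold dEval
  refine Finset.sum_congr rfl fun k _ => ?_
  congr 1
  simp [linForm, pderiv_X, Pi.single_apply]

lemma dEval_add (p q : MvPolynomial (Fin m) S) (x v : Fin m → S) :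
    dEval (p + q) x v = dEval p x v + dEval q x v := by
  simp [dEval, add_mul, Finset.sum_add_distrib]

lemma dEval_sub (p q : MvPolynomial (Fin m) S) (x v : Fin m → S) :
    dEval (p - q) x v = dEval p x v - dEval q x v := by
  simp [dEval, sub_mul, Finset.sum_sub_distrib]

lemma dEval_mul (p q : MvPolynomial (Fin m) S) (x v : Fin m → S) :
    dEval (p * q) x v = dEval p x v * eval x q + eval x p * dEval q x v := by
  simp only [dEval, Finset.sum_mul, Finset.mul_sum, ← Finset.sum_add_distrib]
  refine Finset.sum_congr rfl fun k _ => ?_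
  simp
  ring

lemma dEval_C (c : S) (x v : Fin m → S) : dEval (C c) x v = 0 := by
  simp [dEval]

lemma dEval_pow (p : MvPolynomial (Fin m) S) (k : ℕ) (x v : Fin m → S) :
    dEval (p ^ k) x v = k * eval x p ^ (k - 1) * dEval p x v := by
  simp only [dEval, Finset.mul_sum]
  refine Finset.sum_congr rfl fun j _ => ?_
  simp
  ring

end CommRing

section BW
variable {m : ℕ}

lemma bwInner_eq_sum_left (p q : MvPolynomial (Fin m) ℝ) :
    bwInner p q = ∑ j ∈ p.support,
      (p.coeff j * q.coeff j) / (Nat.multinomial Finset.univ j : ℝ) := by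
  unfold bwInner
  symm
  refine Finset.sum_subset Finset.subset_union_left fun j _ hj => ?_
  simp [notMem_support_iff.mp hj]

lemma bwInner_eq_sum (p q : MvPolynomial (Fin m) ℝ) {s : Finset (Fin m →₀ ℕ)}
    (hs : p.support ⊆ s) : bwInner p q = ∑ j ∈ s,
      (p.coeff j * q.coeff j) / (Nat.multinomial Finset.univ j : ℝ) := by
  rw [bwInner_eq_sum_left]
  refine Finset.sum_subset hs fun j _ hj => ?_
  simp [notMem_support_iff.mp hj]

lemma bwInner_comm (p q : MvPolynomial (Fin m) ℝ) : bwInner p q = bwInner q p := by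
  unfold bwInner
  rw [Finset.union_comm]
  exact Finset.sum_congr rfl fun j _ => by ring

lemma bwInner_add_right (p q r : MvPolynomial (Fin m) ℝ) :
    bwInner p (q + r) = bwInner p q + bwInner p r := by
  simp only [bwInner_eq_sum_left, ← Finset.sum_add_distrib, coeff_add]
  exact Finset.sum_congr rfl fun j _ => by ring

lemma bwInner_C_mul_right (p q : MvPolynomial (Fin m) ℝ) (c : ℝ) :
    bwInner p (C c * q) = c * bwInner p q := by
  simp only [bwInner_eq_sum_left, Finset.mul_sum, coeff_C_mul]
  exact Finset.sum_congr rfl fun j _ => by ring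

lemma bwInner_add_left (p q r : MvPolynomial (Fin m) ℝ) :
    bwInner (p + q) r = bwInner p r + bwInner q r := by
  rw [bwInner_comm, bwInner_add_right, bwInner_comm r, bwInner_comm r]

lemma bwInner_C_mul_left (p q : MvPolynomial (Fin m) ℝ) (c : ℝ) :
    bwInner (C c * p) q = c * bwInner p q := by
  rw [bwInner_comm, bwInner_C_mul_right, bwInner_comm]

lemma bwInner_sum_left {ι : Type*} (s : Finset ι) (p : ι → MvPolynomial (Fin m) ℝ)
    (q : MvPolynomial (Fin m) ℝ) : bwInner (∑ i ∈ s, p i) q = ∑ i ∈ s, bwInner (p i) q := by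
  classical
  induction s using Finset.induction_on with
  | empty => simp [bwInner_eq_sum_left]
  | insert a s ha ih => rw [Finset.sum_insert ha, Finset.sum_insert ha, bwInner_add_left, ih]

lemma multinomial_add_single (j : Fin m →₀ ℕ) (k : Fin m) :
    (j k + 1) * Nat.multinomial Finset.univ (j + Finsupp.single k 1 : Fin m →₀ ℕ) =
      (∑ i, j i + 1) * Nat.multinomial Finset.univ j := by
  classical
  have h1 := Nat.multinomial_spec Finset.univ j
  have h2 := Nat.multinomial_spec Finset.univ (j + Finsupp.single k 1 : Fin m →₀ ℕ)
  have h3 : ∏ i, ((j + Finsupp.single k 1 : Fin m →₀ ℕ) i).factorial =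
      (j k + 1) * ∏ i, (j i).factorial := by
    rw [← Finset.mul_prod_erase _ _ (Finset.mem_univ k),
      ← Finset.mul_prod_erase _ (fun i => (j i).factorial) (Finset.mem_univ k)]
    have : ∀ i ∈ Finset.univ.erase k,
        ((j + Finsupp.single k 1 : Fin m →₀ ℕ) i).factorial = (j i).factorial := by
      intro i hi
      simp [(Finset.ne_of_mem_erase hi).symm]
    rw [Finset.prod_congr rfl this]
    simp [Nat.factorial_succ, mul_assoc]
  have h4 : ∑ i, (j + Finsupp.single k 1 : Fin m →₀ ℕ) i = ∑ i, j i + 1 := by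
    simp [Finset.sum_add_distrib]
  rw [h3, h4, Nat.factorial_succ, ← h1] at h2
  have hpos : 0 < ∏ i, (j i).factorial := Finset.prod_pos fun i _ => Nat.factorial_pos _
  apply Nat.eq_of_mul_eq_mul_left hpos
  linarith

lemma bwInner_X_mul {q p : MvPolynomial (Fin m) ℝ} {d : ℕ} (hq : q.IsHomogeneous d) (k : Fin m) :
    ((d : ℝ) + 1) * bwInner (X k * q) p = bwInner q (pderiv k p) := by
  rw [bwInner_eq_sum_left, bwInner_eq_sum_left, support_X_mul, Finset.sum_map, Finset.mul_sum]
  refine Finset.sum_congr rfl fun j hj => ?_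
  have hdeg : ∑ i, j i = d := by
    have := hq (mem_support_iff.mp hj)
    simpa [Finsupp.weight_apply, Finsupp.sum_fintype] using this
  have h := multinomial_add_single j k
  rw [hdeg] at h
  have h' : ((j k : ℝ) + 1) * Nat.multinomial Finset.univ (j + Finsupp.single k 1 : Fin m →₀ ℕ) =
      ((d : ℝ) + 1) * Nat.multinomial Finset.univ j := by exact_mod_cast h
  have hp1 : (Nat.multinomial Finset.univ j : ℝ) ≠ 0 := by
    exact_mod_cast (Nat.multinomial_pos _ _).ne'
  have hp2 : (Nat.multinomial Finset.univ (j + Finsupp.single k 1 : Fin m →₀ ℕ) : ℝ) ≠ 0 := by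
    exact_mod_cast (Nat.multinomial_pos _ _).ne'
  rw [coeff_pderiv]
  simp only [addLeftEmbedding_apply]
  rw [coeff_X_mul, add_comm (Finsupp.single k 1) j]
  field_simp
  linear_combination (-(coeff j q * coeff (j + Finsupp.single k 1) p)) * h'

lemma bwInner_linForm_mul {q p : MvPolynomial (Fin m) ℝ} {d : ℕ} (hq : q.IsHomogeneous d)
    (v : Fin m → ℝ) :
    ((d : ℝ) + 1) * bwInner (linForm v * q) p = bwInner q (∑ k, C (v k) * pderiv k p) := by
  rw [bwInner_comm q, bwInner_sum_left, linForm, Finset.sum_mul, bwInner_sum_left, Finset.mul_sum]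
  refine Finset.sum_congr rfl fun k _ => ?_
  rw [mul_assoc, bwInner_C_mul_left, bwInner_C_mul_left, bwInner_comm (pderiv k p),
    ← bwInner_X_mul hq]
  ring

lemma isHomogeneous_linForm_pow (x : Fin m → ℝ) (d : ℕ) : (linForm x ^ d).IsHomogeneous d := by
  simpa using (isHomogeneous_linForm x).pow d

/-- The reproducing property of the Bombieri–Weyl inner product. -/
lemma bwInner_linForm_pow (x : Fin m → ℝ) (d : ℕ) {p : MvPolynomial (Fin m) ℝ}
    (hp : p.IsHomogeneous d) : bwInner (linForm x ^ d) p = eval x p := by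
  induction d generalizing p with
  | zero =>
    have : p = C (coeff 0 p) := by
      rw [← totalDegree_eq_zero_iff_eq_C]
      exact Nat.le_zero.mp hp.totalDegree_le
    rw [this, pow_zero, bwInner_eq_sum _ _ (s := {0}) (by simp)]
    · simp [Nat.multinomial]
  | succ d ih =>
    have h := bwInner_linForm_mul (p := p) (isHomogeneous_linForm_pow x d) x
    have hh : (∑ k, C (x k) * pderiv k p).IsHomogeneous d :=
      IsHomogeneous.sum _ _ _ fun k _ => by
        simpa using (isHomogeneous_C (Fin m) (x k)).mul (hp.pderiv (i := k))
    rw [ih hh] at h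
    have he : eval x (∑ k, C (x k) * pderiv k p) = ((d : ℝ) + 1) * eval x p := by
      have := congrArg (eval x) hp.sum_X_mul_pderiv
      simpa using this
    rw [he] at h
    rw [pow_succ']
    exact mul_left_cancel₀ (by positivity) h

lemma bwInner_linForm_pow_mul (x v : Fin m → ℝ) {d : ℕ} (hd : 1 ≤ d)
    {p : MvPolynomial (Fin m) ℝ} (hp : p.IsHomogeneous d) :
    bwInner (linForm v * linForm x ^ (d - 1)) p = dEval p x v / d := by
  obtain ⟨d, rfl⟩ : ∃ e, d = e + 1 := ⟨d - 1, by omega⟩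
  have h := bwInner_linForm_mul (p := p) (isHomogeneous_linForm_pow x d) v
  have hh : (∑ k, C (v k) * pderiv k p).IsHomogeneous d :=
    IsHomogeneous.sum _ _ _ fun k _ => by
      simpa using (isHomogeneous_C (Fin m) (v k)).mul (hp.pderiv (i := k))
  rw [bwInner_linForm_pow x d hh] at h
  have : dEval p x v = eval x (∑ k, C (v k) * pderiv k p) := by
    simp [dEval, mul_comm]
  rw [this, ← h]
  simp
  field_simp

end BW

/-- A system with a multiple zero: a unit zero `x` together with a unit tangent vector `v ⊥ x`
killed by the derivative. -/
def Degenerate {n : ℕ} (f : Fin n → MvPolynomial (Fin (n + 1)) ℝ) : Prop :=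
  ∃ x v : Fin (n + 1) → ℝ, ∑ k, x k ^ 2 = 1 ∧ ∑ k, v k ^ 2 = 1 ∧ ∑ k, v k * x k = 0 ∧
    ∀ i, eval x (f i) = 0 ∧ dEval (f i) x v = 0

section Distance
variable {n : ℕ} {d : Fin n → ℕ}

/-- Every system is close to a degenerate one, as measured by its value and its derivative at a
point in a tangent direction. -/
lemma exists_degenerate_near (hd : ∀ i, 1 ≤ d i) {f : Fin n → MvPolynomial (Fin (n + 1)) ℝ}
    (hf : IsSystem d f) {x v : Fin (n + 1) → ℝ} (hx : ∑ k, x k ^ 2 = 1) (hv : ∑ k, v k ^ 2 = 1)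
    (hxv : ∑ k, v k * x k = 0) :
    ∃ g, IsSystem d g ∧ Degenerate g ∧
      bwNormSys (f - g) = Real.sqrt (∑ i, (eval x (f i) ^ 2 + dEval (f i) x v ^ 2 / d i)) := by
  set h : Fin n → MvPolynomial (Fin (n + 1)) ℝ := fun i =>
    C (eval x (f i)) * linForm x ^ d i +
      C (dEval (f i) x v) * (linForm v * linForm x ^ (d i - 1)) with hh
  have hKx : eval x (linForm x) = 1 := by
    rw [eval_linForm, ← hx]; exact Finset.sum_congr rfl fun k _ => by ring
  have hvx : eval x (linForm v) = 0 := by rw [eval_linForm, hxv]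
  have hKd : dEval (linForm x) x v = 0 := by
    rw [dEval_linForm, ← hxv]; exact Finset.sum_congr rfl fun k _ => by ring
  have hVd : dEval (linForm v) x v = 1 := by
    rw [dEval_linForm, ← hv]; exact Finset.sum_congr rfl fun k _ => by ring
  have hV : ∀ i, (linForm v * linForm x ^ (d i - 1)).IsHomogeneous (d i) := fun i => by
    have := (isHomogeneous_linForm v).mul (isHomogeneous_linForm_pow x (d i - 1))
    rwa [Nat.add_sub_cancel' (hd i)] at this
  have hhom : IsSystem d h := fun i =>
    (by simpa using (isHomogeneous_C _ (eval x (f i))).mul (isHomogeneous_linForm_pow x (d i)) :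
      (C (eval x (f i)) * linForm x ^ d i).IsHomogeneous (d i)).add
    (by simpa using (isHomogeneous_C _ (dEval (f i) x v)).mul (hV i))
  have hheval : ∀ i, eval x (h i) = eval x (f i) := fun i => by
    simp [hh, hKx, hvx]
  have hhd : ∀ i, dEval (h i) x v = dEval (f i) x v := fun i => by
    simp [hh, dEval_add, dEval_C, dEval_mul, dEval_pow, hKx, hvx, hKd, hVd]
  refine ⟨f - h, fun i => (hf i).sub (hhom i),
    ⟨x, v, hx, hv, hxv, fun i => ⟨by simp [hheval], ?_⟩⟩, ?_⟩
  · rw [Pi.sub_apply, dEval_sub, hhd, sub_self]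
  · rw [_root_.sub_sub_cancel, bwNormSys]
    congr 1
    refine Finset.sum_congr rfl fun i _ => ?_
    rw [show h i = C (eval x (f i)) * linForm x ^ d i +
      C (dEval (f i) x v) * (linForm v * linForm x ^ (d i - 1)) from rfl, bwInner_add_left,
      bwInner_C_mul_left, bwInner_C_mul_left]
    rw [← show h i = C (eval x (f i)) * linForm x ^ d i +
      C (dEval (f i) x v) * (linForm v * linForm x ^ (d i - 1)) from rfl,
      bwInner_linForm_pow x _ (hhom i), bwInner_linForm_pow_mul x v (hd i) (hhom i), hheval, hhd]
    ring

lemma exists_unit_orthogonal (hn : 1 ≤ n) (x : Fin (n + 1) → ℝ) :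
    ∃ v : Fin (n + 1) → ℝ, ∑ k, v k ^ 2 = 1 ∧ ∑ k, v k * x k = 0 := by
  have hker : LinearMap.ker (Fintype.linearCombination ℝ x : (Fin (n + 1) → ℝ) →ₗ[ℝ] ℝ) ≠ ⊥ :=
    LinearMap.ker_ne_bot_of_finrank_lt (by simp; omega)
  obtain ⟨v, hv, hv0⟩ := Submodule.exists_mem_ne_zero_of_ne_bot hker
  have hv1 : ∑ k, v k * x k = 0 := by
    simpa [Fintype.linearCombination_apply] using hv
  have hpos : 0 < ∑ k, v k ^ 2 := by
    obtain ⟨k, hk⟩ := Function.ne_iff.mp hv0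
    exact Finset.sum_pos' (fun i _ => sq_nonneg _) ⟨k, Finset.mem_univ _, by
      have : v k ≠ 0 := hk
      positivity⟩
  refine ⟨fun k => v k / Real.sqrt (∑ k, v k ^ 2), ?_, ?_⟩
  · simp only [div_pow, Real.sq_sqrt hpos.le]
    rw [← Finset.sum_div, div_self hpos.ne']
  · simp only [div_mul_eq_mul_div]
    rw [← Finset.sum_div, hv1, zero_div]

lemma exists_degenerate_near_of_kappa (hd : ∀ i, 1 ≤ d i)
    {f : Fin n → MvPolynomial (Fin (n + 1)) ℝ} (hf : IsSystem d f) (hn : 1 ≤ n)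
    (hf1 : bwNormSys f = 1) {t ε : ℝ} (ht : 0 < t) (hε : 1 / t < ε)
    (hk : ENNReal.ofReal t ≤ kappa d f) :
    ∃ g, IsSystem d g ∧ Degenerate g ∧ bwNormSys (f - g) < ε := by
  have hε0 : 0 < ε := lt_trans (by positivity) hε
  have hlt : ENNReal.ofReal (1 / ε) < kappa d f := by
    refine lt_of_lt_of_le ?_ hk
    rw [ENNReal.ofReal_lt_ofReal_iff ht]
    rw [div_lt_iff₀ hε0]
    rwa [div_lt_iff₀ ht, mul_comm] at hε
  simp only [kappa, lt_iSup_iff] at hlt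
  obtain ⟨x, hx, hlt⟩ := hlt
  have hx1 : ∑ k, x k ^ 2 = 1 := hx
  rw [kappaAt, hf1, ENNReal.ofReal_one] at hlt
  set q := sigmaMin d f x ^ 2 + ∑ i, (eval x (f i)) ^ 2 with hq
  have hsq : Real.sqrt q < ε := by
    by_contra! hcon
    refine absurd hlt (not_lt.mpr ?_)
    rw [ENNReal.ofReal_div_of_pos hε0, ENNReal.ofReal_one]
    gcongr
  have hq2 : q < ε ^ 2 := (Real.sqrt_lt' hε0).mp hsq
  have hσ : sigmaMin d f x < Real.sqrt (ε ^ 2 - ∑ i, (eval x (f i)) ^ 2) := by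
    apply Real.lt_sqrt_of_sq_lt
    linarith
  have hne : ((fun v => Real.sqrt (∑ i,
      ((∑ k, MvPolynomial.eval x (MvPolynomial.pderiv k (f i)) * v k) / Real.sqrt (d i)) ^ 2)) ''
    {v : Fin (n + 1) → ℝ | (∑ k, v k * x k = 0) ∧ ∑ k, v k ^ 2 = 1}).Nonempty := by
    obtain ⟨v, hv, hxv⟩ := exists_unit_orthogonal hn x
    exact Set.Nonempty.image _ ⟨v, hxv, hv⟩
  obtain ⟨_, ⟨v, ⟨hxv, hv⟩, rfl⟩, hlt2⟩ := exists_lt_of_csInf_lt hne hσ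
  obtain ⟨g, hg, hdg, hfg⟩ := exists_degenerate_near hd hf hx1 hv hxv
  refine ⟨g, hg, hdg, ?_⟩
  rw [hfg, Real.sqrt_lt' hε0, Finset.sum_add_distrib]
  have h2 : ∑ i, dEval (f i) x v ^ 2 / d i < ε ^ 2 - ∑ i, (eval x (f i)) ^ 2 := by
    have := (Real.sqrt_lt_sqrt_iff (by positivity)).mp hlt2
    refine lt_of_eq_of_lt (Finset.sum_congr rfl fun i _ => ?_) this
    rw [div_pow, Real.sq_sqrt (by positivity)]
    rfl
  linarith

end Distance

section Macaulay
variable {n : ℕ} {S : Type*} [CommRing S]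

/-- The exponents of the monomials of degree `a` in `n + 1` variables. -/
abbrev Expo (n a : ℕ) : Finset (Fin (n + 1) →₀ ℕ) := Finset.univ.finsuppAntidiag a

/-- The index set of the coefficients of a system. -/
abbrev Idx (d : Fin n → ℕ) : Type := Σ i : Fin n, (Expo n (d i) : Finset (Fin (n + 1) →₀ ℕ))

lemma mem_Expo {a : ℕ} {β : Fin (n + 1) →₀ ℕ} : β ∈ Expo n a ↔ ∑ k, β k = a := by
  simp [Expo, Finset.mem_finsuppAntidiag]

lemma mem_Expo_of_coeff_ne_zero {p : MvPolynomial (Fin (n + 1)) S} {a : ℕ}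
    (hp : p.IsHomogeneous a) {γ : Fin (n + 1) →₀ ℕ} (h : coeff γ p ≠ 0) : γ ∈ Expo n a := by
  have := hp h
  rw [mem_Expo]
  simpa [Finsupp.weight_apply, Finsupp.sum_fintype] using this

/-- The system with prescribed coefficients. -/
noncomputable def sys (d : Fin n → ℕ) (c : Idx d → S) (i : Fin n) : MvPolynomial (Fin (n + 1)) S :=
  ∑ α : (Expo n (d i) : Finset (Fin (n + 1) →₀ ℕ)), monomial α.1 (c ⟨i, α⟩)

/-- The coefficients of a system. -/
noncomputable def coefs (d : Fin n → ℕ) (f : Fin n → MvPolynomial (Fin (n + 1)) S) : Idx d → S :=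
  fun j => coeff j.2.1 (f j.1)

variable {d : Fin n → ℕ}

lemma coeff_sys (c : Idx d → S) (i : Fin n) (γ : Fin (n + 1) →₀ ℕ) :
    coeff γ (sys d c i) = if h : γ ∈ Expo n (d i) then c ⟨i, γ, h⟩ else 0 := by
  classical
  rw [sys, coeff_sum]
  simp only [coeff_monomial]
  split_ifs with h
  · rw [Finset.sum_eq_single ⟨γ, h⟩]
    · simp
    · intro b _ hb
      rw [if_neg]
      exact fun hb' => hb (Subtype.ext hb')
    · simp
  · refine Finset.sum_eq_zero fun b _ => if_neg ?_
    rintro rfl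
    exact h b.2

lemma coefs_sys (c : Idx d → S) : coefs d (sys d c) = c := by
  funext ⟨i, α, hα⟩
  simp only [coefs, coeff_sys]
  exact dif_pos hα

lemma isHomogeneous_sys (c : Idx d → S) (i : Fin n) : (sys d c i).IsHomogeneous (d i) := by
  refine IsHomogeneous.sum _ _ _ fun α _ => isHomogeneous_monomial _ ?_
  rw [Finsupp.degree_eq_sum]
  exact mem_Expo.mp α.2

lemma sys_coefs {f : Fin n → MvPolynomial (Fin (n + 1)) S} (hf : ∀ i, (f i).IsHomogeneous (d i)) :
    sys d (coefs d f) = f := by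
  funext i
  ext γ
  rw [coeff_sys]
  split_ifs with h
  · rfl
  · by_contra hne
    exact h (mem_Expo_of_coeff_ne_zero (hf i) (Ne.symm hne))

lemma map_sys {S' : Type*} [CommRing S'] (φ : S →+* S') (c : Idx d → S) (i : Fin n) :
    map φ (sys d c i) = sys d (fun j => φ (c j)) i := by
  simp [sys, map_monomial]

/-- The Jacobian determinant with respect to all variables but the `k`-th. -/
noncomputable def jac (k : Fin (n + 1)) (f : Fin n → MvPolynomial (Fin (n + 1)) S) :
    MvPolynomial (Fin (n + 1)) S :=
  (Matrix.of fun i l => pderiv (k.succAbove l) (f i)).det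

lemma isHomogeneous_jac (k : Fin (n + 1)) {f : Fin n → MvPolynomial (Fin (n + 1)) S}
    (hf : ∀ i, (f i).IsHomogeneous (d i)) : (jac k f).IsHomogeneous (∑ i, (d i - 1)) := by
  rw [jac, Matrix.det_apply]
  refine IsHomogeneous.sum _ _ _ fun σ _ => ?_
  have h : (∏ i, (Matrix.of fun i l => pderiv (k.succAbove l) (f i)) (σ i) i).IsHomogeneous
      (∑ i, (d i - 1)) := by
    rw [← Equiv.sum_comp σ]
    exact IsHomogeneous.prod _ _ _ fun i _ => (hf (σ i)).pderiv
  rcases Int.units_eq_one_or (Equiv.Perm.sign σ) with h' | h' <;> rw [h']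
  · simpa using h
  · simpa using h.neg

lemma map_jac {S' : Type*} [CommRing S'] (φ : S →+* S') (k : Fin (n + 1))
    (f : Fin n → MvPolynomial (Fin (n + 1)) S) :
    map φ (jac k f) = jac k (fun i => map φ (f i)) := by
  rw [jac, RingHom.map_det, jac]
  congr 1
  ext i l : 2
  simp [pderiv_map]

open Classical in
/-- The polynomial in the row of the Macaulay matrix indexed by `β`. -/
noncomputable def macRow (d : Fin n → ℕ) (k : Fin (n + 1))
    (f : Fin n → MvPolynomial (Fin (n + 1)) S) (β : Fin (n + 1) →₀ ℕ) :
    MvPolynomial (Fin (n + 1)) S :=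
  if h : ∃ i, d i ≤ β (k.succAbove i) then
    monomial (β - Finsupp.single (k.succAbove h.choose) (d h.choose)) 1 * f h.choose
  else monomial (β - Finsupp.single k (∑ i, (d i - 1))) 1 * jac k f

/-- The Macaulay matrix of a system in the chart `k`. -/
noncomputable def mac (d : Fin n → ℕ) (k : Fin (n + 1))
    (f : Fin n → MvPolynomial (Fin (n + 1)) S) :
    Matrix (Expo n (2 * ∑ i, (d i - 1))) (Expo n (2 * ∑ i, (d i - 1))) S :=
  Matrix.of fun β γ => coeff γ.1 (macRow d k f β.1)

lemma map_macRow {S' : Type*} [CommRing S'] (φ : S →+* S') (k : Fin (n + 1))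
    (f : Fin n → MvPolynomial (Fin (n + 1)) S) (β : Fin (n + 1) →₀ ℕ) :
    map φ (macRow d k f β) = macRow d k (fun i => map φ (f i)) β := by
  unfold macRow
  split_ifs with h
  · simp [map_monomial]
  · simp [map_monomial, map_jac]

lemma map_det_mac {S' : Type*} [CommRing S'] (φ : S →+* S') (k : Fin (n + 1))
    (f : Fin n → MvPolynomial (Fin (n + 1)) S) :
    φ (mac d k f).det = (mac d k (fun i => map φ (f i))).det := by
  rw [RingHom.map_det]
  congr 1
  ext β γ
  simp [mac, ← map_macRow, coeff_map]

lemma sum_eq_add_succAbove (k : Fin (n + 1)) (g : Fin (n + 1) → ℕ) :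
    ∑ l, g l = g k + ∑ i, g (k.succAbove i) := Fin.sum_univ_succAbove g k

lemma le_of_reduced {k : Fin (n + 1)} {β : Fin (n + 1) →₀ ℕ}
    (hβ : β ∈ Expo n (2 * ∑ i, (d i - 1))) (h : ¬ ∃ i, d i ≤ β (k.succAbove i)) :
    ∑ i, (d i - 1) ≤ β k := by
  push Not at h
  have h1 : ∑ i, β (k.succAbove i) ≤ ∑ i, (d i - 1) :=
    Finset.sum_le_sum fun i _ => by have := h i; omega
  have h2 := mem_Expo.mp hβ
  rw [sum_eq_add_succAbove k] at h2
  omega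

lemma single_le {l : Fin (n + 1)} {a : ℕ} {β : Fin (n + 1) →₀ ℕ} (h : a ≤ β l) :
    Finsupp.single l a ≤ β := by
  rwa [Finsupp.single_le_iff]

lemma isHomogeneous_monomial_mul {a b : ℕ} {p : MvPolynomial (Fin (n + 1)) S}
    (hp : p.IsHomogeneous b) {l : Fin (n + 1)} {β : Fin (n + 1) →₀ ℕ} (hβ : β ∈ Expo n a)
    (hl : b ≤ β l) : (monomial (β - Finsupp.single l b) 1 * p).IsHomogeneous a := by
  have h1 : Finsupp.degree (β - Finsupp.single l b) + b = a := by
    have h2 := congrArg Finsupp.degree (tsub_add_cancel_of_le (single_le hl))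
    rw [map_add, Finsupp.degree_single] at h2
    rw [h2, Finsupp.degree_eq_sum, mem_Expo.mp hβ]
  rw [← h1]
  exact (isHomogeneous_monomial 1 rfl).mul hp

lemma isHomogeneous_macRow (k : Fin (n + 1))
    {f : Fin n → MvPolynomial (Fin (n + 1)) S} (hf : ∀ i, (f i).IsHomogeneous (d i))
    {β : Fin (n + 1) →₀ ℕ} (hβ : β ∈ Expo n (2 * ∑ i, (d i - 1))) :
    (macRow d k f β).IsHomogeneous (2 * ∑ i, (d i - 1)) := by
  unfold macRow
  split_ifs with h
  · exact isHomogeneous_monomial_mul (hf _) hβ h.choose_spec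
  · exact isHomogeneous_monomial_mul (isHomogeneous_jac k hf) hβ (le_of_reduced hβ h)

lemma sum_coeff_mul {p : MvPolynomial (Fin (n + 1)) S} {a : ℕ} (hp : p.IsHomogeneous a)
    (g : (Fin (n + 1) →₀ ℕ) → S) :
    ∑ γ : (Expo n a : Finset _), coeff γ.1 p * g γ.1 = ∑ γ ∈ p.support, coeff γ p * g γ := by
  rw [Finset.sum_coe_sort (Expo n a) (fun γ => coeff γ p * g γ)]
  symm
  refine Finset.sum_subset (fun γ hγ => mem_Expo_of_coeff_ne_zero hp (mem_support_iff.mp hγ)) ?_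
  intro γ _ hγ
  rw [notMem_support_iff.mp hγ, zero_mul]

end Macaulay

section Vanishing
variable {n : ℕ} {d : Fin n → ℕ}

lemma dEval_self {p : MvPolynomial (Fin (n + 1)) ℝ} {a : ℕ} (hp : p.IsHomogeneous a)
    (x : Fin (n + 1) → ℝ) : dEval p x x = a * eval x p := by
  have := congrArg (eval x) hp.sum_X_mul_pderiv
  simp only [map_sum, map_mul, eval_X, nsmul_eq_mul, map_natCast] at this
  rw [← this, dEval]
  exact Finset.sum_congr rfl fun k _ => mul_comm _ _

lemma dEval_comb (p : MvPolynomial (Fin (n + 1)) ℝ) (x v w : Fin (n + 1) → ℝ) (a b : ℝ) :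
    dEval p x (a • v + b • w) = a * dEval p x v + b * dEval p x w := by
  simp only [dEval, Finset.mul_sum, ← Finset.sum_add_distrib]
  exact Finset.sum_congr rfl fun k _ => by simp; ring

lemma eval_jac_eq_zero (k : Fin (n + 1)) {f : Fin n → MvPolynomial (Fin (n + 1)) ℝ}
    (hf : ∀ i, (f i).IsHomogeneous (d i)) {x v : Fin (n + 1) → ℝ}
    (hxv : LinearIndependent ℝ ![x, v]) (h0 : ∀ i, eval x (f i) = 0)
    (h1 : ∀ i, dEval (f i) x v = 0) : eval x (jac k f) = 0 := by
  have hw : ∃ a b : ℝ, (a • x + b • v) k = 0 ∧ a • x + b • v ≠ 0 := by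
    rw [LinearIndependent.pair_iff] at hxv
    by_cases hk : x k = 0
    · exact ⟨1, 0, by simp [hk], fun h => one_ne_zero (hxv 1 0 h).1⟩
    · refine ⟨v k, -x k, by simp; ring, fun h => hk ?_⟩
      simpa using (hxv _ _ h).2
  obtain ⟨a, b, hwk, hw0⟩ := hw
  set w := a • x + b • v with hwdef
  have hdw : ∀ i, dEval (f i) x w = 0 := fun i => by
    rw [hwdef, dEval_comb, dEval_self (hf i), h0, h1]; ring
  rw [jac, RingHom.map_det]
  refine Matrix.exists_mulVec_eq_zero_iff.mp ⟨fun l => w (k.succAbove l), ?_, ?_⟩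
  · intro h
    apply hw0
    funext l
    rcases Fin.eq_self_or_eq_succAbove k l with rfl | ⟨l, rfl⟩
    · simpa using hwk
    · exact congrFun h l
  · funext i
    have := hdw i
    rw [dEval, Fin.sum_univ_succAbove _ k, hwk, mul_zero, zero_add] at this
    simpa [Matrix.mulVec, dotProduct] using this

lemma det_mac_eq_zero (k : Fin (n + 1))
    {f : Fin n → MvPolynomial (Fin (n + 1)) ℝ}
    (hf : ∀ i, (f i).IsHomogeneous (d i)) {x v : Fin (n + 1) → ℝ}
    (hxv : LinearIndependent ℝ ![x, v]) (h0 : ∀ i, eval x (f i) = 0)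
    (h1 : ∀ i, dEval (f i) x v = 0) : (mac d k f).det = 0 := by
  have hJ := eval_jac_eq_zero k hf hxv h0 h1
  have hx : x ≠ 0 := by simpa using hxv.ne_zero 0
  refine Matrix.exists_mulVec_eq_zero_iff.mp ⟨fun γ => ∏ l, x l ^ γ.1 l, ?_, ?_⟩
  · obtain ⟨l, hl⟩ := Function.ne_iff.mp hx
    intro h
    have := congrFun h ⟨Finsupp.single l (2 * ∑ i, (d i - 1)), mem_Expo.mpr (by
      simp [Finsupp.single_apply])⟩
    rw [Pi.zero_apply, Finset.prod_eq_zero_iff] at this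
    obtain ⟨m, -, hm⟩ := this
    rcases eq_or_ne l m with rfl | hlm
    · exact pow_ne_zero _ hl hm
    · simp [hlm] at hm
  · funext β
    simp only [Matrix.mulVec, dotProduct, mac, Matrix.of_apply]
    rw [sum_coeff_mul (isHomogeneous_macRow k hf β.2) (fun γ => ∏ l, x l ^ γ l), ← eval_eq']
    unfold macRow
    split_ifs with h
    · simp [h0]
    · simp [hJ]

end Vanishing

section Scaling
variable {n : ℕ} {S : Type*} [CommRing S] {d : Fin n → ℕ}

/-- Substitute `s * X k` for the variable `X k`. -/
noncomputable def scaleVar (k : Fin (n + 1)) (s : S) :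
    MvPolynomial (Fin (n + 1)) S →ₐ[S] MvPolynomial (Fin (n + 1)) S :=
  aeval fun l => if l = k then C s * X l else X l

lemma scaleVar_monomial (k : Fin (n + 1)) (s : S) (m : Fin (n + 1) →₀ ℕ) (a : S) :
    scaleVar k s (monomial m a) = C (s ^ m k) * monomial m a := by
  classical
  rw [scaleVar, aeval_monomial, monomial_eq, Finsupp.prod_fintype _ _ (by simp),
    Finsupp.prod_fintype _ _ (by simp)]
  have : ∀ l, (if l = k then C s * X l else X l : MvPolynomial (Fin (n + 1)) S) ^ m l =
      (if l = k then C (s ^ m k) else 1) * X l ^ m l := by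
    intro l
    split_ifs with h
    · subst h; simp [mul_pow]
    · simp
  simp only [this, Finset.prod_mul_distrib, Finset.prod_ite_eq', Finset.mem_univ, if_true,
    algebraMap_eq]
  ring

lemma coeff_scaleVar (k : Fin (n + 1)) (s : S) (p : MvPolynomial (Fin (n + 1)) S)
    (γ : Fin (n + 1) →₀ ℕ) : coeff γ (scaleVar k s p) = s ^ γ k * coeff γ p := by
  induction p using MvPolynomial.induction_on' with
  | monomial m a =>
    rw [scaleVar_monomial, coeff_C_mul, coeff_monomial]
    split_ifs with h
    · rw [h]
    · simp
  | add p q hp hq => rw [map_add, coeff_add, hp, hq, coeff_add, mul_add]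

lemma pderiv_scaleVar {k l : Fin (n + 1)} (hl : l ≠ k) (s : S)
    (p : MvPolynomial (Fin (n + 1)) S) :
    pderiv l (scaleVar k s p) = scaleVar k s (pderiv l p) := by
  ext γ
  simp only [coeff_pderiv, coeff_scaleVar]
  simp [hl, mul_assoc]

lemma jac_scaleVar (k : Fin (n + 1)) (s : S) (f : Fin n → MvPolynomial (Fin (n + 1)) S) :
    jac k (fun i => scaleVar k s (f i)) = scaleVar k s (jac k f) := by
  rw [jac, jac, AlgHom.map_det]
  congr 1
  ext i l : 2
  simp [pderiv_scaleVar (Fin.succAbove_ne k l)]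

lemma scaleVar_sys (k : Fin (n + 1)) (s : S) (c : Idx d → S) (i : Fin n) :
    scaleVar k s (sys d c i) = sys d (fun j => s ^ j.2.1 k * c j) i := by
  ext γ
  rw [coeff_scaleVar, coeff_sys, coeff_sys]
  split_ifs with h
  · rfl
  · simp

/-- `β` is reduced in the chart `k`. -/
def IsReduced (d : Fin n → ℕ) (k : Fin (n + 1)) (β : Fin (n + 1) →₀ ℕ) : Prop :=
  ¬ ∃ i, d i ≤ β (k.succAbove i)

open Classical in
/-- The weight of the `β`-th row of the Macaulay matrix. -/
noncomputable def rowWeight (d : Fin n → ℕ) (k : Fin (n + 1)) (β : Fin (n + 1) →₀ ℕ) : ℕ :=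
  if IsReduced d k β then β k - ∑ i, (d i - 1) else β k

lemma scaleVar_macRow (k : Fin (n + 1)) (s : S) (f : Fin n → MvPolynomial (Fin (n + 1)) S)
    (β : Fin (n + 1) →₀ ℕ) :
    C (s ^ rowWeight d k β) * macRow d k (fun i => scaleVar k s (f i)) β =
      scaleVar k s (macRow d k f β) := by
  unfold rowWeight IsReduced macRow
  by_cases h : ∃ i, d i ≤ β (k.succAbove i)
  · rw [if_neg (not_not.mpr h), dif_pos h, dif_pos h, map_mul, scaleVar_monomial]
    have : (β - Finsupp.single (k.succAbove h.choose) (d h.choose)) k = β k := by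
      simp
    rw [this]
    ring
  · rw [if_pos h, dif_neg h, dif_neg h, map_mul, scaleVar_monomial, jac_scaleVar]
    have : (β - Finsupp.single k (∑ i, (d i - 1))) k = β k - ∑ i, (d i - 1) := by simp
    rw [this]
    ring

/-- The exponent with `k`-th entry `a` and remaining entries `r`. -/
noncomputable def mkExpo (k : Fin (n + 1)) (a : ℕ) (r : Fin n → ℕ) : Fin (n + 1) →₀ ℕ :=
  Finsupp.equivFunOnFinite.symm (k.insertNth (α := fun _ => ℕ) a r)

@[simp] lemma mkExpo_self (k : Fin (n + 1)) (a : ℕ) (r : Fin n → ℕ) : mkExpo k a r k = a := by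
  simp [mkExpo]

@[simp] lemma mkExpo_succAbove (k : Fin (n + 1)) (a : ℕ) (r : Fin n → ℕ) (i : Fin n) :
    mkExpo k a r (k.succAbove i) = r i := by
  simp [mkExpo]

lemma expo_ext (k : Fin (n + 1)) {β γ : Fin (n + 1) →₀ ℕ} (h0 : β k = γ k)
    (h : ∀ i, β (k.succAbove i) = γ (k.succAbove i)) : β = γ := by
  ext l
  rcases Fin.eq_self_or_eq_succAbove k l with rfl | ⟨l, rfl⟩
  · exact h0
  · exact h l

lemma mkExpo_mem {k : Fin (n + 1)} {a : ℕ} {r : Fin n → ℕ} (h : ∑ i, r i ≤ a) :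
    mkExpo k (a - ∑ i, r i) r ∈ Expo n a := by
  rw [mem_Expo, sum_eq_add_succAbove k]
  simp
  omega

lemma sum_le_of_lt {r : Fin n → ℕ} (hr : ∀ i, r i < d i) : ∑ i, r i ≤ 2 * ∑ i, (d i - 1) := by
  have : ∑ i, r i ≤ ∑ i, (d i - 1) := Finset.sum_le_sum fun i _ => by have := hr i; omega
  omega

open Classical in
lemma card_reduced (k : Fin (n + 1)) :
    ((Expo n (2 * ∑ i, (d i - 1))).filter (IsReduced d k)).card = ∏ i, d i := by
  have : ∏ i, d i = (Fintype.piFinset fun i => Finset.range (d i)).card := by simp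
  rw [this]
  refine Finset.card_nbij' (fun β i => β (k.succAbove i))
    (fun r => mkExpo k (2 * ∑ i, (d i - 1) - ∑ i, r i) r) ?_ ?_ ?_ ?_
  · intro β hβ
    simp only [Finset.coe_filter, Set.mem_ofPred_eq, IsReduced, not_exists, not_le] at hβ
    simpa using hβ.2
  · intro r hr
    simp only [Finset.mem_coe, Fintype.mem_piFinset, Finset.mem_range] at hr
    simp only [Finset.coe_filter, Set.mem_ofPred_eq, IsReduced, not_exists, not_le]
    exact ⟨mkExpo_mem (sum_le_of_lt hr), fun i => by simpa using hr i⟩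
  · intro β hβ
    simp only [Finset.coe_filter, Set.mem_ofPred_eq] at hβ
    have := mem_Expo.mp hβ.1
    rw [sum_eq_add_succAbove k] at this
    refine expo_ext k ?_ fun i => by simp
    simp
    omega
  · intro r hr
    funext i
    simp

lemma sum_rowWeight (k : Fin (n + 1)) :
    ∑ β ∈ Expo n (2 * ∑ i, (d i - 1)), rowWeight d k β + (∑ i, (d i - 1)) * ∏ i, d i =
      ∑ β ∈ Expo n (2 * ∑ i, (d i - 1)), β k := by
  classical
  rw [← card_reduced k, mul_comm (∑ i, (d i - 1)), ← smul_eq_mul (Finset.card _),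
      ← Finset.sum_const, Finset.sum_filter,
    ← Finset.sum_add_distrib]
  refine Finset.sum_congr rfl fun β hβ => ?_
  unfold rowWeight
  split_ifs with h
  · have := le_of_reduced hβ h
    omega
  · rfl

lemma det_mac_scale [IsDomain S] (k : Fin (n + 1)) {s : S} (hs : s ≠ 0)
    (f : Fin n → MvPolynomial (Fin (n + 1)) S) :
    (mac d k (fun i => scaleVar k s (f i))).det =
      s ^ ((∑ i, (d i - 1)) * ∏ i, d i) * (mac d k f).det := by
  have h : Matrix.diagonal (fun β : (Expo n (2 * ∑ i, (d i - 1)) : Finset _) =>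
        s ^ rowWeight d k β.1) * mac d k (fun i => scaleVar k s (f i)) =
      mac d k f * Matrix.diagonal (fun γ => s ^ γ.1 k) := by
    ext β γ
    rw [Matrix.diagonal_mul, Matrix.mul_diagonal]
    simp only [mac, Matrix.of_apply]
    rw [← coeff_C_mul, scaleVar_macRow, coeff_scaleVar, mul_comm]
  have h2 := congrArg Matrix.det h
  rw [Matrix.det_mul, Matrix.det_mul, Matrix.det_diagonal, Matrix.det_diagonal,
    Finset.prod_pow_eq_pow_sum, Finset.prod_pow_eq_pow_sum,
    Finset.sum_coe_sort (Expo n (2 * ∑ i, (d i - 1))) (fun β => β k),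
    Finset.sum_coe_sort (Expo n (2 * ∑ i, (d i - 1))) (fun β => rowWeight d k β),
    ← sum_rowWeight, pow_add] at h2
  apply mul_left_cancel₀ (pow_ne_zero (∑ β ∈ Expo n (2 * ∑ i, (d i - 1)), rowWeight d k β) hs)
  rw [h2]
  ring

end Scaling

section Nonvanishing
variable {n : ℕ} {d : Fin n → ℕ}

/-- The system `x_i ^ d_i - x_k ^ d_i` in the chart `k`. -/
noncomputable def fermat (d : Fin n → ℕ) (k : Fin (n + 1)) (i : Fin n) :
    MvPolynomial (Fin (n + 1)) ℝ :=
  X (k.succAbove i) ^ d i - X k ^ d i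

lemma isHomogeneous_fermat (k : Fin (n + 1)) (i : Fin n) :
    (fermat d k i).IsHomogeneous (d i) := by
  refine IsHomogeneous.sub ?_ ?_
  · simpa using (isHomogeneous_X ℝ (k.succAbove i)).pow (d i)
  · simpa using (isHomogeneous_X ℝ k).pow (d i)

lemma monomial_mkExpo_zero (k : Fin (n + 1)) (a : Fin n → ℕ) :
    (monomial (mkExpo k 0 a) 1 : MvPolynomial (Fin (n + 1)) ℝ) =
      ∏ i, X (k.succAbove i) ^ a i := by
  rw [monomial_eq, Finsupp.prod_fintype _ _ (by simp), Fin.prod_univ_succAbove _ k]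
  simp

lemma jac_fermat (k : Fin (n + 1)) :
    jac k (fermat d k) = monomial (mkExpo k 0 fun i => d i - 1) (∏ i, (d i : ℝ)) := by
  have : (Matrix.of fun i l => pderiv (k.succAbove l) (fermat d k i)) =
      Matrix.diagonal fun i => C (d i : ℝ) * X (k.succAbove i) ^ (d i - 1) := by
    ext i l : 2
    rw [Matrix.of_apply, Matrix.diagonal_apply]
    split_ifs with h
    · subst h
      simp [fermat, pderiv_X_of_ne (Fin.succAbove_ne k i).symm]
    · simp [fermat, pderiv_X_of_ne (Fin.succAbove_ne k l).symm,
        pderiv_X_of_ne (fun hh => h (Fin.succAbove_right_injective hh) :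
          k.succAbove i ≠ k.succAbove l)]
  rw [jac, this, Matrix.det_diagonal, Finset.prod_mul_distrib, ← monomial_mkExpo_zero,
    ← map_prod, C_mul_monomial, mul_one]

lemma det_mac_fermat_ne_zero (hd : ∀ i, 1 ≤ d i) (k : Fin (n + 1)) :
    (mac d k (fermat d k)).det ≠ 0 := by
  classical
  intro hdet
  obtain ⟨v, hv0, hv⟩ := Matrix.exists_mulVec_eq_zero_iff.mpr hdet
  set Λ : (Fin (n + 1) →₀ ℕ) → ℝ :=
      fun γ => if h : γ ∈ Expo n (2 * ∑ i, (d i - 1)) then v ⟨γ, h⟩ else 0 with hΛ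
  have hΛv : ∀ γ : (Expo n (2 * ∑ i, (d i - 1)) : Finset _), Λ γ.1 = v γ := fun γ => dif_pos γ.2
  have hrow : ∀ β ∈ Expo n (2 * ∑ i, (d i - 1)), ∑ γ ∈ (macRow d k (fermat d k) β).support,
      coeff γ (macRow d k (fermat d k) β) * Λ γ = 0 := by
    intro β hβ
    rw [← sum_coeff_mul (isHomogeneous_macRow k (isHomogeneous_fermat k) hβ)]
    have := congrFun hv ⟨β, hβ⟩
    simp only [Matrix.mulVec, dotProduct, mac, Matrix.of_apply, Pi.zero_apply] at this
    rw [← this]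
    exact Finset.sum_congr rfl fun γ _ => by rw [hΛv]
  set Φ : MvPolynomial (Fin (n + 1)) ℝ → ℝ := fun p => ∑ γ ∈ p.support, coeff γ p * Λ γ with hΦ
  have hΦm : ∀ γ c, Φ (monomial γ c) = c * Λ γ := by
    intro γ c
    simp only [hΦ]
    rw [Finset.sum_subset (support_monomial_subset : (monomial γ c).support ⊆ {γ})]
    · simp
    · intro x _ hx
      rw [notMem_support_iff.mp hx, zero_mul]
  have hΦs : ∀ γ γ' : Fin (n + 1) →₀ ℕ,
      Φ (monomial γ 1 - monomial γ' 1) = Λ γ - Λ γ' := by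
    intro γ γ'
    have h1 : ∀ p : MvPolynomial (Fin (n + 1)) ℝ, p.support ⊆ {γ, γ'} →
        Φ p = ∑ x ∈ ({γ, γ'} : Finset _), coeff x p * Λ x := fun p hp =>
      Finset.sum_subset hp fun x _ hx => by rw [notMem_support_iff.mp hx, zero_mul]
    have h2 := hΦm γ 1
    have h3 := hΦm γ' 1
    rw [h1 _ (support_monomial_subset.trans (by simp))] at h2 h3
    rw [h1 _ ((support_sub _ _ _).trans (Finset.union_subset
      (support_monomial_subset.trans (by simp)) (support_monomial_subset.trans (by simp))))]
    simp only [coeff_sub, sub_mul, Finset.sum_sub_distrib, h2, h3, one_mul]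
  have hstep : ∀ β ∈ Expo n (2 * ∑ i, (d i - 1)), (∃ i, d i ≤ β (k.succAbove i)) →
      ∃ i, d i ≤ β (k.succAbove i) ∧
      Λ β = Λ (β - Finsupp.single (k.succAbove i) (d i) + Finsupp.single k (d i)) := by
    intro β hβ h
    refine ⟨h.choose, h.choose_spec, ?_⟩
    have h1 := hrow β hβ
    have h2 : macRow d k (fermat d k) β = monomial β 1 -
        monomial (β - Finsupp.single (k.succAbove h.choose) (d h.choose) +
          Finsupp.single k (d h.choose)) 1 := by
      rw [macRow, dif_pos h, fermat, mul_sub, X_pow_eq_monomial, X_pow_eq_monomial,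
        monomial_mul, monomial_mul, one_mul, tsub_add_cancel_of_le (single_le h.choose_spec)]
    change Φ _ = 0 at h1
    rw [h2, hΦs] at h1
    linarith
  have hres : ∀ m, ∀ β ∈ Expo n (2 * ∑ i, (d i - 1)), ∑ i, β (k.succAbove i) ≤ m →
      Λ β = Λ (mkExpo k (2 * ∑ i, (d i - 1) - ∑ i, β (k.succAbove i) % d i)
        fun i => β (k.succAbove i) % d i) := by
    intro m
    induction m with
    | zero =>
      intro β hβ hm
      have h0 : ∀ i, β (k.succAbove i) = 0 := by simpa using hm
      have hs := mem_Expo.mp hβ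
      rw [sum_eq_add_succAbove k] at hs
      congr 1
      refine expo_ext k ?_ fun i => by simp [h0]
      simp [h0] at hs ⊢
      exact hs
    | succ m ih =>
      intro β hβ hm
      have hs := mem_Expo.mp hβ
      rw [sum_eq_add_succAbove k] at hs
      by_cases h : ∃ i, d i ≤ β (k.succAbove i)
      · obtain ⟨i, hi, hΛi⟩ := hstep β hβ h
        set β' := β - Finsupp.single (k.succAbove i) (d i) + Finsupp.single k (d i) with hβ'
        have hk' : β' k = β k + d i := by
          simp [hβ']
        have hj' : ∀ j, β' (k.succAbove j) = β (k.succAbove j) - if i = j then d i else 0 := by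
          intro j
          simp [hβ', Finsupp.single_apply, Fin.succAbove_right_injective.eq_iff]
        have hsum : ∑ j, β' (k.succAbove j) + d i = ∑ j, β (k.succAbove j) := by
          have : ∑ j, (if i = j then d i else 0) = d i := by simp
          rw [← this, ← Finset.sum_add_distrib]
          refine Finset.sum_congr rfl fun j _ => ?_
          rw [hj']
          split_ifs with hij
          · subst hij; omega
          · simp
        have hmem : β' ∈ Expo n (2 * ∑ i, (d i - 1)) := by
          rw [mem_Expo, sum_eq_add_succAbove k]
          omega
        have hmod : ∀ j, β' (k.succAbove j) % d j = β (k.succAbove j) % d j := by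
          intro j
          rw [hj']
          split_ifs with hij
          · subst hij
            exact (Nat.mod_eq_sub_mod hi).symm
          · simp
        rw [hΛi, ih β' hmem (by have := hd i; omega)]
        simp only [hmod]
      · push Not at h
        have h' : ∀ i, β (k.succAbove i) % d i = β (k.succAbove i) := fun i =>
          Nat.mod_eq_of_lt (h i)
        congr 1
        refine expo_ext k ?_ fun i => by simp [h']
        simp [h']
        omega
  have hcyc : ∀ r : Fin n → ℕ, (∀ i, r i < d i) →
      Λ (mkExpo k (2 * ∑ i, (d i - 1) - ∑ i, (r i + (d i - 1)) % d i)
        fun i => (r i + (d i - 1)) % d i) = 0 := by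
    intro r hr
    have hβ : mkExpo k (2 * ∑ i, (d i - 1) - ∑ i, r i) r ∈ Expo n (2 * ∑ i, (d i - 1)) :=
        mkExpo_mem (sum_le_of_lt hr)
    have hred : ¬ ∃ i, d i ≤ mkExpo k (2 * ∑ i, (d i - 1) - ∑ i, r i) r (k.succAbove i) := by
      simpa using hr
    have hle := le_of_reduced hβ hred
    have h1 := hrow _ hβ
    change Φ _ = 0 at h1
    rw [macRow, dif_neg hred, jac_fermat, monomial_mul, one_mul, hΦm] at h1
    have h2 : Λ (mkExpo k (2 * ∑ i, (d i - 1) - ∑ i, r i) r - Finsupp.single k (∑ i, (d i - 1)) +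
        mkExpo k 0 fun i => d i - 1) = 0 := by
      refine (mul_eq_zero.mp h1).resolve_left (Finset.prod_ne_zero_iff.mpr fun i _ => ?_)
      have := hd i
      positivity
    rw [hres _ _ ?_ le_rfl] at h2
    · rw [← h2]
      simp
    · have hs := mem_Expo.mp hβ
      rw [sum_eq_add_succAbove k] at hs
      rw [mem_Expo, sum_eq_add_succAbove k]
      simp only [mkExpo_self, mkExpo_succAbove] at hs hle
      simp [Finset.sum_add_distrib]
      omega
  apply hv0
  funext γ
  have h1 := hΛv γ
  rw [← h1, hres _ γ.1 γ.2 le_rfl]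
  have h2 := hcyc (fun i => (γ.1 (k.succAbove i) + 1) % d i) fun i => Nat.mod_lt _ (hd i)
  have h3 : ∀ i, ((γ.1 (k.succAbove i) + 1) % d i + (d i - 1)) % d i =
      γ.1 (k.succAbove i) % d i := by
    intro i
    have := hd i
    rw [Nat.mod_add_mod, show γ.1 (k.succAbove i) + 1 + (d i - 1) = γ.1 (k.succAbove i) + d i by
      omega, Nat.add_mod_right]
  simp only [h3] at h2
  exact h2

end Nonvanishing

section PrincipalIdeal

open Polynomial in
lemma natDegree_pseudo_rem_lt {A : Type*} [CommRing A] [IsDomain A] {P H : A[X]}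
    (hP : 0 < P.natDegree) (hPH : P.natDegree ≤ H.natDegree) :
    (Polynomial.C P.leadingCoeff * H -
        Polynomial.C H.leadingCoeff * Polynomial.X ^ (H.natDegree - P.natDegree) * P).natDegree <
      H.natDegree := by
  have hP0 : P ≠ 0 := by rintro rfl; simp at hP
  have hH0 : H ≠ 0 := by rintro rfl; simp at hPH; omega
  have h1 : P.leadingCoeff ≠ 0 := leadingCoeff_ne_zero.mpr hP0
  have h2 : H.leadingCoeff ≠ 0 := leadingCoeff_ne_zero.mpr hH0
  rcases eq_or_ne (Polynomial.C P.leadingCoeff * H -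
    Polynomial.C H.leadingCoeff * Polynomial.X ^ (H.natDegree - P.natDegree) * P) 0 with h0 | h0
  · rw [h0]; simp; omega
  refine natDegree_lt_natDegree h0 ?_
  have hd : (Polynomial.C P.leadingCoeff * H).degree = H.degree := by
    rw [degree_mul, degree_C h1, zero_add]
  rw [← hd]
  refine degree_sub_lt_left ?_ (mul_ne_zero (Polynomial.C_ne_zero.mpr h1) hH0) ?_
  · rw [degree_mul, degree_mul, degree_mul, degree_C h1, degree_C h2, degree_X_pow,
      degree_eq_natDegree hP0, degree_eq_natDegree hH0, zero_add, zero_add]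
    norm_cast
    omega
  · rw [leadingCoeff_mul, leadingCoeff_mul, leadingCoeff_mul, leadingCoeff_C, leadingCoeff_C,
      leadingCoeff_X_pow, mul_one, mul_comm]

open Polynomial in
/-- A nonzero prime ideal of `A[X]` contracting to `0` in a factorial ring `A` has a common divisor
inside the ideal. -/
lemma exists_dvd_of_prime_ideal {A : Type*} [CommRing A] [IsDomain A]
    [UniqueFactorizationMonoid A] {J : Ideal A[X]} (hJ : J.IsPrime) (hJ0 : J ≠ ⊥)
    (hC : ∀ a, Polynomial.C a ∈ J → a = 0) : ∃ P ∈ J, P ≠ 0 ∧ ∀ H ∈ J, P ∣ H := by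
  classical
  have hex : ∃ k, ∃ G ∈ J, G ≠ 0 ∧ G.natDegree = k := by
    obtain ⟨G, hG, hG0⟩ := Submodule.exists_mem_ne_zero_of_ne_bot hJ0
    exact ⟨_, G, hG, hG0, rfl⟩
  obtain ⟨G, hG, hG0, hGk⟩ := Nat.find_spec hex
  have hmin : ∀ H ∈ J, H ≠ 0 → G.natDegree ≤ H.natDegree := fun H hH hH0 => by
    rw [hGk]
    exact Nat.find_min' hex ⟨H, hH, hH0, rfl⟩
  obtain ⟨s, hs, u, hu⟩ := UniqueFactorizationMonoid.exists_prime_factors G hG0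
  have hsJ : s.prod ∈ J := by
    have : s.prod * u ∈ J := hu ▸ hG
    exact (hJ.mem_or_mem this).resolve_right fun h =>
      hJ.ne_top (Ideal.eq_top_of_isUnit_mem _ h u.isUnit)
  obtain ⟨P, hPs, hPJ⟩ := (Ideal.IsPrime.multiset_prod_mem_iff_exists_mem hJ s).mp hsJ
  have hPp := hs P hPs
  have hPG : P ∣ G := (Multiset.dvd_prod hPs).trans ⟨u, hu.symm⟩
  have hPd : P.natDegree ≤ G.natDegree := natDegree_le_of_dvd hPG hG0
  have hPpos : 0 < P.natDegree := by
    by_contra h0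
    have h1 := eq_C_of_natDegree_eq_zero (by omega : P.natDegree = 0)
    rw [h1] at hPJ
    rw [hC _ hPJ] at h1
    exact hPp.ne_zero (by simpa using h1)
  have key : ∀ k, ∀ H ∈ J, H.natDegree = k → ∃ a, a ≠ 0 ∧ P ∣ Polynomial.C a * H := by
    intro k
    induction k using Nat.strong_induction_on with
    | _ k ih =>
      intro H hH hk
      rcases eq_or_ne H 0 with rfl | hH0
      · exact ⟨1, one_ne_zero, by simp⟩
      have hle := hPd.trans (hmin H hH hH0)
      have hmem : Polynomial.C P.leadingCoeff * H - Polynomial.C H.leadingCoeff *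
          Polynomial.X ^ (H.natDegree - P.natDegree) * P ∈ J :=
        J.sub_mem (J.mul_mem_left _ hH) (J.mul_mem_left _ hPJ)
      obtain ⟨a, ha, hdvd⟩ := ih _ (hk ▸ natDegree_pseudo_rem_lt hPpos hle) _ hmem rfl
      refine ⟨a * P.leadingCoeff, mul_ne_zero ha (leadingCoeff_ne_zero.mpr hPp.ne_zero), ?_⟩
      have h2 : Polynomial.C (a * P.leadingCoeff) * H =
          Polynomial.C a * (Polynomial.C P.leadingCoeff * H -
          Polynomial.C H.leadingCoeff * Polynomial.X ^ (H.natDegree - P.natDegree) * P) +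
          Polynomial.C a * (Polynomial.C H.leadingCoeff *
            Polynomial.X ^ (H.natDegree - P.natDegree)) * P := by
        rw [Polynomial.C_mul]; ring
      rw [h2]
      exact dvd_add hdvd (dvd_mul_left _ _)
  refine ⟨P, hPJ, hPp.ne_zero, fun H hH => ?_⟩
  obtain ⟨a, ha, hdvd⟩ := key _ H hH rfl
  refine (hPp.dvd_or_dvd hdvd).resolve_left fun h => ?_
  have := natDegree_le_of_dvd h (Polynomial.C_ne_zero.mpr ha)
  rw [natDegree_C] at this
  omega

end PrincipalIdeal

section Tangent

open Filter Topology

lemma eval_smul_of_isHomogeneous {κ S : Type*} [CommSemiring S] {p : MvPolynomial κ S} {a : ℕ}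
    (hp : p.IsHomogeneous a) (s : S) (y : κ → S) : eval (s • y) p = s ^ a * eval y p := by
  rw [eval_eq, eval_eq, Finset.mul_sum]
  refine Finset.sum_congr rfl fun m hm => ?_
  have h := hp (mem_support_iff.mp hm)
  rw [Finsupp.weight_apply, Finsupp.sum] at h
  simp only [Pi.smul_apply, smul_eq_mul, mul_pow, Finset.prod_mul_distrib,
      Finset.prod_pow_eq_pow_sum]
  simp only [Pi.one_apply, smul_eq_mul, mul_one] at h
  rw [h]
  ring

/-- A polynomial vanishing along curves issued from a point with arbitrary velocity is zero. -/
lemma eq_zero_of_curves {κ : Type*} (Q : MvPolynomial κ ℝ) (c : κ → ℝ)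
    (h : ∀ L : κ → ℝ, ∃ η : ℝ → κ → ℝ, (∀ k, Tendsto (fun t => η t k) (𝓝[≠] 0) (𝓝 (L k))) ∧
      ∀ t ≠ 0, eval (c + t • η t) Q = 0) : Q = 0 := by
  classical
  set T : MvPolynomial κ ℝ := bind₁ (fun k => X k + C (c k)) Q with hT
  have hTe : ∀ y, eval y T = eval (c + y) Q := by
    intro y
    rw [hT, ← aeval_eq_eval, ← aeval_eq_eval]
    change aeval y (bind₁ _ Q) = aeval _ Q
    rw [aeval_bind₁]
    congr 2
    funext k
    simp [add_comm]
  suffices hT0 : T = 0 by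
    refine MvPolynomial.funext fun y => ?_
    have := hTe (y - c)
    rw [hT0] at this
    simpa using this.symm
  by_contra hne
  have hex : ∃ k, homogeneousComponent k T ≠ 0 := by
    by_contra hall
    push Not at hall
    apply hne
    rw [← sum_homogeneousComponent T]
    exact Finset.sum_eq_zero fun k _ => hall k
  set k := Nat.find hex with hk
  have hk0 : homogeneousComponent k T ≠ 0 := Nat.find_spec hex
  have hlow : ∀ i < k, homogeneousComponent i T = 0 := fun i hi => by
    by_contra h'
    exact Nat.find_min hex hi h'
  apply hk0
  refine MvPolynomial.funext fun L => ?_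
  obtain ⟨η, hη, hη0⟩ := h L
  rw [map_zero]
  have hcont : ∀ i, Tendsto (fun t => eval (η t) (homogeneousComponent i T)) (𝓝[≠] 0)
      (𝓝 (eval L (homogeneousComponent i T))) := fun i =>
    ((MvPolynomial.continuous_eval _).tendsto L).comp (tendsto_pi_nhds.mpr hη)
  have hsum : ∀ t : ℝ, t ≠ 0 → ∑ i ∈ range (T.totalDegree + 1),
      t ^ (i - k) * eval (η t) (homogeneousComponent i T) = 0 := by
    intro t ht
    have h1 := hTe (t • η t)
    rw [hη0 t ht] at h1
    have h2 : t ^ k * ∑ i ∈ range (T.totalDegree + 1),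
      t ^ (i - k) * eval (η t) (homogeneousComponent i T) = 0 := by
      rw [← h1]
      conv_rhs => rw [← sum_homogeneousComponent T, map_sum]
      rw [Finset.mul_sum]
      refine Finset.sum_congr rfl fun i _ => ?_
      rcases lt_or_ge i k with hi | hi
      · rw [hlow i hi]; simp
      · rw [← mul_assoc, ← pow_add, Nat.add_sub_cancel' hi,
          eval_smul_of_isHomogeneous (homogeneousComponent_isHomogeneous i T)]
    exact (mul_eq_zero.mp h2).resolve_left (pow_ne_zero _ ht)
  have hlim : Tendsto (fun t : ℝ => ∑ i ∈ range (T.totalDegree + 1),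
      t ^ (i - k) * eval (η t) (homogeneousComponent i T)) (𝓝[≠] 0)
      (𝓝 (∑ i ∈ range (T.totalDegree + 1),
        (0:ℝ) ^ (i - k) * eval L (homogeneousComponent i T))) := by
    refine tendsto_finsetSum _ fun i _ => Tendsto.mul ?_ (hcont i)
    exact ((continuous_pow (i - k)).tendsto 0).mono_left nhdsWithin_le_nhds
  have hlim0 : Tendsto (fun t : ℝ => ∑ i ∈ range (T.totalDegree + 1),
      t ^ (i - k) * eval (η t) (homogeneousComponent i T)) (𝓝[≠] 0) (𝓝 0) := by
    refine tendsto_const_nhds.congr' ?_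
    filter_upwards [self_mem_nhdsWithin] with t ht
    exact (hsum t ht).symm
  have := tendsto_nhds_unique hlim hlim0
  rw [Finset.sum_eq_single k] at this
  · simpa using this
  · intro i _ hik
    rcases lt_or_ge i k with hi | hi
    · rw [hlow i hi]; simp
    · rw [zero_pow (by omega), zero_mul]
  · intro hk'
    rw [homogeneousComponent_eq_zero]
    · simp
    · simpa [Nat.lt_succ_iff] using hk'

end Tangent

section Param
variable {n : ℕ} {S : Type*} [CommRing S] {d : Fin n → ℕ}

/-- A vector proportional to the component of `v` orthogonal to `x`. -/
def perp {m : ℕ} (x v : Fin m → S) : Fin m → S :=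
  fun l => (x ⬝ᵥ x) * v l - (x ⬝ᵥ v) * x l

/-- A parametrization of the systems having a degenerate zero. -/
noncomputable def psi (d : Fin n → ℕ) (c : Idx d → S) (x v : Fin (n + 1) → S) (i : Fin n) :
    MvPolynomial (Fin (n + 1)) S :=
  C ((x ⬝ᵥ x) ^ d i * (perp x v ⬝ᵥ perp x v)) * sys d c i -
    C ((perp x v ⬝ᵥ perp x v) * eval x (sys d c i)) * linForm x ^ d i -
    C ((x ⬝ᵥ x) * dEval (sys d c i) x (perp x v)) *
      (linForm (perp x v) * linForm x ^ (d i - 1))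

lemma map_psi {S' : Type*} [CommRing S'] (φ : S →+* S') (c : Idx d → S) (x v : Fin (n + 1) → S)
    (i : Fin n) :
    map φ (psi d c x v i) = psi d (fun j => φ (c j)) (fun l => φ (x l)) (fun l => φ (v l)) i := by
  have hdot : ∀ y z : Fin (n + 1) → S,
      φ (y ⬝ᵥ z) = (fun l => φ (y l)) ⬝ᵥ (fun l => φ (z l)) := fun y z => by
    simp [dotProduct]
  have hperp : (fun l => φ (perp x v l)) = perp (fun l => φ (x l)) (fun l => φ (v l)) := by
    funext l
    simp [perp, hdot]
  have hev : ∀ p : MvPolynomial (Fin (n + 1)) S,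
      φ (eval x p) = eval (fun l => φ (x l)) (map φ p) := fun p => by
    rw [eval_map]
    exact eval₂_comp_left φ (RingHom.id S) x p
  have hde : ∀ (p : MvPolynomial (Fin (n + 1)) S) (w : Fin (n + 1) → S),
      φ (dEval p x w) = dEval (map φ p) (fun l => φ (x l)) (fun l => φ (w l)) := fun p w => by
    simp only [dEval, map_sum, map_mul, hev, pderiv_map]
  have hlin : ∀ y : Fin (n + 1) → S, map φ (linForm y) = linForm (fun l => φ (y l)) := fun y => by
    simp [linForm]
  simp only [psi, map_sub, map_mul, map_C, map_pow, map_sys, hlin, hdot, hev, hde, hperp]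

lemma isHomogeneous_psi (hd : ∀ i, 1 ≤ d i) (c : Idx d → ℝ) (x v : Fin (n + 1) → ℝ) (i : Fin n) :
    (psi d c x v i).IsHomogeneous (d i) := by
  have hC : ∀ (a : ℝ) {p : MvPolynomial (Fin (n + 1)) ℝ}, p.IsHomogeneous (d i) →
      (C a * p).IsHomogeneous (d i) := fun a p hp => by
    simpa using (isHomogeneous_C _ a).mul hp
  have h := (isHomogeneous_linForm (perp x v)).mul (isHomogeneous_linForm_pow x (d i - 1))
  rw [show 1 + (d i - 1) = d i by have := hd i; omega] at h
  exact ((hC _ (isHomogeneous_sys c i)).sub (hC _ (isHomogeneous_linForm_pow x (d i)))).sub (hC _ h)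

lemma dot_perp {m : ℕ} (x v : Fin m → S) : x ⬝ᵥ perp x v = 0 := by
  have : perp x v = (x ⬝ᵥ x) • v - (x ⬝ᵥ v) • x := by
    funext l; simp [perp]
  rw [this, dotProduct_sub, dotProduct_smul, dotProduct_smul, smul_eq_mul, smul_eq_mul]
  ring

lemma eval_psi (c : Idx d → S) (x v : Fin (n + 1) → S) (i : Fin n) :
    eval x (psi d c x v i) = 0 := by
  have h1 : eval x (linForm x) = x ⬝ᵥ x := eval_linForm x x
  have h2 : eval x (linForm (perp x v)) = 0 := by
    rw [eval_linForm, ← dot_perp x v]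
    exact dotProduct_comm (perp x v) x
  simp only [psi, map_sub, map_mul, eval_C, map_pow, h1, h2]
  ring

lemma dEval_psi (hd : ∀ i, 1 ≤ d i) (c : Idx d → S) (x v : Fin (n + 1) → S) (i : Fin n) :
    dEval (psi d c x v i) x (perp x v) = 0 := by
  have h1 : eval x (linForm x) = x ⬝ᵥ x := eval_linForm x x
  have h2 : eval x (linForm (perp x v)) = 0 := by
    rw [eval_linForm, ← dot_perp x v]
    exact dotProduct_comm (perp x v) x
  have h3 : dEval (linForm x) x (perp x v) = 0 := by
    rw [dEval_linForm, ← dot_perp x v]; rfl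
  have h4 : dEval (linForm (perp x v)) x (perp x v) = perp x v ⬝ᵥ perp x v := by
    rw [dEval_linForm]; rfl
  simp only [psi, dEval_sub, dEval_C, dEval_mul, dEval_pow, h1, h2, h3, h4, map_pow, map_mul,
      eval_C]
  obtain ⟨a, ha⟩ := Nat.exists_eq_add_of_le (hd i)
  rw [ha, Nat.add_sub_cancel_left]
  ring

lemma psi_eq_self {f : Fin n → MvPolynomial (Fin (n + 1)) ℝ}
    (hf : IsSystem d f) {x v : Fin (n + 1) → ℝ} (hx : ∑ k, x k ^ 2 = 1) (hv : ∑ k, v k ^ 2 = 1)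
    (hxv : ∑ k, v k * x k = 0) (h : ∀ i, eval x (f i) = 0 ∧ dEval (f i) x v = 0) (i : Fin n) :
    psi d (coefs d f) x v i = f i := by
  have hxx : x ⬝ᵥ x = 1 := by rw [← hx]; exact Finset.sum_congr rfl fun k _ => (sq _).symm
  have hvv : v ⬝ᵥ v = 1 := by rw [← hv]; exact Finset.sum_congr rfl fun k _ => (sq _).symm
  have hx0 : x ⬝ᵥ v = 0 := by rw [dotProduct_comm]; exact hxv
  have hp : perp x v = v := by funext l; simp [perp, hxx, hx0]
  rw [psi, hp, sys_coefs hf, (h i).1, (h i).2, hxx, hvv]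
  simp

lemma degenerate_zero (hn : 1 ≤ n) :
    Degenerate (fun _ : Fin n => (0 : MvPolynomial (Fin (n + 1)) ℝ)) := by
  obtain ⟨v, hv, hvx⟩ := exists_unit_orthogonal hn (Pi.single 0 1 : Fin (n + 1) → ℝ)
  refine ⟨Pi.single 0 1, v, ?_, hv, hvx, fun i => by simp [dEval]⟩
  rw [Finset.sum_eq_single 0] <;> simp +contextual

lemma dEval_smul {p : MvPolynomial (Fin (n + 1)) ℝ} {a : ℕ} (hp : p.IsHomogeneous a) (s r : ℝ)
    (x v : Fin (n + 1) → ℝ) : dEval p (s • x) (r • v) = s ^ (a - 1) * r * dEval p x v := by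
  simp only [dEval, Finset.mul_sum]
  refine Finset.sum_congr rfl fun k _ => ?_
  rw [eval_smul_of_isHomogeneous hp.pderiv]
  simp; ring

lemma degenerate_of_orthogonal {f : Fin n → MvPolynomial (Fin (n + 1)) ℝ}
    (hf : IsSystem d f) {x w : Fin (n + 1) → ℝ} (hx : x ≠ 0) (hw : w ≠ 0) (hxw : x ⬝ᵥ w = 0)
    (h0 : ∀ i, eval x (f i) = 0) (h1 : ∀ i, dEval (f i) x w = 0) : Degenerate f := by
  have hn : ∀ y : Fin (n + 1) → ℝ, y ≠ 0 → ∑ k, ((Real.sqrt (y ⬝ᵥ y))⁻¹ • y) k ^ 2 = 1 := by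
    intro y hy
    have hpos : 0 < y ⬝ᵥ y :=
      lt_of_le_of_ne (Finset.sum_nonneg fun k _ => mul_self_nonneg _)
        (Ne.symm (mt dotProduct_self_eq_zero.mp hy))
    simp only [Pi.smul_apply, smul_eq_mul, mul_pow, ← Finset.mul_sum, inv_pow, Real.sq_sqrt hpos.le]
    rw [inv_mul_eq_one₀ hpos.ne']
    exact Finset.sum_congr rfl fun k _ => (sq _).symm
  refine ⟨_, _, hn x hx, hn w hw, ?_, fun i => ⟨?_, ?_⟩⟩
  · change ((Real.sqrt (w ⬝ᵥ w))⁻¹ • w) ⬝ᵥ ((Real.sqrt (x ⬝ᵥ x))⁻¹ • x) = 0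
    rw [smul_dotProduct, dotProduct_smul, dotProduct_comm w x, hxw]; simp
  · rw [eval_smul_of_isHomogeneous (hf i), h0, mul_zero]
  · rw [dEval_smul (hf i), h1, mul_zero]

lemma degenerate_of_linearIndependent {f : Fin n → MvPolynomial (Fin (n + 1)) ℝ}
    (hf : IsSystem d f) {x v : Fin (n + 1) → ℝ} (hx : x ≠ 0) (hv : ∀ a : ℝ, v ≠ a • x)
    (h0 : ∀ i, eval x (f i) = 0) (h1 : ∀ i, dEval (f i) x v = 0) : Degenerate f := by
  have hxx : x ⬝ᵥ x ≠ 0 := mt dotProduct_self_eq_zero.mp hx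
  have hp : perp x v = (x ⬝ᵥ x) • v + (-(x ⬝ᵥ v)) • x := by
    funext l; simp [perp, sub_eq_add_neg]
  refine degenerate_of_orthogonal hf hx ?_ (dot_perp x v) h0 fun i => ?_
  · intro h
    apply hv ((x ⬝ᵥ v) / (x ⬝ᵥ x))
    funext l
    have := congrFun h l
    simp only [perp, Pi.zero_apply] at this
    simp only [Pi.smul_apply, smul_eq_mul]
    field_simp
    linarith
  · rw [hp, dEval_comb, dEval_self (hf i), h0, h1]; ring

lemma degenerate_psi (hn : 1 ≤ n) (hd : ∀ i, 1 ≤ d i) (c : Idx d → ℝ) (x v : Fin (n + 1) → ℝ) :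
    Degenerate (psi d c x v) := by
  by_cases hw : perp x v = 0
  · have : psi d c x v = fun _ => 0 := by
      funext i
      simp [psi, hw, linForm, dEval]
    rw [this]
    exact degenerate_zero hn
  · refine degenerate_of_orthogonal (isHomogeneous_psi hd c x v) ?_ hw (dot_perp x v)
      (fun i => eval_psi c x v i) (fun i => dEval_psi hd c x v i)
    rintro rfl
    apply hw
    funext l
    simp [perp]

/-- The parametrization of degenerate systems at the level of coordinate rings. -/
noncomputable def theta (d : Fin n → ℕ) : MvPolynomial (Idx d) ℝ →ₐ[ℝ]
    MvPolynomial (Idx d ⊕ (Fin (n + 1) ⊕ Fin (n + 1))) ℝ :=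
  aeval (coefs d (psi d (fun j => X (Sum.inl j)) (fun l => X (Sum.inr (Sum.inl l)))
    (fun l => X (Sum.inr (Sum.inr l)))))

/-- The ideal of polynomials in the coefficients vanishing on degenerate systems. -/
noncomputable def discIdeal (d : Fin n → ℕ) : Ideal (MvPolynomial (Idx d) ℝ) :=
  RingHom.ker (theta d).toRingHom

instance isPrime_discIdeal : (discIdeal d).IsPrime := RingHom.ker_isPrime _

lemma eval_theta (p : Idx d ⊕ (Fin (n + 1) ⊕ Fin (n + 1)) → ℝ) (Q : MvPolynomial (Idx d) ℝ) :
    eval p (theta d Q) = eval (coefs d (psi d (fun j => p (Sum.inl j))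
      (fun l => p (Sum.inr (Sum.inl l))) (fun l => p (Sum.inr (Sum.inr l))))) Q := by
  rw [theta, aeval_def, eval_eval₂, ← eval₂_id]
  congr 1
  · ext; simp
  · funext j
    rw [coefs, ← coeff_map, map_psi]
    simp [coefs]

lemma mem_discIdeal (hn : 1 ≤ n) (hd : ∀ i, 1 ≤ d i) {Q : MvPolynomial (Idx d) ℝ} :
    Q ∈ discIdeal d ↔ ∀ f, IsSystem d f → Degenerate f → eval (coefs d f) Q = 0 := by
  constructor
  · rintro hQ f hf ⟨x, v, hx, hv, hxv, h⟩
    have h1 := eval_theta (Sum.elim (coefs d f) (Sum.elim x v)) Q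
    rw [show theta d Q = 0 from hQ, map_zero] at h1
    rw [h1]
    congr 3
    funext i
    exact (psi_eq_self hf hx hv hxv h i).symm
  · intro h
    change theta d Q = 0
    refine MvPolynomial.funext fun p => ?_
    rw [eval_theta, map_zero]
    exact h _ (isHomogeneous_psi hd _ _ _) (degenerate_psi hn hd _ _ _)

end Param

section Dominance
variable {n : ℕ} {d : Fin n → ℕ}

lemma dEval_X {m : ℕ} {S : Type*} [CommRing S] (k : Fin m) (x v : Fin m → S) :
    dEval (X k) x v = v k := by
  simp [dEval, pderiv_X, Pi.single_apply]

/-- The index of the coefficient of `X₀ ^ dⱼ` in the `j`-th polynomial. -/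
noncomputable def leadIdx (d : Fin n → ℕ) (j : Fin n) : Idx d :=
  ⟨j, Finsupp.single 0 (d j), mem_Expo.mpr (by simp [Finsupp.single_apply])⟩

/-- The base point of the curves used in `eq_zero_of_rename_mem_discIdeal`. -/
noncomputable def baseSys (d : Fin n → ℕ) (j i : Fin n) : MvPolynomial (Fin (n + 1)) ℝ :=
  if i = j then X 0 ^ (d i - 2) * X j.succ ^ 2 else X 0 ^ (d i - 1) * X i.succ

lemma isHomogeneous_baseSys (hd : ∀ i, 1 ≤ d i) {j : Fin n} (hj : 2 ≤ d j) (i : Fin n) :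
    (baseSys d j i).IsHomogeneous (d i) := by
  unfold baseSys
  split_ifs with h
  · subst h
    have := ((isHomogeneous_X ℝ (0 : Fin (n + 1))).pow (d i - 2)).mul
      ((isHomogeneous_X ℝ i.succ).pow 2)
    rwa [one_mul, one_mul, Nat.sub_add_cancel hj] at this
  · have := ((isHomogeneous_X ℝ (0 : Fin (n + 1))).pow (d i - 1)).mul (isHomogeneous_X ℝ i.succ)
    rwa [one_mul, Nat.sub_add_cancel (hd i)] at this

open Filter Topology in
/-- No nonzero equation of the degenerate systems avoids the coefficient `leadIdx d j`. -/
lemma eq_zero_of_rename_mem_discIdeal (hn : 1 ≤ n) (hd : ∀ i, 1 ≤ d i) {j : Fin n} (hj : 2 ≤ d j)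
    (a : MvPolynomial {b : Idx d // b ≠ leadIdx d j} ℝ)
    (ha : rename Subtype.val a ∈ discIdeal d) : a = 0 := by
  classical
  refine eq_zero_of_curves a (fun b => coefs d (baseSys d j) b.1) fun L => ?_
  set g : Fin n → MvPolynomial (Fin (n + 1)) ℝ :=
    sys d (fun b => if h : b = leadIdx d j then 0 else L ⟨b, h⟩) with hg
  set δ : Fin n → ℝ := fun i => dEval (g i) (Fin.cons 1 0) (Fin.cons 0 (Pi.single j 1)) with hδ
  set α : Fin n → ℝ := fun i => if i = j then -δ j / 2 else -eval (Fin.cons 1 0) (g i) with hα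
  set x : ℝ → Fin (n + 1) → ℝ := fun t => Fin.cons 1 (t • α) with hx
  set v : ℝ → Fin (n + 1) → ℝ := fun t => Fin.cons 0 (fun i => if i = j then 1 else t * -δ i)
    with hv
  set Q : ℝ → Fin n → ℝ := fun t i => δ i - dEval (g i) (x t) (v t) with hQ
  set P : ℝ → Fin n → ℝ := fun t i => -((if i = j then t * α j ^ 2 else α i) + eval (x t) (g i)) -
    Q t i * (t * α j) with hP
  set F : ℝ → Fin n → MvPolynomial (Fin (n + 1)) ℝ := fun t i =>
    g i + C (P t i) * X 0 ^ (d i) + C (Q t i) * (X 0 ^ (d i - 1) * X j.succ) with hF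
  have hxc : Continuous x := by
    refine continuous_pi fun k => ?_
    refine Fin.cases ?_ (fun i => ?_) k
    · simp only [hx, Fin.cons_zero]; fun_prop
    · simp only [hx, Fin.cons_succ, Pi.smul_apply]; fun_prop
  have hvc : Continuous v := by
    refine continuous_pi fun k => ?_
    refine Fin.cases ?_ (fun i => ?_) k
    · simp only [hv, Fin.cons_zero]; fun_prop
    · simp only [hv, Fin.cons_succ]
      split_ifs <;> fun_prop
  have hevc : ∀ p : MvPolynomial (Fin (n + 1)) ℝ, Continuous fun t => eval (x t) p := fun p =>
    (MvPolynomial.continuous_eval p).comp hxc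
  have hQc : ∀ i, Continuous fun t => Q t i := fun i => by
    refine continuous_const.sub (continuous_finsetSum _ fun k _ => (hevc _).mul ?_)
    exact (continuous_apply k).comp hvc
  have hPc : ∀ i, Continuous fun t => P t i := fun i => by
    refine Continuous.sub (Continuous.neg (Continuous.add ?_ (hevc _))) ((hQc i).mul (by fun_prop))
    split_ifs <;> fun_prop
  have hx0 : x 0 = Fin.cons 1 0 := by simp [hx]
  have hv0 : v 0 = Fin.cons 0 (Pi.single j 1) := by
    simp only [hv, zero_mul]
    congr 1
    funext i
    simp [Pi.single_apply]
  have hQ0 : ∀ i, Q 0 i = 0 := fun i => by simp [hQ, hx0, hv0, hδ]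
  have hP0 : ∀ i, i ≠ j → P 0 i = 0 := fun i hi => by simp [hP, hQ0, hx0, hα, hi]
  refine ⟨fun t b => coefs d (F t) b.1, fun b => ?_, fun t ht => ?_⟩
  · have hcont : Continuous fun t => coefs d (F t) b.1 := by
      simp only [coefs, hF, coeff_add, coeff_C_mul]
      exact (continuous_const.add ((hPc _).mul continuous_const)).add ((hQc _).mul continuous_const)
    have h0 : coefs d (F 0) b.1 = L b := by
      have hb : coefs d g b.1 = L b := by
        rw [hg, coefs_sys]
        simp [b.2]
      rw [← hb]
      obtain ⟨⟨i, β⟩, hb'⟩ := b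
      simp only [coefs, hF, coeff_add, coeff_C_mul, hQ0]
      by_cases hi : i = j
      · have : coeff β.1 (X 0 ^ d i : MvPolynomial (Fin (n + 1)) ℝ) = 0 := by
          rw [coeff_X_pow, if_neg]
          rintro h
          subst hi
          exact hb' (by
            unfold leadIdx
            congr 1
            exact Subtype.ext h.symm)
        rw [this]; ring
      · rw [hP0 i hi]; ring
    have := (hcont.tendsto 0).mono_left (nhdsWithin_le_nhds (s := {0}ᶜ))
    rwa [h0] at this
  · have hhom : IsSystem d (fun i => baseSys d j i + C t * F t i) := fun i => by
      have hC : ∀ (a : ℝ) {p : MvPolynomial (Fin (n + 1)) ℝ}, p.IsHomogeneous (d i) →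
          (C a * p).IsHomogeneous (d i) := fun a p hp => by
        simpa using (isHomogeneous_C _ a).mul hp
      have h1 := (isHomogeneous_X ℝ (0 : Fin (n + 1))).pow (d i)
      have h2 := ((isHomogeneous_X ℝ (0 : Fin (n + 1))).pow (d i - 1)).mul
        (isHomogeneous_X ℝ j.succ)
      rw [one_mul] at h1
      rw [one_mul, Nat.sub_add_cancel (hd i)] at h2
      exact (isHomogeneous_baseSys hd hj i).add
        (hC _ (((isHomogeneous_sys _ i).add (hC _ h1)).add (hC _ h2)))
    have hdeg : Degenerate (fun i => baseSys d j i + C t * F t i) := by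
      refine degenerate_of_linearIndependent hhom (x := x t) (v := v t) ?_ ?_ (fun i => ?_)
        fun i => ?_
      · intro h
        have := congrFun h 0
        simp [hx] at this
      · intro a h
        have h1 := congrFun h 0
        have h2 := congrFun h j.succ
        simp [hx, hv] at h1 h2
        rw [← h1] at h2
        simp at h2
      · by_cases hi : i = j
        · subst hi
          simp [baseSys, hF, hP, hx]; ring
        · simp [baseSys, hF, hP, hx, hi]; ring
      · have hxz : x t 0 = 1 := by simp [hx]
        have hvz : v t 0 = 0 := by simp [hv]
        have hvj : v t j.succ = 1 := by simp [hv]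
        have hxs : ∀ i, x t (Fin.succ i) = t * α i := fun i => by simp [hx]
        by_cases hi : i = j
        · subst hi
          simp [baseSys, hF, hQ, dEval_add, dEval_sub, dEval_mul, dEval_C, dEval_pow, dEval_X, hxz,
              hvz, hvj,
            hxs, hα]
          ring
        · have hvi : v t i.succ = t * -δ i := by simp [hv, hi]
          simp [baseSys, hF, hQ, dEval_add, dEval_sub, dEval_mul, dEval_C, dEval_pow, dEval_X, hxz,
              hvz, hvj,
            hxs, hvi, hi]
    have := (mem_discIdeal hn hd).mp ha _ hhom hdeg
    rw [eval_rename] at this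
    rw [← this]
    congr 2
    funext b
    simp [coefs]

end Dominance

section Discriminant
variable {n : ℕ} {d : Fin n → ℕ}

/-- The determinant of the Macaulay matrix of the generic system. -/
noncomputable def genDet (d : Fin n → ℕ) (k : Fin (n + 1)) : MvPolynomial (Idx d) ℝ :=
  (mac d k (sys d (X : Idx d → MvPolynomial (Idx d) ℝ))).det

lemma map_genDet {S : Type*} [CommRing S] (φ : MvPolynomial (Idx d) ℝ →+* S) (k : Fin (n + 1)) :
    φ (genDet d k) = (mac d k (sys d (fun b => φ (X b)))).det := by
  rw [genDet, map_det_mac]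
  congr 2
  funext i
  exact map_sys φ _ i

lemma genDet_ne_zero (hd : ∀ i, 1 ≤ d i) (k : Fin (n + 1)) : genDet d k ≠ 0 := by
  intro h
  apply det_mac_fermat_ne_zero hd k
  have h1 := map_genDet (eval (coefs d (fermat d k))) k
  rw [h, map_zero] at h1
  simp only [eval_X] at h1
  rw [sys_coefs (isHomogeneous_fermat k)] at h1
  exact h1.symm

lemma genDet_mem_discIdeal (hn : 1 ≤ n) (hd : ∀ i, 1 ≤ d i) (k : Fin (n + 1)) :
    genDet d k ∈ discIdeal d := by
  rw [mem_discIdeal hn hd]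
  rintro f hf ⟨x, v, hx, hv, hxv, h⟩
  rw [map_genDet]
  simp only [eval_X]
  rw [show (fun b => coefs d f b) = coefs d f from rfl, sys_coefs hf]
  refine det_mac_eq_zero k hf ?_ (fun i => (h i).1) fun i => (h i).2
  rw [LinearIndependent.pair_iff]
  intro a b hab
  have hl : ∀ l, a * x l + b * v l = 0 := fun l => by simpa using congrFun hab l
  have hsx : ∑ l, (a * x l + b * v l) * x l = a := by
    calc ∑ l, (a * x l + b * v l) * x l = a * ∑ l, x l ^ 2 + b * ∑ l, v l * x l := by
          rw [Finset.mul_sum, Finset.mul_sum, ← Finset.sum_add_distrib]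
          exact Finset.sum_congr rfl fun l _ => by ring
      _ = a := by rw [hx, hxv]; ring
  have hsv : ∑ l, (a * x l + b * v l) * v l = b := by
    calc ∑ l, (a * x l + b * v l) * v l = a * ∑ l, v l * x l + b * ∑ l, v l ^ 2 := by
          rw [Finset.mul_sum, Finset.mul_sum, ← Finset.sum_add_distrib]
          exact Finset.sum_congr rfl fun l _ => by ring
      _ = b := by rw [hv, hxv]; ring
  simp only [hl, zero_mul, Finset.sum_const_zero] at hsx hsv
  exact ⟨hsx.symm, hsv.symm⟩

/-- Substituting `X_b s ^ w b` for `X_b`. -/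
noncomputable def weightHom {κ : Type*} (w : κ → ℕ) :
    MvPolynomial κ ℝ →ₐ[ℝ] Polynomial (MvPolynomial κ ℝ) :=
  aeval fun b => Polynomial.X ^ w b * Polynomial.C (X b)

lemma coeff_weightHom {κ : Type*} [Fintype κ] (w : κ → ℕ) (P : MvPolynomial κ ℝ) (m : κ →₀ ℕ) :
    coeff m ((weightHom w P).coeff (∑ b, m b * w b)) = coeff m P := by
  classical
  induction P using MvPolynomial.induction_on' with
  | monomial l a =>
    have : weightHom w (monomial l a) =
        Polynomial.C (monomial l a) * Polynomial.X ^ (∑ b, l b * w b) := by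
      rw [weightHom, aeval_monomial, Finsupp.prod_fintype _ _ (by simp), monomial_eq,
        Finsupp.prod_fintype _ _ (by simp)]
      simp only [mul_pow, Finset.prod_mul_distrib, ← pow_mul, Finset.prod_pow_eq_pow_sum,
        map_mul, map_prod, map_pow, mul_comm (w _)]
      rw [Polynomial.algebraMap_apply, MvPolynomial.algebraMap_eq]
      ring
    rw [this, Polynomial.coeff_C_mul_X_pow]
    by_cases hlm : l = m
    · subst hlm; simp
    · rw [coeff_monomial, if_neg hlm]
      split_ifs
      · rw [coeff_monomial, if_neg hlm]
      · simp
  | add p q hp hq => rw [map_add, Polynomial.coeff_add, coeff_add, hp, hq, coeff_add]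

lemma weight_le_of_dvd {κ : Type*} [Fintype κ] {w : κ → ℕ} {a : ℕ} {P H : MvPolynomial κ ℝ}
    (hH : H ≠ 0) (hw : weightHom w H = Polynomial.X ^ a * Polynomial.C H) (hP : P ∣ H)
    {m : κ →₀ ℕ} (hm : coeff m P ≠ 0) : ∑ b, m b * w b ≤ a := by
  have h1 : weightHom w P ∣ Polynomial.X ^ a * Polynomial.C H := hw ▸ map_dvd _ hP
  have h2 : (weightHom w P).natDegree ≤ a := by
    refine (Polynomial.natDegree_le_of_dvd h1 ?_).trans ?_
    · exact mul_ne_zero (pow_ne_zero _ Polynomial.X_ne_zero) (Polynomial.C_ne_zero.mpr hH)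
    · rw [mul_comm]; exact Polynomial.natDegree_C_mul_X_pow_le _ _
  refine le_trans ?_ h2
  apply Polynomial.le_natDegree_of_ne_zero
  intro h0
  apply hm
  rw [← coeff_weightHom w P m, h0, coeff_zero]

lemma weightHom_genDet (k : Fin (n + 1)) : weightHom (fun b : Idx d => b.2.1 k) (genDet d k) =
    Polynomial.X ^ ((∑ i, (d i - 1)) * ∏ i, d i) * Polynomial.C (genDet d k) := by
  rw [map_genDet (Polynomial.C : _ →+* Polynomial (MvPolynomial (Idx d) ℝ)),
    ← det_mac_scale k
      (Polynomial.X_ne_zero : (Polynomial.X : Polynomial (MvPolynomial (Idx d) ℝ)) ≠ 0)]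
  refine (map_genDet (weightHom (fun b : Idx d => b.2.1 k)).toRingHom k).trans ?_
  congr 2
  funext i
  rw [scaleVar_sys]
  congr 1
  funext b
  simp [weightHom]

lemma det_mac_C_mul {S : Type*} [CommRing S] (h1 : ∀ i, d i = 1) (k : Fin (n + 1)) (s : S)
    (f : Fin n → MvPolynomial (Fin (n + 1)) S) :
    (mac d k (fun i => C s * f i)).det = s ^ n * (mac d k f).det := by
  have he : ∑ i, (d i - 1) = 0 := Finset.sum_eq_zero fun i _ => by simp [h1]
  have hjac : jac k (fun i => C s * f i) = C (s ^ n) * jac k f := by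
    have : (Matrix.of fun i l => pderiv (k.succAbove l) (C s * f i)) =
        (C s : MvPolynomial (Fin (n + 1)) S) •
          Matrix.of fun i l => pderiv (k.succAbove l) (f i) := by
      ext i l : 2
      simp
    rw [jac, this, Matrix.det_smul, jac, Fintype.card_fin, map_pow]
  have hrow : ∀ β ∈ Expo n (2 * ∑ i, (d i - 1)), ∀ g : Fin n → MvPolynomial (Fin (n + 1)) S,
      macRow d k g β = monomial 0 1 * jac k g := by
    intro β hβ g
    rw [he, mul_zero, mem_Expo] at hβ
    have hβ0 : ∀ l, β l = 0 := fun l => by simpa using Finset.sum_eq_zero_iff.mp hβ l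
    rw [macRow, dif_neg, show β = 0 from Finsupp.ext hβ0]
    · simp
    · simp [hβ0, h1]
  have hmac : mac d k (fun i => C s * f i) = s ^ n • mac d k f := by
    ext β γ : 2
    simp only [mac, Matrix.of_apply, Matrix.smul_apply, hrow _ β.2, hjac]
    rw [mul_left_comm, coeff_C_mul, smul_eq_mul]
  have hcard : Fintype.card (Expo n (2 * ∑ i, (d i - 1)) : Finset (Fin (n + 1) →₀ ℕ)) = 1 := by
    rw [Fintype.card_coe, he]
    simp [Expo]
  rw [hmac, Matrix.det_smul, hcard, pow_one]

lemma weightHom_one_genDet (h1 : ∀ i, d i = 1) (k : Fin (n + 1)) :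
    weightHom (fun _ : Idx d => 1) (genDet d k) =
      Polynomial.X ^ n * Polynomial.C (genDet d k) := by
  rw [map_genDet (Polynomial.C : _ →+* Polynomial (MvPolynomial (Idx d) ℝ)),
    ← det_mac_C_mul h1]
  refine (map_genDet (weightHom (fun _ : Idx d => 1)).toRingHom k).trans ?_
  congr 2
  funext i
  ext1 γ
  rw [coeff_C_mul, coeff_sys, coeff_sys]
  split_ifs <;> simp [weightHom]

lemma coefs_smul (s : ℝ) (f : Fin n → MvPolynomial (Fin (n + 1)) ℝ) :
    coefs d (fun i => C s * f i) = s • coefs d f := by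
  funext b
  simp [coefs]

lemma homogeneousComponent_mem_discIdeal (hn : 1 ≤ n) (hd : ∀ i, 1 ≤ d i)
    {P : MvPolynomial (Idx d) ℝ} (hP : P ∈ discIdeal d) (a : ℕ) :
    homogeneousComponent a P ∈ discIdeal d := by
  rw [mem_discIdeal hn hd] at hP ⊢
  intro f hf hdeg
  set q : Polynomial ℝ := ∑ i ∈ range (P.totalDegree + 1),
    Polynomial.C (eval (coefs d f) (homogeneousComponent i P)) * Polynomial.X ^ i with hq
  have hq0 : q = 0 := by
    refine Polynomial.funext fun s => ?_
    have hsys : IsSystem d (fun i => C s * f i) := fun i => by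
      simpa using (isHomogeneous_C _ s).mul (hf i)
    have hsdeg : Degenerate (fun i => C s * f i) := by
      obtain ⟨x, v, hx, hv, hxv, h⟩ := hdeg
      exact ⟨x, v, hx, hv, hxv, fun i => by simp [dEval_mul, dEval_C, h i]⟩
    have h1 := hP _ hsys hsdeg
    rw [coefs_smul, ← sum_homogeneousComponent P, map_sum] at h1
    rw [Polynomial.eval_zero, ← h1, hq, Polynomial.eval_finsetSum]
    refine Finset.sum_congr rfl fun i _ => ?_
    rw [eval_smul_of_isHomogeneous (homogeneousComponent_isHomogeneous i P)]
    simp only [Polynomial.eval_mul, Polynomial.eval_C, Polynomial.eval_pow, Polynomial.eval_X]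
    ring
  by_cases ha : a ∈ range (P.totalDegree + 1)
  · have h2 : q.coeff a = 0 := by rw [hq0, Polynomial.coeff_zero]
    rw [hq, Polynomial.finsetSum_coeff] at h2
    simp only [Polynomial.coeff_C_mul_X_pow] at h2
    simpa [ha] using h2
  · rw [homogeneousComponent_eq_zero, map_zero]
    simpa [Nat.lt_succ_iff] using ha

/-- If some degree is at least `2`, then the equations of degenerate systems have a common
divisor. -/
lemma exists_common_divisor (hn : 1 ≤ n) (hd : ∀ i, 1 ≤ d i) {j : Fin n} (hj : 2 ≤ d j) :
    ∃ P ∈ discIdeal d, P ≠ 0 ∧ ∀ H ∈ discIdeal d, P ∣ H := by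
  classical
  set E : MvPolynomial (Idx d) ℝ ≃ₐ[ℝ]
      Polynomial (MvPolynomial {b : Idx d // b ≠ leadIdx d j} ℝ) :=
    (renameEquiv ℝ (Equiv.optionSubtypeNe (leadIdx d j)).symm).trans (optionEquivLeft ℝ _) with hE
  have hEC : ∀ a, E.symm (Polynomial.C a) = rename Subtype.val a := by
    intro a
    rw [AlgEquiv.symm_apply_eq]
    induction a using MvPolynomial.induction_on with
    | C r =>
      rw [rename_C]
      simp [hE]
    | add p q hp hq => rw [Polynomial.C_add, hp, hq, map_add, map_add]
    | mul_X p b hp =>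
      rw [Polynomial.C_mul, hp, map_mul, map_mul, rename_X]
      congr 1
      simp [hE, Equiv.optionSubtypeNe_symm_of_ne b.2]
  have hprime : (Ideal.comap E.symm.toRingHom (discIdeal d)).IsPrime := Ideal.comap_isPrime _ _
  set J : Ideal (Polynomial (MvPolynomial {b : Idx d // b ≠ leadIdx d j} ℝ)) :=
    Ideal.comap E.symm.toRingHom (discIdeal d) with hJ
  have hmem : ∀ H, H ∈ discIdeal d → E H ∈ J := fun H hH => by
    change E.symm (E H) ∈ discIdeal d
    rwa [AlgEquiv.symm_apply_apply]
  have hJ0 : J ≠ ⊥ := fun h => by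
    have h1 := hmem _ (genDet_mem_discIdeal hn hd 0)
    rw [h, Ideal.mem_bot] at h1
    exact genDet_ne_zero hd 0 (by simpa using h1)
  have hJC : ∀ a, Polynomial.C a ∈ J → a = 0 := fun a ha => by
    refine eq_zero_of_rename_mem_discIdeal hn hd hj a ?_
    rw [← hEC]
    exact ha
  obtain ⟨P, hPJ, hP0, hP⟩ := exists_dvd_of_prime_ideal hprime hJ0 hJC
  refine ⟨E.symm P, hPJ, by simpa using hP0, fun H hH => ?_⟩
  simpa using map_dvd E.symm (hP _ (hmem H hH))

lemma exists_bounded_equation (hn : 1 ≤ n) (hd : ∀ i, 1 ≤ d i) :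
    ∃ P ∈ discIdeal d, P ≠ 0 ∧ ∀ m, coeff m P ≠ 0 → ((∀ i, d i = 1) ∧ ∑ b, m b ≤ n) ∨
      ∀ a, (∀ i, a ≤ d i) → (∑ b, m b) * a ≤ (n + 1) * ((∑ i, (d i - 1)) * ∏ i, d i) := by
  by_cases h1 : ∀ i, d i = 1
  · refine ⟨genDet d 0, genDet_mem_discIdeal hn hd 0, genDet_ne_zero hd 0,
      fun m hm => Or.inl ⟨h1, ?_⟩⟩
    simpa using weight_le_of_dvd (genDet_ne_zero hd 0) (weightHom_one_genDet h1 0) dvd_rfl hm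
  · push Not at h1
    obtain ⟨j, hj⟩ := h1
    obtain ⟨P, hPI, hP0, hP⟩ := exists_common_divisor hn hd
      (j := j) (by have := hd j; omega)
    refine ⟨P, hPI, hP0, fun m hm => Or.inr fun a ha => ?_⟩
    calc (∑ b, m b) * a ≤ ∑ b : Idx d, m b * ∑ k, b.2.1 k := by
          rw [Finset.sum_mul]
          refine Finset.sum_le_sum fun b _ => Nat.mul_le_mul_left _ ?_
          rw [mem_Expo.mp b.2.2]
          exact ha b.1
      _ = ∑ k : Fin (n + 1), ∑ b : Idx d, m b * b.2.1 k := by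
          rw [Finset.sum_comm]
          exact Finset.sum_congr rfl fun b _ => Finset.mul_sum _ _ _
      _ ≤ ∑ _k : Fin (n + 1), (∑ i, (d i - 1)) * ∏ i, d i :=
          Finset.sum_le_sum fun k _ => weight_le_of_dvd (genDet_ne_zero hd k) (weightHom_genDet k)
            (hP _ (genDet_mem_discIdeal hn hd k)) hm
      _ = _ := by simp

/-- A homogeneous equation of controlled degree for the degenerate systems. -/
theorem exists_discriminant (hn : 1 ≤ n) (hd : ∀ i, 1 ≤ d i) :
    ∃ (δ : ℕ) (P : MvPolynomial (Idx d) ℝ), P ≠ 0 ∧ P.IsHomogeneous δ ∧ 1 ≤ δ ∧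
      (((∀ i, d i = 1) ∧ δ ≤ n) ∨
        ∀ a, (∀ i, a ≤ d i) → δ * a ≤ (n + 1) * ((∑ i, (d i - 1)) * ∏ i, d i)) ∧
      ∀ f, IsSystem d f → Degenerate f → eval (coefs d f) P = 0 := by
  obtain ⟨P, hPI, hP0, hP⟩ := exists_bounded_equation hn hd
  obtain ⟨δ, hδ⟩ : ∃ a, homogeneousComponent a P ≠ 0 := by
    by_contra hall
    push Not at hall
    apply hP0
    rw [← sum_homogeneousComponent P]
    exact Finset.sum_eq_zero fun k _ => hall k
  have hmem := homogeneousComponent_mem_discIdeal hn hd hPI δ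
  have hvan := (mem_discIdeal hn hd).mp hmem
  obtain ⟨m, hm⟩ := ne_zero_iff.mp hδ
  have hmδ : ∑ b, m b = δ := by
    have := homogeneousComponent_isHomogeneous δ P hm
    simpa [Finsupp.weight_apply, Finsupp.sum_fintype] using this
  have hmP : coeff m P ≠ 0 := by
    rw [coeff_homogeneousComponent] at hm
    exact fun h => hm (by simp [h])
  refine ⟨δ, homogeneousComponent δ P, hδ, homogeneousComponent_isHomogeneous δ P, ?_,
    hmδ ▸ hP m hmP, hvan⟩
  rw [Nat.one_le_iff_ne_zero]
  rintro rfl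
  have h0 := hvan _ (fun i => isHomogeneous_zero _ _ _) (degenerate_zero hn)
  rw [homogeneousComponent_zero] at hδ h0
  rw [eval_C] at h0
  exact hδ (by rw [h0, C_0])

end Discriminant

open ProbabilityTheory

/-- The normalising constant of the standard Gaussian density. -/
noncomputable def gaussConst (V : Type*) [NormedAddCommGroup V] [InnerProductSpace ℝ V] : ℝ :=
  ((2 * Real.pi) ^ (Module.finrank ℝ V / 2 : ℝ))⁻¹

theorem gaussConst_pos (V : Type*) [NormedAddCommGroup V] [InnerProductSpace ℝ V] :
    0 < gaussConst V := by
  unfold gaussConst; positivity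

section Gaussian
variable {V : Type*} [NormedAddCommGroup V] [InnerProductSpace ℝ V] [FiniteDimensional ℝ V]
  [MeasurableSpace V] [BorelSpace V]

theorem integrable_exp_neg_mul_sq_norm {b : ℝ} (hb : 0 < b) :
    Integrable (fun z : V => Real.exp (-b * ‖z‖ ^ 2)) := by
  have h := (GaussianFourier.integrable_cexp_neg_mul_sq_norm_add (V := V) (b := b)
    (by simpa using hb) 0 0).re
  refine h.congr (Filter.Eventually.of_forall fun z => ?_)
  simp only [zero_mul, add_zero]
  rw [← Complex.ofReal_neg, ← Complex.ofReal_pow, ← Complex.ofReal_mul, ← Complex.ofReal_exp]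
  rfl

theorem lintegral_exp_neg_mul_sq_norm {b : ℝ} (hb : 0 < b) :
    ∫⁻ z : V, ENNReal.ofReal (Real.exp (-b * ‖z‖ ^ 2)) =
      ENNReal.ofReal ((Real.pi / b) ^ (Module.finrank ℝ V / 2 : ℝ)) := by
  rw [← GaussianFourier.integral_rexp_neg_mul_sq_norm hb,
    ofReal_integral_eq_lintegral_ofReal (integrable_exp_neg_mul_sq_norm hb)
      (Filter.Eventually.of_forall fun z => (Real.exp_pos _).le)]

theorem stdGaussian_eq_withDensity :
    stdGaussian V = volume.withDensity
      fun z => ENNReal.ofReal (gaussConst V * Real.exp (-(1 / 2) * ‖z‖ ^ 2)) := by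
  have hint : Integrable (fun z : V => gaussConst V * Real.exp (-(1 / 2) * ‖z‖ ^ 2)) :=
    (integrable_exp_neg_mul_sq_norm (by norm_num)).const_mul _
  have : IsFiniteMeasure ((volume : Measure V).withDensity
      fun z => ENNReal.ofReal (gaussConst V * Real.exp (-(1 / 2) * ‖z‖ ^ 2))) :=
    isFiniteMeasure_withDensity_ofReal hint.2
  apply Measure.ext_of_charFun
  ext t
  rw [charFun_stdGaussian, charFun_apply, integral_withDensity_eq_integral_toReal_smul
    (by fun_prop) (Filter.Eventually.of_forall fun z => ENNReal.ofReal_lt_top)]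
  have h := GaussianFourier.integral_cexp_neg_mul_sq_norm_add (V := V) (b := (1 / 2 : ℝ))
    (by norm_num) Complex.I t
  have : ∀ z : V, (ENNReal.ofReal (gaussConst V * Real.exp (-(1 / 2) * ‖z‖ ^ 2))).toReal •
      Complex.exp (⟪z, t⟫ * Complex.I) = (gaussConst V : ℂ) *
        Complex.exp (-((1 / 2 : ℝ) : ℂ) * ‖z‖ ^ 2 + Complex.I * ⟪t, z⟫) := by
    intro z
    rw [ENNReal.toReal_ofReal (by have := gaussConst_pos V; positivity), Complex.exp_add,
      real_inner_comm, Complex.real_smul]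
    push_cast
    ring_nf
  simp_rw [this]
  rw [integral_const_mul, h]
  have h2 : ((Real.pi : ℂ) / ((1 / 2 : ℝ) : ℂ)) ^ (Module.finrank ℝ V / 2 : ℂ) =
      (((2 * Real.pi) ^ (Module.finrank ℝ V / 2 : ℝ) : ℝ) : ℂ) := by
    rw [Complex.ofReal_cpow (by positivity)]
    push_cast
    ring_nf
  rw [h2, ← mul_assoc, ← Complex.ofReal_mul, gaussConst, inv_mul_cancel₀ (by positivity),
    Complex.I_sq]
  push_cast
  ring_nf

theorem lintegral_stdGaussian (F : V → ℝ≥0∞) (hF : Measurable F) :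
    ∫⁻ z, F z ∂stdGaussian V =
      ∫⁻ z, ENNReal.ofReal (gaussConst V * Real.exp (-(1 / 2) * ‖z‖ ^ 2)) * F z := by
  rw [stdGaussian_eq_withDensity, lintegral_withDensity_eq_lintegral_mul _ (by fun_prop) hF]
  rfl

theorem stdGaussian_absolutelyContinuous : stdGaussian V ≪ volume := by
  rw [stdGaussian_eq_withDensity]
  exact withDensity_absolutelyContinuous _ _

theorem lintegral_stdGaussian_exp {k : ℝ} :
    ∫⁻ z : V, ENNReal.ofReal (Real.exp (-(k ^ 2 / 2) * ‖z‖ ^ 2)) ∂stdGaussian V =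
      ENNReal.ofReal ((1 + k ^ 2) ^ (-(Module.finrank ℝ V / 2 : ℝ))) := by
  rw [lintegral_stdGaussian _ (by fun_prop)]
  have : ∀ z : V, ENNReal.ofReal (gaussConst V * Real.exp (-(1 / 2) * ‖z‖ ^ 2)) *
      ENNReal.ofReal (Real.exp (-(k ^ 2 / 2) * ‖z‖ ^ 2)) =
      ENNReal.ofReal (gaussConst V) *
        ENNReal.ofReal (Real.exp (-((1 + k ^ 2) / 2) * ‖z‖ ^ 2)) := by
    intro z
    rw [← ENNReal.ofReal_mul (by have := gaussConst_pos V; positivity),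
      ← ENNReal.ofReal_mul (gaussConst_pos V).le, mul_assoc, ← Real.exp_add]
    ring_nf
  simp_rw [this]
  rw [lintegral_const_mul _ (by fun_prop), lintegral_exp_neg_mul_sq_norm (by positivity),
    ← ENNReal.ofReal_mul (gaussConst_pos V).le, gaussConst]
  congr 1
  rw [div_div_eq_mul_div, mul_comm Real.pi 2, Real.div_rpow (by positivity) (by positivity),
    Real.rpow_neg (by positivity)]
  have : (0:ℝ) < (2 * Real.pi) ^ (Module.finrank ℝ V / 2 : ℝ) := by positivity
  field_simp

theorem lintegral_stdGaussian_polar [Nontrivial V] (F : V → ℝ≥0∞) (hF : Measurable F) :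
    ∫⁻ z, F z ∂stdGaussian V = ∫⁻ θ : sphere (0 : V) 1, (∫⁻ ρ in Set.Ioi (0 : ℝ),
      ENNReal.ofReal (ρ ^ (Module.finrank ℝ V - 1)) * (ENNReal.ofReal (gaussConst V *
        Real.exp (-(1 / 2) * ρ ^ 2)) * F (ρ • (θ : V))))
        ∂(volume : Measure V).toSphere := by
  rw [lintegral_stdGaussian F hF]
  set G : V → ℝ≥0∞ := fun z =>
    ENNReal.ofReal (gaussConst V * Real.exp (-(1 / 2) * ‖z‖ ^ 2)) * F z with hG
  have hGm : Measurable G := by fun_prop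
  have h1 : ∫⁻ z, G z = ∫⁻ z : ({0}ᶜ : Set V), G z ∂((volume : Measure V).comap (↑)) := by
    rw [lintegral_subtype_comap (measurableSet_singleton _).compl, restrict_compl_singleton]
  have h2 := (Measure.measurePreserving_homeomorphUnitSphereProd
    (volume : Measure V)).lintegral_comp_emb (Homeomorph.measurableEmbedding _)
    (fun p => G ((p.2 : ℝ) • (p.1 : V)))
  have h3 : ∀ z : ({0}ᶜ : Set V), (((homeomorphUnitSphereProd V z).2 : ℝ) •
      ((homeomorphUnitSphereProd V z).1 : V)) = z := by
    intro z
    have : ‖(z : V)‖ ≠ 0 := norm_ne_zero_iff.2 z.2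
    simp [smul_smul, this]
  simp only [h3] at h2
  rw [h1, h2, lintegral_prod _ (by fun_prop)]
  refine lintegral_congr fun θ => ?_
  rw [Measure.volumeIoiPow, lintegral_withDensity_eq_lintegral_mul _ (by fun_prop) (by fun_prop)]
  simp only [Pi.mul_apply]
  rw [lintegral_subtype_comap measurableSet_Ioi (fun ρ : ℝ =>
    ENNReal.ofReal (ρ ^ (Module.finrank ℝ V - 1)) * G (ρ • (θ : V)))]
  refine setLIntegral_congr_fun measurableSet_Ioi fun ρ hρ => ?_
  simp [hG, norm_smul]

/-- The standard Gaussian measure splits along an orthogonal decomposition. -/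
theorem stdGaussian_map_add (K : Submodule ℝ V) :
    ((stdGaussian K).prod (stdGaussian Kᗮ)).map (fun p => (p.1 : V) + (p.2 : V)) =
      stdGaussian V := by
  apply Measure.ext_of_charFun
  ext t
  rw [charFun_stdGaussian, charFun_apply, integral_map (by fun_prop) (by fun_prop)]
  have : ∀ p : K × Kᗮ, Complex.exp (⟪(p.1 : V) + (p.2 : V), t⟫ * Complex.I) =
      Complex.exp (⟪p.1, K.orthogonalProjectionOnto t⟫ * Complex.I) *
      Complex.exp (⟪p.2, Kᗮ.orthogonalProjectionOnto t⟫ * Complex.I) := by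
    intro p
    rw [inner_add_left, ← Complex.exp_add]
    simp [add_mul]
  simp_rw [this]
  rw [integral_prod_mul (fun y : K => Complex.exp (⟪y, K.orthogonalProjectionOnto t⟫ * Complex.I))
    (fun y : Kᗮ => Complex.exp (⟪y, Kᗮ.orthogonalProjectionOnto t⟫ * Complex.I)),
    ← charFun_apply, ← charFun_apply, charFun_stdGaussian, charFun_stdGaussian,
    ← Complex.exp_add]
  congr 1
  have := K.norm_sq_eq_add_norm_sq_projection t
  norm_cast
  rw [this]
  simp only [Submodule.coe_norm]
  ring

/-- The product of two copies of the standard Gaussian is invariant under rotations mixing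
the two factors. -/
theorem stdGaussian_prod_map_rotation (c s : ℝ) (h : c ^ 2 + s ^ 2 = 1) :
    ((stdGaussian V).prod (stdGaussian V)).map
      (fun p => (c • p.1 + s • p.2, -s • p.1 + c • p.2)) =
      (stdGaussian V).prod (stdGaussian V) := by
  let L : V × V →L[ℝ] V × V :=
    (c • ContinuousLinearMap.fst ℝ V V + s • ContinuousLinearMap.snd ℝ V V).prod
      (-s • ContinuousLinearMap.fst ℝ V V + c • ContinuousLinearMap.snd ℝ V V)
  have hL : (fun p : V × V => (c • p.1 + s • p.2, -s • p.1 + c • p.2)) = L := rfl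
  have : IsProbabilityMeasure (((stdGaussian V).prod (stdGaussian V)).map L) :=
    Measure.isProbabilityMeasure_map (by fun_prop)
  rw [hL]
  apply Measure.ext_of_charFunDual
  ext T
  rw [charFunDual_map, charFunDual_prod, charFunDual_prod, charFunDual_stdGaussian,
    charFunDual_stdGaussian, charFunDual_stdGaussian, charFunDual_stdGaussian,
    ← Complex.exp_add, ← Complex.exp_add]
  set A := T.comp (ContinuousLinearMap.inl ℝ V V) with hA
  set B := T.comp (ContinuousLinearMap.inr ℝ V V) with hB
  have h1 : (T ∘L L) ∘L ContinuousLinearMap.inl ℝ V V = c • A + (-s) • B := by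
    ext x
    have : L (x, 0) = c • (x, 0) + (-s) • (0, x) := by simp [L]
    rw [ContinuousLinearMap.comp_apply, ContinuousLinearMap.comp_apply,
      ContinuousLinearMap.inl_apply, this, map_add, map_smul, map_smul]
    rfl
  have h2 : (T ∘L L) ∘L ContinuousLinearMap.inr ℝ V V = s • A + c • B := by
    ext x
    have : L (0, x) = s • (x, 0) + c • (0, x) := by simp [L]
    rw [ContinuousLinearMap.comp_apply, ContinuousLinearMap.comp_apply,
      ContinuousLinearMap.inr_apply, this, map_add, map_smul, map_smul]
    rfl
  rw [h1, h2]
  obtain ⟨a, ha⟩ := (InnerProductSpace.toDual ℝ V).surjective A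
  obtain ⟨b, hb⟩ := (InnerProductSpace.toDual ℝ V).surjective B
  have e1 : ‖c • A + (-s) • B‖ = ‖c • a + (-s) • b‖ := by
    rw [← ha, ← hb, ← LinearIsometryEquiv.norm_map (InnerProductSpace.toDual ℝ V)]
    rw [map_add, map_smulₛₗ, map_smulₛₗ]; rfl
  have e2 : ‖s • A + c • B‖ = ‖s • a + c • b‖ := by
    rw [← ha, ← hb, ← LinearIsometryEquiv.norm_map (InnerProductSpace.toDual ℝ V)]
    rw [map_add, map_smulₛₗ, map_smulₛₗ]; rfl
  have e3 : ‖A‖ = ‖a‖ := by rw [← ha, LinearIsometryEquiv.norm_map]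
  have e4 : ‖B‖ = ‖b‖ := by rw [← hb, LinearIsometryEquiv.norm_map]
  rw [e1, e2, e3, e4]
  have : ‖c • a + (-s) • b‖ ^ 2 + ‖s • a + c • b‖ ^ 2 = ‖a‖ ^ 2 + ‖b‖ ^ 2 := by
    simp only [← real_inner_self_eq_norm_sq, inner_add_left, inner_add_right,
      real_inner_smul_left, real_inner_smul_right, real_inner_comm a b]
    linear_combination (inner ℝ a a + inner ℝ b b) * h
  congr 1
  norm_cast
  linarith

theorem gaussConst_real : gaussConst ℝ = (Real.sqrt (2 * Real.pi))⁻¹ := by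
  rw [gaussConst, Module.finrank_self, Nat.cast_one, Real.sqrt_eq_rpow]

theorem stdGaussian_real_le {S : Set ℝ} (hS : MeasurableSet S) :
    stdGaussian ℝ S ≤ ENNReal.ofReal (Real.sqrt (2 * Real.pi))⁻¹ * volume S := by
  rw [stdGaussian_eq_withDensity, withDensity_apply _ hS, ← setLIntegral_const]
  refine setLIntegral_mono measurable_const fun x _ => ENNReal.ofReal_le_ofReal ?_
  rw [gaussConst_real]
  refine mul_le_of_le_one_right (by positivity) (Real.exp_le_one_iff.2 ?_)
  nlinarith [sq_nonneg ‖x‖]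

/-- A set all of whose sections in a fixed unit direction are short has small Gaussian measure. -/
theorem stdGaussian_le_of_slices {S : Set V} (hS : MeasurableSet S) {u : V} (hu : ‖u‖ = 1)
    {b : ℝ≥0∞} (hb : ∀ w : V, volume {τ : ℝ | w + τ • u ∈ S} ≤ b) :
    stdGaussian V S ≤ ENNReal.ofReal (Real.sqrt (2 * Real.pi))⁻¹ * b := by
  set K : Submodule ℝ V := Submodule.span ℝ {u} with hK
  have hm : Measurable fun p : K × Kᗮ => (p.1 : V) + (p.2 : V) := by fun_prop
  rw [← stdGaussian_map_add K, Measure.map_apply hm hS, Measure.prod_apply_symm (hm hS)]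
  have key : ∀ w : Kᗮ, stdGaussian K ((fun y : K => (y, w)) ⁻¹'
      ((fun p : K × Kᗮ => (p.1 : V) + (p.2 : V)) ⁻¹' S)) ≤
      ENNReal.ofReal (Real.sqrt (2 * Real.pi))⁻¹ * b := by
    intro w
    have hm2 : MeasurableSet ((fun y : K => (y, w)) ⁻¹'
      ((fun p : K × Kᗮ => (p.1 : V) + (p.2 : V)) ⁻¹' S)) := measurable_prodMk_right (hm hS)
    rw [← stdGaussian_map (LinearIsometryEquiv.toSpanUnitSingleton u hu),
      Measure.map_apply (by fun_prop) hm2]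
    refine (stdGaussian_real_le (by measurability)).trans ?_
    gcongr
    refine le_of_eq_of_le (congrArg _ ?_) (hb w)
    ext τ
    simp [LinearIsometryEquiv.toSpanUnitSingleton, add_comm]
  calc _ ≤ ∫⁻ _ : Kᗮ, ENNReal.ofReal (Real.sqrt (2 * Real.pi))⁻¹ * b ∂stdGaussian Kᗮ :=
        lintegral_mono key
    _ = _ := by rw [lintegral_const, measure_univ, mul_one]

end Gaussian

theorem exists_eval_eq_coeff_mul_prod {p : Polynomial ℂ} {k : ℕ} (hk : p.natDegree = k) :
    ∃ ζ : Fin k → ℂ, ∀ z, p.eval z = p.coeff k * ∏ i, (z - ζ i) := by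
  have hs := IsAlgClosed.splits p
  obtain ⟨l, hl⟩ := Quotient.exists_rep p.roots
  have hl' : (l : Multiset ℂ) = p.roots := hl
  have hcard : l.length = k := by
    rw [← hk, hs.natDegree_eq_card_roots, ← hl', Multiset.coe_card]
  subst hcard
  refine ⟨fun i => l.get i, fun z => ?_⟩
  conv_lhs => rw [hs.eq_prod_roots]
  rw [Polynomial.eval_mul, Polynomial.eval_C, Polynomial.eval_multiset_prod, Multiset.map_map,
    Polynomial.leadingCoeff, hk, ← hl', Multiset.map_coe, Multiset.prod_coe, ← List.prod_ofFn]
  congr 2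
  apply List.ext_get <;> simp

theorem lintegral_log_div_le {B : ℝ} (hB : 0 < B) (c : ℝ) :
    ∫⁻ s : ℝ, ENNReal.ofReal (Real.log (B / |s - c|)) ≤ ENNReal.ofReal (2 * B) := by
  rw [lintegral_sub_right_eq_self (μ := (volume : Measure ℝ))
    (fun s => ENNReal.ofReal (Real.log (B / |s|))) c]
  have h1 : ∀ s : ℝ, ENNReal.ofReal (Real.log (B / |s|)) =
      ENNReal.ofReal (max 0 (Real.log (B / |s|))) := by
    intro s
    rcases le_total 0 (Real.log (B / |s|)) with h | h
    · rw [max_eq_right h]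
    · rw [max_eq_left h, ENNReal.ofReal_of_nonpos h, ENNReal.ofReal_zero]
  simp_rw [h1]
  rw [lintegral_eq_lintegral_meas_lt (f := fun s => max 0 (Real.log (B / |s|))) _
      (Filter.Eventually.of_forall fun s => le_max_left _ _)
    (by fun_prop)]
  calc _ ≤ ∫⁻ t in Set.Ioi (0 : ℝ), ENNReal.ofReal (2 * B * Real.exp (-t)) := by
        refine setLIntegral_mono (by fun_prop) fun t ht => ?_
        have hsub : {s : ℝ | t < max 0 (Real.log (B / |s|))} ⊆
            Set.Icc (-(B * Real.exp (-t))) (B * Real.exp (-t)) := by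
          intro s hs
          have hs' : t < Real.log (B / |s|) := by
            change t < max 0 _ at hs
            rcases lt_max_iff.1 hs with h | h
            · exact absurd h (not_lt.2 (le_of_lt ht))
            · exact h
          have hs0 : 0 < |s| := by
            by_contra hcon
            have : |s| = 0 := le_antisymm (not_lt.1 hcon) (abs_nonneg s)
            rw [this, _root_.div_zero, Real.log_zero] at hs'
            exact absurd hs' (not_lt.2 (le_of_lt ht))
          rw [Real.lt_log_iff_exp_lt (by positivity), lt_div_iff₀ hs0] at hs'
          rw [Set.mem_Icc, ← abs_le, Real.exp_neg]
          rw [← div_eq_mul_inv, le_div_iff₀ (Real.exp_pos _)]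
          linarith
        refine (measure_mono hsub).trans ?_
        rw [Real.volume_Icc]
        exact ENNReal.ofReal_le_ofReal (by linarith)
    _ = _ := by
        rw [← ofReal_integral_eq_lintegral_ofReal
          ((integrableOn_exp_neg_Ioi 0).const_mul _)
          (Filter.Eventually.of_forall fun t => by positivity), integral_const_mul,
          integral_exp_neg_Ioi_zero, mul_one]

/-- A one-variable polynomial of degree `k` with leading coefficient `a` is at most `A ^ k * |a|`
in absolute value only on a set of measure at most `2 * e * A`. -/
theorem volume_polynomial_le {p : Polynomial ℝ} {k : ℕ} (hk : 1 ≤ k) (hdeg : p.natDegree ≤ k)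
    (ha : p.coeff k ≠ 0) {A : ℝ} (hA : 0 < A) :
    volume {s : ℝ | |p.eval s| ≤ A ^ k * |p.coeff k|} ≤
      ENNReal.ofReal (2 * Real.exp 1 * A) := by
  have hk' : p.natDegree = k := le_antisymm hdeg (Polynomial.le_natDegree_of_ne_zero ha)
  have hnat : (p.map Complex.ofRealHom).natDegree = k := by
    rw [Polynomial.natDegree_map, hk']
  obtain ⟨ζ, hζ⟩ := exists_eval_eq_coeff_mul_prod hnat
  have hprod : ∀ s : ℝ, |p.eval s| = |p.coeff k| * ∏ i, ‖(s : ℂ) - ζ i‖ := by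
    intro s
    have h := congrArg norm (hζ s)
    have e1 : (p.map Complex.ofRealHom).eval (s : ℂ) = ((p.eval s : ℝ) : ℂ) :=
      Polynomial.eval_map_apply (f := Complex.ofRealHom) (p := p) s
    rw [e1, norm_mul, norm_prod, Polynomial.coeff_map] at h
    simpa using h
  set B := Real.exp 1 * A with hB
  have hB0 : 0 < B := by positivity
  set F : ℝ → ℝ≥0∞ := fun s => ∑ i, ENNReal.ofReal (Real.log (B / |s - (ζ i).re|)) with hF
  have hFint : ∫⁻ s, F s ≤ k * ENNReal.ofReal (2 * B) := by
    rw [hF, lintegral_finsetSum _ (by fun_prop)]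
    refine (Finset.sum_le_card_nsmul _ _ _ fun i _ => lintegral_log_div_le hB0 _).trans ?_
    rw [Finset.card_univ, Fintype.card_fin, nsmul_eq_mul]
  have hfin : volume (Set.range fun i => (ζ i).re) = 0 :=
    (Set.finite_range _).measure_zero _
  have hsub : {s : ℝ | |p.eval s| ≤ A ^ k * |p.coeff k|} ⊆
      {s | (k : ℝ≥0∞) ≤ F s} ∪ Set.range fun i => (ζ i).re := by
    intro s hs
    rcases em (s ∈ Set.range fun i => (ζ i).re) with h | h
    · exact Or.inr h
    left
    have hpos : ∀ i, 0 < |s - (ζ i).re| := fun i =>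
      abs_pos.2 (sub_ne_zero.2 fun e => h ⟨i, e.symm⟩)
    have hle : ∀ i, |s - (ζ i).re| ≤ ‖(s : ℂ) - ζ i‖ := fun i => by
      simpa using Complex.abs_re_le_norm ((s : ℂ) - ζ i)
    have hs1 : |p.coeff k| * ∏ i, ‖(s : ℂ) - ζ i‖ ≤ A ^ k * |p.coeff k| := by
      rw [← hprod]; exact hs
    have hs2 : ∏ i, |s - (ζ i).re| ≤ A ^ k := by
      have : 0 < |p.coeff k| := abs_pos.2 ha
      refine (Finset.prod_le_prod (fun i _ => abs_nonneg _) fun i _ => hle i).trans ?_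
      nlinarith
    have hs3 : (k : ℝ) ≤ ∑ i, Real.log (B / |s - (ζ i).re|) := by
      rw [← Real.log_prod fun i _ => (div_pos hB0 (hpos i)).ne', Finset.prod_div_distrib,
        Finset.prod_const, Finset.card_univ, Fintype.card_fin,
        Real.le_log_iff_exp_le (div_pos (by positivity) (Finset.prod_pos fun i _ => hpos i)),
        le_div_iff₀ (Finset.prod_pos fun i _ => hpos i), hB, mul_pow, ← Real.exp_nat_mul, mul_one]
      gcongr
    have hs4 : ∑ i, Real.log (B / |s - (ζ i).re|) ≤
        ∑ i, max 0 (Real.log (B / |s - (ζ i).re|)) :=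
      Finset.sum_le_sum fun i _ => le_max_right _ _
    have hs5 : F s = ENNReal.ofReal (∑ i, max 0 (Real.log (B / |s - (ζ i).re|))) := by
      rw [ENNReal.ofReal_sum_of_nonneg fun i _ => le_max_left _ _, hF]
      refine Finset.sum_congr rfl fun i _ => ?_
      rcases le_total 0 (Real.log (B / |s - (ζ i).re|)) with h | h
      · rw [max_eq_right h]
      · rw [max_eq_left h, ENNReal.ofReal_of_nonpos h, ENNReal.ofReal_zero]
    change (k : ℝ≥0∞) ≤ F s
    rw [hs5, ← ENNReal.ofReal_natCast]
    exact ENNReal.ofReal_le_ofReal (hs3.trans hs4)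
  have hk0 : (k : ℝ≥0∞) ≠ 0 := by exact_mod_cast (by omega : k ≠ 0)
  have hmarkov := (mul_meas_ge_le_lintegral (μ := volume) (f := F) (by fun_prop) k).trans hFint
  rw [ENNReal.mul_le_mul_iff_right hk0 (ENNReal.natCast_ne_top k)] at hmarkov
  calc _ ≤ volume {s | (k : ℝ≥0∞) ≤ F s} + volume (Set.range fun i => (ζ i).re) :=
        (measure_mono hsub).trans (measure_union_le _ _)
    _ ≤ ENNReal.ofReal (2 * B) := by rw [hfin, add_zero]; exact hmarkov
    _ = _ := by rw [hB, mul_assoc]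

/-- The restriction of a polynomial to an affine line, as a one-variable polynomial. -/
noncomputable def linePoly {ι : Type*} (P : MvPolynomial ι ℝ) (w u : ι → ℝ) : Polynomial ℝ :=
  aeval (fun i => Polynomial.C (w i) + Polynomial.C (u i) * Polynomial.X) P

theorem eval_linePoly {ι : Type*} (P : MvPolynomial ι ℝ) (w u : ι → ℝ) (s : ℝ) :
    (linePoly P w u).eval s = eval (fun i => w i + s * u i) P := by
  rw [linePoly, ← Polynomial.coe_evalRingHom, aeval_def, hom_eval₂]
  have : (Polynomial.evalRingHom s).comp (algebraMap ℝ (Polynomial ℝ)) = RingHom.id ℝ := by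
    ext; simp
  rw [this]
  change eval _ P = _
  congr 2
  ext i
  simp only [Polynomial.coe_evalRingHom, Polynomial.eval_add, Polynomial.eval_mul,
    Polynomial.eval_C, Polynomial.eval_X]
  ring

theorem natDegree_linePoly_le {ι : Type*} [Fintype ι] {P : MvPolynomial ι ℝ} {k : ℕ}
    (hP : P.IsHomogeneous k) (w u : ι → ℝ) : (linePoly P w u).natDegree ≤ k := by
  rw [linePoly, aeval_def, eval₂_eq']
  refine Polynomial.natDegree_sum_le_of_forall_le _ _ fun m hm => ?_
  have hmk : ∑ i, m i = k := by
    have := hP (mem_support_iff.1 hm)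
    simpa [Finsupp.weight_apply, Finsupp.sum_fintype] using this
  rw [Polynomial.algebraMap_apply]
  refine (Polynomial.natDegree_C_mul_le _ _).trans ((Polynomial.natDegree_prod_le _ _).trans ?_)
  rw [← hmk]
  refine Finset.sum_le_sum fun i _ => ?_
  refine Polynomial.natDegree_pow_le_of_le _ ?_ |>.trans (mul_one (m i)).le
  compute_degree

theorem coeff_prod_sum_of_natDegree_le {ι : Type*} (s : Finset ι) (f : ι → Polynomial ℝ)
    (m : ι → ℕ) (h : ∀ i ∈ s, (f i).natDegree ≤ m i) :
    (∏ i ∈ s, f i).coeff (∑ i ∈ s, m i) = ∏ i ∈ s, (f i).coeff (m i) := by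
  classical
  induction s using Finset.induction_on with
  | empty => simp
  | insert a s ha ih =>
    rw [Finset.prod_insert ha, Finset.sum_insert ha, Finset.prod_insert ha,
      Polynomial.coeff_mul_add_eq_of_natDegree_le (h a (Finset.mem_insert_self _ _))
        ((Polynomial.natDegree_prod_le _ _).trans
          (Finset.sum_le_sum fun i hi => h i (Finset.mem_insert_of_mem hi))),
      ih fun i hi => h i (Finset.mem_insert_of_mem hi)]

theorem coeff_linePoly {ι : Type*} [Fintype ι] {P : MvPolynomial ι ℝ} {k : ℕ}
    (hP : P.IsHomogeneous k) (w u : ι → ℝ) : (linePoly P w u).coeff k = eval u P := by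
  rw [linePoly, aeval_def, eval₂_eq', Polynomial.finsetSum_coeff, eval_eq']
  refine Finset.sum_congr rfl fun m hm => ?_
  have hmk : ∑ i, m i = k := by
    have := hP (mem_support_iff.1 hm)
    simpa [Finsupp.weight_apply, Finsupp.sum_fintype] using this
  rw [Polynomial.algebraMap_apply, Polynomial.coeff_C_mul, ← hmk]
  congr 1
  have h1 : ∀ i, (Polynomial.C (w i) + Polynomial.C (u i) * Polynomial.X).natDegree ≤ 1 :=
    fun i => by compute_degree
  rw [coeff_prod_sum_of_natDegree_le _ _ _ fun i _ =>
    (Polynomial.natDegree_pow_le_of_le (m i) (h1 i)).trans (mul_one (m i)).le]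
  refine Finset.prod_congr rfl fun i _ => ?_
  have := Polynomial.coeff_pow_of_natDegree_le (m := m i) (h1 i)
  rw [mul_one] at this
  rw [this]
  simp

/-- A family of power series whose `i`-th coefficient is a form of degree `i` in the parameter. -/
def GradedSeries {ι : Type*} (F : (ι → ℝ) → PowerSeries ℝ) : Prop :=
  ∀ i, ∃ q : MvPolynomial ι ℝ, q.IsHomogeneous i ∧ ∀ u, PowerSeries.coeff i (F u) = eval u q

namespace GradedSeries
variable {ι : Type*} {F G : (ι → ℝ) → PowerSeries ℝ}

theorem add (hF : GradedSeries F) (hG : GradedSeries G) : GradedSeries fun u => F u + G u := by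
  intro i
  obtain ⟨p, hp, hp'⟩ := hF i
  obtain ⟨q, hq, hq'⟩ := hG i
  exact ⟨p + q, hp.add hq, fun u => by simp [hp', hq']⟩

theorem mul (hF : GradedSeries F) (hG : GradedSeries G) : GradedSeries fun u => F u * G u := by
  intro i
  choose p hp hp' using hF
  choose q hq hq' using hG
  refine ⟨∑ x ∈ Finset.HasAntidiagonal.antidiagonal i, p x.1 * q x.2, ?_, fun u => ?_⟩
  · refine IsHomogeneous.sum _ _ _ fun x hx => ?_
    rw [← Finset.HasAntidiagonal.mem_antidiagonal.1 hx]
    exact (hp _).mul (hq _)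
  · simp [PowerSeries.coeff_mul, hp', hq']

theorem const (a : ℝ) : GradedSeries fun _ : ι → ℝ => PowerSeries.C a := by
  intro i
  rcases Nat.eq_zero_or_pos i with rfl | hi
  · exact ⟨C a, isHomogeneous_C _ _, fun u => by simp⟩
  · exact ⟨0, isHomogeneous_zero _ _ _, fun u => by simp [PowerSeries.coeff_C, hi.ne']⟩

theorem coord (j : ι) : GradedSeries fun u : ι → ℝ => PowerSeries.C (u j) * PowerSeries.X := by
  intro i
  rcases eq_or_ne i 1 with rfl | hi
  · exact ⟨X j, isHomogeneous_X _ _, fun u => by simp⟩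
  · refine ⟨0, isHomogeneous_zero _ _ _, fun u => ?_⟩
    simp [PowerSeries.coeff_C_mul, PowerSeries.coeff_X, hi]

theorem inv (hF : GradedSeries F) {a : ℝ} (ha : ∀ u, PowerSeries.constantCoeff (F u) = a) :
    GradedSeries fun u => (F u)⁻¹ := by
  intro i
  induction i using Nat.strong_induction_on with
  | _ i ih =>
    choose p hp hp' using hF
    rcases Nat.eq_zero_or_pos i with rfl | hi
    · exact ⟨C a⁻¹, isHomogeneous_C _ _, fun u => by simp [ha]⟩
    · choose q hq hq' using ih
      refine ⟨C (-a⁻¹) * ∑ x ∈ (Finset.HasAntidiagonal.antidiagonal i).attach,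
        if h : x.1.2 < i then p x.1.1 * q x.1.2 h else 0, ?_, fun u => ?_⟩
      · suffices hs : (∑ x ∈ (Finset.HasAntidiagonal.antidiagonal i).attach,
            if h : x.1.2 < i then p x.1.1 * q x.1.2 h else 0).IsHomogeneous i by
          simpa only [zero_add] using (isHomogeneous_C ι (-a⁻¹)).mul hs
        refine IsHomogeneous.sum _ _ i fun x hx => ?_
        split_ifs with h
        · have := Finset.HasAntidiagonal.mem_antidiagonal.1 x.2
          have h2 := (hp x.1.1).mul (hq x.1.2 h)
          rwa [this] at h2
        · exact isHomogeneous_zero _ _ _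
      · rw [PowerSeries.coeff_inv, if_neg hi.ne', ha, map_mul, eval_C, map_sum,
          ← Finset.sum_attach]
        congr 1
        refine Finset.sum_congr rfl fun x _ => ?_
        split_ifs with h
        · rw [hp', hq', map_mul]
        · simp

theorem linePoly (P : MvPolynomial ι ℝ) (z : ι → ℝ) :
    GradedSeries fun u => (SmoothedKappa.linePoly P z u : PowerSeries ℝ) := by
  induction P using MvPolynomial.induction_on with
  | C a =>
    simpa [SmoothedKappa.linePoly, Polynomial.algebraMap_apply] using GradedSeries.const (ι := ι) a
  | add p q hp hq => simpa [SmoothedKappa.linePoly] using hp.add hq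
  | mul_X p j hp =>
    simpa [SmoothedKappa.linePoly] using hp.mul ((GradedSeries.const (z j)).add (coord j))

end GradedSeries

/-- Dividing a power series by `X - ζ` preserves geometric decay at any radius below `‖ζ‖`. -/
theorem decay_of_X_sub_mul {g h : PowerSeries ℂ} {ζ : ℂ} {r : ℝ} (hr : 0 < r) (hζ : r < ‖ζ‖)
    (hgh : (PowerSeries.X - PowerSeries.C ζ) * h = g)
    (hg : ∃ c : ℝ, ∀ k, ‖PowerSeries.coeff k g‖ * r ^ k ≤ c) :
    ∃ c : ℝ, ∀ k, ‖PowerSeries.coeff k h‖ * r ^ k ≤ c := by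
  obtain ⟨c, hc⟩ := hg
  refine ⟨max (‖PowerSeries.coeff 0 h‖) (c / (‖ζ‖ - r)), fun k => ?_⟩
  have hd : 0 < ‖ζ‖ - r := sub_pos.2 hζ
  induction k with
  | zero => simp
  | succ k ih =>
    have h1 : PowerSeries.coeff (k + 1) g =
        PowerSeries.coeff k h - ζ * PowerSeries.coeff (k + 1) h := by
      rw [← hgh, sub_mul, map_sub, PowerSeries.coeff_succ_X_mul, PowerSeries.coeff_C_mul]
    have h2 : ‖ζ‖ * ‖PowerSeries.coeff (k + 1) h‖ ≤
        ‖PowerSeries.coeff k h‖ + ‖PowerSeries.coeff (k + 1) g‖ := by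
      rw [← norm_mul]
      have : ζ * PowerSeries.coeff (k + 1) h =
        PowerSeries.coeff k h - PowerSeries.coeff (k + 1) g := by rw [h1]; ring
      rw [this]
      exact norm_sub_le _ _
    set m := max (‖PowerSeries.coeff 0 h‖) (c / (‖ζ‖ - r)) with hm
    have h3 : c ≤ m * (‖ζ‖ - r) := by
      rw [← div_le_iff₀ hd]
      exact le_max_right _ _
    have h4 := hc (k + 1)
    have h5 : ‖ζ‖ * (‖PowerSeries.coeff (k + 1) h‖ * r ^ (k + 1)) ≤ ‖ζ‖ * m := by
      calc _ = (‖ζ‖ * ‖PowerSeries.coeff (k + 1) h‖) * r ^ (k + 1) := by ring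
        _ ≤ (‖PowerSeries.coeff k h‖ + ‖PowerSeries.coeff (k + 1) g‖) * r ^ (k + 1) := by gcongr
        _ = (‖PowerSeries.coeff k h‖ * r ^ k) * r +
            ‖PowerSeries.coeff (k + 1) g‖ * r ^ (k + 1) := by ring
        _ ≤ m * r + m * (‖ζ‖ - r) := by
          refine add_le_add (mul_le_mul_of_nonneg_right ih hr.le) (h4.trans h3)
        _ = _ := by ring
    exact le_of_mul_le_mul_left h5 (hr.trans hζ)

theorem decay_of_prod_mul {r : ℝ} (hr : 0 < r) {k : ℕ} (ζ : Fin k → ℂ) (hζ : ∀ i, r < ‖ζ i‖)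
    (s : Finset (Fin k)) (h : PowerSeries ℂ)
    (hg : ∃ c : ℝ, ∀ k, ‖PowerSeries.coeff k
      ((∏ i ∈ s, (PowerSeries.X - PowerSeries.C (ζ i))) * h)‖ * r ^ k ≤ c) :
    ∃ c : ℝ, ∀ k, ‖PowerSeries.coeff k h‖ * r ^ k ≤ c := by
  classical
  induction s using Finset.induction_on with
  | empty => simpa using hg
  | insert a s ha ih =>
    refine ih (decay_of_X_sub_mul hr (hζ a) rfl ?_)
    rwa [Finset.prod_insert ha, mul_assoc] at hg

/-- The coefficients of the inverse of a polynomial without zeros in the closed disc of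
radius `r` are `O(r ^ (-k))`. -/
theorem decay_of_no_root {p : Polynomial ℝ} {r : ℝ} (hr : 0 < r) (hp : p.coeff 0 ≠ 0)
    (h : ∀ ζ : ℂ, ‖ζ‖ ≤ r → Polynomial.aeval ζ p ≠ 0) :
    ∃ c : ℝ, ∀ k, |PowerSeries.coeff k (p : PowerSeries ℝ)⁻¹| * r ^ k ≤ c := by
  set p' := p.map Complex.ofRealHom with hp'
  obtain ⟨ζ, hζ⟩ := exists_eval_eq_coeff_mul_prod (p := p') rfl
  have hroot : ∀ i, r < ‖ζ i‖ := by
    intro i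
    by_contra hcon
    refine h _ (not_lt.1 hcon) ?_
    have h1 := hζ (ζ i)
    rw [Finset.prod_eq_zero (Finset.mem_univ i) (sub_self _), mul_zero] at h1
    rw [← h1, hp', Polynomial.eval_map]
    rfl
  have hpoly : p' = Polynomial.C (p'.coeff p'.natDegree) *
      ∏ i, (Polynomial.X - Polynomial.C (ζ i)) := by
    refine Polynomial.funext fun z => ?_
    rw [hζ z]
    simp [Polynomial.eval_prod]
  have hser : (PowerSeries.map Complex.ofRealHom) (p : PowerSeries ℝ) =
      PowerSeries.C (p'.coeff p'.natDegree) *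
        ∏ i, (PowerSeries.X - PowerSeries.C (ζ i)) := by
    have := congrArg (Polynomial.coeToPowerSeries.ringHom (R := ℂ)) hpoly
    simp only [map_mul, map_prod, map_sub, Polynomial.coeToPowerSeries.ringHom_apply,
      Polynomial.coe_C, Polynomial.coe_X] at this
    rw [← this, hp', Polynomial.polynomial_map_coe]
  have hc : p'.coeff p'.natDegree ≠ 0 := by
    intro h0
    refine hp ?_
    rw [h0, map_zero, zero_mul] at hpoly
    have h1 := congrArg (Polynomial.coeff · 0) hpoly
    simpa [hp'] using h1
  set g := (PowerSeries.map Complex.ofRealHom) (p : PowerSeries ℝ)⁻¹ with hg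
  have hinv : (∏ i, (PowerSeries.X - PowerSeries.C (ζ i))) *
      (PowerSeries.C (p'.coeff p'.natDegree) * g) = 1 := by
    rw [← mul_assoc, mul_comm _ (PowerSeries.C _), ← hser, hg, ← map_mul,
      PowerSeries.mul_inv_cancel _ (by simpa using hp), map_one]
  obtain ⟨c, hc'⟩ := decay_of_prod_mul hr ζ hroot Finset.univ _ ⟨1, fun k => by
    rw [hinv, PowerSeries.coeff_one]
    split_ifs with hk
    · simp [hk]
    · simp⟩
  refine ⟨c / ‖p'.coeff p'.natDegree‖, fun k => ?_⟩
  rw [le_div_iff₀ (norm_pos_iff.2 hc)]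
  have h2 := hc' k
  rw [PowerSeries.coeff_C_mul, hg, PowerSeries.coeff_map, norm_mul] at h2
  have h3 : ‖Complex.ofRealHom (PowerSeries.coeff k (p : PowerSeries ℝ)⁻¹)‖ =
    |PowerSeries.coeff k (p : PowerSeries ℝ)⁻¹| := by simp
  rw [h3] at h2
  linarith

/-- If a polynomial vanishes at `1`, the coefficients of its inverse do not decay. -/
theorem exists_lt_coeff_inv {p : Polynomial ℝ} (hp : p.coeff 0 ≠ 0) (h1 : p.eval 1 = 0)
    {q : ℝ} (hq0 : 0 < q) (hq : q < 1) (c : ℝ) :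
    ∃ k, c * q ^ k < |PowerSeries.coeff k (p : PowerSeries ℝ)⁻¹| := by
  by_contra! hcon
  have hs : Summable fun k => ‖PowerSeries.coeff k (p : PowerSeries ℝ)⁻¹‖ :=
    Summable.of_nonneg_of_le (fun k => norm_nonneg _) hcon
      ((summable_geometric_of_lt_one hq0.le hq).mul_left c)
  have hs' : Summable fun k => ‖p.coeff k‖ :=
    summable_of_ne_finset_zero (s := p.support) fun k hk => by
      rw [Polynomial.notMem_support_iff.1 hk, norm_zero]
  have key := tsum_mul_tsum_eq_tsum_sum_antidiagonal_of_summable_norm hs' hs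
  have e1 : ∑' k, p.coeff k = 0 := by
    rw [tsum_eq_sum (s := p.support) fun k hk => Polynomial.notMem_support_iff.1 hk, ← h1,
      Polynomial.eval_eq_sum, Polynomial.sum]
    simp
  have e2 : ∀ n, ∑ kl ∈ Finset.HasAntidiagonal.antidiagonal n,
      p.coeff kl.1 * PowerSeries.coeff kl.2 (p : PowerSeries ℝ)⁻¹ = if n = 0 then 1 else 0 := by
    intro n
    rw [← PowerSeries.coeff_one, ← PowerSeries.mul_inv_cancel (p : PowerSeries ℝ)
      (by simpa using hp), PowerSeries.coeff_mul]
    simp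
  simp_rw [e2] at key
  rw [e1, zero_mul, tsum_ite_eq] at key
  exact zero_ne_one key

/-- If `P` has a zero at `z + u₀`, then for most Gaussian directions `u` the restriction of `P`
to the line `z + ζ u` has a complex zero of modulus comparable to `‖u₀‖`. -/
theorem stdGaussian_no_root_le {ι : Type*} [Fintype ι] (P : MvPolynomial ι ℝ)
    (z u₀ : EuclideanSpace ℝ ι) (hz : eval z P ≠ 0) (h0 : eval (z + u₀) P = 0)
    {r : ℝ} (hr : 0 < r) :
    stdGaussian (EuclideanSpace ℝ ι)
        {u | ∀ ζ : ℂ, ‖ζ‖ ≤ r → Polynomial.aeval ζ (linePoly P z u) ≠ 0} ≤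
      ENNReal.ofReal (Real.sqrt (2 * Real.pi))⁻¹ *
        ENNReal.ofReal (2 * Real.exp 1 * (‖u₀‖ / r)) := by
  have hconst : ∀ u, (linePoly P z u).coeff 0 = eval z P := fun u => by
    rw [Polynomial.coeff_zero_eq_eval_zero, eval_linePoly]
    simp
  have hgr := (GradedSeries.linePoly P z).inv (a := eval z P) fun u => by
    simpa using hconst u
  choose h hh hh' using hgr
  have hu0 : 0 < ‖u₀‖ := by
    refine norm_pos_iff.2 fun h => hz ?_
    rw [h, add_zero] at h0
    exact h0
  set Bad : ℕ → Set (EuclideanSpace ℝ ι) := fun j => {u | ∀ k, |eval u (h k)| * r ^ k ≤ j}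
    with hBad
  have hmono : Monotone Bad := fun i j hij u hu k =>
    (hu k).trans (by exact_mod_cast hij)
  have hcont : ∀ k, Continuous fun u : EuclideanSpace ℝ ι => eval u (h k) := fun k =>
    (MvPolynomial.continuous_eval (h k)).comp (PiLp.continuous_ofLp 2 _)
  have hsub : {u : EuclideanSpace ℝ ι | ∀ ζ : ℂ, ‖ζ‖ ≤ r →
      Polynomial.aeval ζ (linePoly P z u) ≠ 0} ⊆ ⋃ j, Bad j := by
    intro u hu
    obtain ⟨c, hc⟩ := decay_of_no_root hr (by rw [hconst u]; exact hz) hu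
    obtain ⟨j, hj⟩ := exists_nat_ge c
    refine Set.mem_iUnion.2 ⟨j, fun k => ?_⟩
    rw [← hh']
    exact (hc k).trans hj
  refine (measure_mono hsub).trans ?_
  rw [hmono.measure_iUnion]
  refine iSup_le fun j => ?_
  have key : ∀ q ∈ Set.Ioo (0 : ℝ) 1, stdGaussian (EuclideanSpace ℝ ι) (Bad j) ≤
      ENNReal.ofReal (Real.sqrt (2 * Real.pi))⁻¹ *
        ENNReal.ofReal (2 * Real.exp 1 * (‖u₀‖ / (q * r))) := by
    rintro q ⟨hq0, hq1⟩
    obtain ⟨k, hk⟩ := exists_lt_coeff_inv (p := linePoly P z u₀) (by rw [hconst]; exact hz)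
      (by rw [eval_linePoly]; simp only [one_mul]; exact h0) hq0 hq1 (max j |(eval z P)⁻¹|)
    rw [hh'] at hk
    have hk1 : 1 ≤ k := by
      by_contra hcon
      obtain rfl : k = 0 := by omega
      rw [← hh', PowerSeries.coeff_zero_eq_constantCoeff_apply, PowerSeries.constantCoeff_inv] at hk
      have : PowerSeries.constantCoeff (linePoly P z u₀ : PowerSeries ℝ) = eval z P := by
        simpa using hconst u₀
      rw [this, pow_zero, mul_one] at hk
      exact absurd hk (not_lt.2 (le_max_right _ _))
    have hj : j * q ^ k < |eval u₀ (h k)| :=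
      lt_of_le_of_lt (by gcongr; exact le_max_left _ _) hk
    refine (measure_mono (t := {u : EuclideanSpace ℝ ι | |eval u (h k)| * r ^ k ≤ j})
      fun u hu => (hu : ∀ k, |eval u.ofLp (h k)| * r ^ k ≤ j) k).trans ?_
    have hcl : IsClosed {u : EuclideanSpace ℝ ι | |eval u (h k)| * r ^ k ≤ j} :=
      isClosed_le (((hcont k).abs).mul_const _) continuous_const
    refine stdGaussian_le_of_slices hcl.measurableSet (u := ‖u₀‖⁻¹ • u₀)
      (by rw [norm_smul, norm_inv, norm_norm, inv_mul_cancel₀ hu0.ne']) fun w => ?_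
    have hhom : eval (‖u₀‖⁻¹ • u₀).ofLp (h k) = (‖u₀‖⁻¹) ^ k * eval u₀ (h k) :=
      eval_smul_of_isHomogeneous (hh k) _ _
    have ha : (linePoly (h k) w (‖u₀‖⁻¹ • u₀).ofLp).coeff k ≠ 0 := by
      rw [coeff_linePoly (hh k), hhom]
      refine mul_ne_zero (by positivity) fun h => ?_
      rw [h, abs_zero] at hj
      exact absurd hj (not_lt.2 (by positivity))
    refine le_trans (measure_mono fun τ hτ => ?_) (volume_polynomial_le hk1
      (natDegree_linePoly_le (hh k) _ _) ha (A := ‖u₀‖ / (q * r)) (by positivity))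
    change |eval (w + τ • ‖u₀‖⁻¹ • u₀).ofLp (h k)| * r ^ k ≤ j at hτ
    rw [Set.mem_ofPred_eq, eval_linePoly, coeff_linePoly (hh k), hhom, abs_mul (‖u₀‖⁻¹ ^ k),
      abs_of_pos (show 0 < ‖u₀‖⁻¹ ^ k by positivity)]
    have : (fun i => w i + τ * (‖u₀‖⁻¹ • u₀).ofLp i) = (w + τ • ‖u₀‖⁻¹ • u₀).ofLp := by
      ext i; simp
    rw [this, div_pow, inv_pow, mul_pow]
    have e : ‖u₀‖ ^ k / (q ^ k * r ^ k) * ((‖u₀‖ ^ k)⁻¹ * |eval u₀ (h k)|) =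
        |eval u₀ (h k)| / (q ^ k * r ^ k) := by field_simp
    rw [e, le_div_iff₀ (by positivity)]
    calc _ = (|eval (w + τ • ‖u₀‖⁻¹ • u₀).ofLp (h k)| * r ^ k) * q ^ k := by ring
      _ ≤ j * q ^ k := by gcongr
      _ ≤ _ := hj.le
  have hlim : Filter.Tendsto (fun q : ℝ => ENNReal.ofReal (Real.sqrt (2 * Real.pi))⁻¹ *
      ENNReal.ofReal (2 * Real.exp 1 * (‖u₀‖ / (q * r)))) (nhdsWithin 1 (Set.Iio 1))
      (nhds (ENNReal.ofReal (Real.sqrt (2 * Real.pi))⁻¹ *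
        ENNReal.ofReal (2 * Real.exp 1 * (‖u₀‖ / (1 * r))))) := by
    refine ENNReal.Tendsto.const_mul ?_ (Or.inr ENNReal.ofReal_ne_top)
    refine ENNReal.tendsto_ofReal (Filter.Tendsto.mono_left ?_ nhdsWithin_le_nhds)
    have : ContinuousAt (fun q : ℝ => 2 * Real.exp 1 * (‖u₀‖ / (q * r))) 1 := by
      have : (1 : ℝ) * r ≠ 0 := by positivity
      fun_prop (disch := assumption)
    exact this
  rw [one_mul] at hlim
  exact ge_of_tendsto hlim (Filter.mem_of_superset (Ioo_mem_nhdsLT one_pos) key)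

section Radial
variable (V : Type*) [NormedAddCommGroup V] [InnerProductSpace ℝ V]

/-- The radial density of the standard Gaussian measure. -/
noncomputable def radialDensity (ρ : ℝ) : ℝ≥0∞ :=
  ENNReal.ofReal (ρ ^ (Module.finrank ℝ V - 1)) *
    ENNReal.ofReal (gaussConst V * Real.exp (-(1 / 2) * ρ ^ 2))

/-- The total radial mass of the standard Gaussian measure. -/
noncomputable def radialMass : ℝ≥0∞ := ∫⁻ ρ in Set.Ioi (0 : ℝ), radialDensity V ρ

theorem measurable_radialDensity : Measurable (radialDensity V) := by
  unfold radialDensity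
  fun_prop

variable {V}

theorem lintegral_radialDensity_pow (hV : 1 ≤ Module.finrank ℝ V) (k : ℕ) :
    ∫⁻ ρ in Set.Ioi (0 : ℝ), radialDensity V ρ * ENNReal.ofReal (ρ ^ k) =
      ENNReal.ofReal (gaussConst V *
          ((1 / 2 : ℝ) ^ (-((Module.finrank ℝ V + k : ℝ) / 2)) * (1 / 2) *
        Real.Gamma ((Module.finrank ℝ V + k : ℝ) / 2))) := by
  have hq : (-1 : ℝ) < (Module.finrank ℝ V - 1 + k : ℕ) :=
    lt_of_lt_of_le (by norm_num) (Nat.cast_nonneg _)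
  have key := integral_rpow_mul_exp_neg_mul_rpow (p := 2) (b := 1 / 2) (by norm_num) hq
    (by norm_num)
  have hint := integrableOn_rpow_mul_exp_neg_mul_sq (b := 1 / 2) (by norm_num) hq
  have e : ((Module.finrank ℝ V - 1 + k : ℕ) : ℝ) + 1 = Module.finrank ℝ V + k := by
    push_cast [Nat.cast_sub hV]; ring
  rw [e, neg_div] at key
  rw [← key, ← integral_const_mul, ofReal_integral_eq_lintegral_ofReal]
  · refine setLIntegral_congr_fun measurableSet_Ioi fun ρ hρ => ?_
    have hρ : 0 < ρ := hρ
    have := (gaussConst_pos V).le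
    simp only [radialDensity]
    rw [← ENNReal.ofReal_mul (by positivity), ← ENNReal.ofReal_mul (by positivity)]
    congr 1
    rw [Real.rpow_natCast, pow_add, Real.rpow_two]
    ring
  · refine Integrable.const_mul ?_ _
    refine hint.congr_fun (fun x hx => ?_) measurableSet_Ioi
    simp only [Real.rpow_two]
  · refine (ae_restrict_iff' measurableSet_Ioi).2 (Filter.Eventually.of_forall fun x hx => ?_)
    have hx : 0 < x := hx
    have := (gaussConst_pos V).le
    positivity

theorem lintegral_radialDensity_sq (hV : 1 ≤ Module.finrank ℝ V) :
    ∫⁻ ρ in Set.Ioi (0 : ℝ), radialDensity V ρ * ENNReal.ofReal (ρ ^ 2) =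
      ENNReal.ofReal (Module.finrank ℝ V) * radialMass V := by
  have h0 := lintegral_radialDensity_pow hV 0
  have hM : (0 : ℝ) < Module.finrank ℝ V := by exact_mod_cast hV
  simp only [pow_zero, ENNReal.ofReal_one, mul_one] at h0
  rw [radialMass, h0, lintegral_radialDensity_pow hV 2, ← ENNReal.ofReal_mul hM.le]
  congr 1
  have e1 : ((Module.finrank ℝ V : ℝ) + (2 : ℕ)) / 2 = (Module.finrank ℝ V : ℝ) / 2 + 1 := by
    push_cast; ring
  have e2 : ((Module.finrank ℝ V : ℝ) + (0 : ℕ)) / 2 = (Module.finrank ℝ V : ℝ) / 2 := by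
    push_cast; ring
  rw [e1, e2, Real.Gamma_add_one (by positivity), neg_add, Real.rpow_add (by norm_num),
    Real.rpow_neg_one]
  ring

theorem lintegral_radialDensity_linear_le (hV : 1 ≤ Module.finrank ℝ V) :
    ∫⁻ ρ in Set.Ioi (0 : ℝ), radialDensity V ρ *
      ENNReal.ofReal (ρ / (2 * Real.sqrt (Module.finrank ℝ V))) ≤ radialMass V / 2 := by
  set M : ℝ := (Module.finrank ℝ V : ℝ) with hM'
  have hM : 0 < M := by rw [hM']; exact_mod_cast hV
  have hb : ∀ ρ : ℝ, radialDensity V ρ * ENNReal.ofReal (ρ / (2 * Real.sqrt M)) ≤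
      ENNReal.ofReal (4 * M)⁻¹ * (radialDensity V ρ * ENNReal.ofReal (ρ ^ 2)) +
        ENNReal.ofReal (1 / 4) * radialDensity V ρ := by
    intro ρ
    have h1 : ρ / (2 * Real.sqrt M) ≤ (4 * M)⁻¹ * ρ ^ 2 + 1 / 4 := by
      have hs : 0 < Real.sqrt M := Real.sqrt_pos.2 hM
      have e : (4 * M)⁻¹ * ρ ^ 2 + 1 / 4 - ρ / (2 * Real.sqrt M) =
          (ρ / (2 * Real.sqrt M) - 1 / 2) ^ 2 := by
        have : M = Real.sqrt M ^ 2 := (Real.sq_sqrt hM.le).symm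
        nth_rewrite 1 [this]
        field_simp
        ring
      nlinarith [sq_nonneg (ρ / (2 * Real.sqrt M) - 1 / 2)]
    calc _ ≤ radialDensity V ρ * ENNReal.ofReal ((4 * M)⁻¹ * ρ ^ 2 + 1 / 4) := by gcongr
      _ = _ := by
        rw [ENNReal.ofReal_add (by positivity) (by positivity),
          ENNReal.ofReal_mul (by positivity)]
        ring
  refine (lintegral_mono hb).trans ?_
  have hm := measurable_radialDensity V
  rw [lintegral_add_right _ (by fun_prop), lintegral_const_mul _ (by fun_prop),
    lintegral_const_mul _ hm, lintegral_radialDensity_sq hV, ← hM', ← mul_assoc,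
    ← ENNReal.ofReal_mul (by positivity), ← radialMass, ← add_mul,
    ← ENNReal.ofReal_add (by positivity) (by positivity)]
  have : (4 * M)⁻¹ * M + 1 / 4 = 2⁻¹ := by field_simp; norm_num
  rw [this, ENNReal.ofReal_inv_of_pos two_pos, ENNReal.ofReal_ofNat, mul_comm]
  rfl

variable [FiniteDimensional ℝ V] [MeasurableSpace V] [BorelSpace V] [Nontrivial V]

theorem stdGaussian_cone {K : Set V} (hK : MeasurableSet K)
    (hc : ∀ z, ∀ ρ : ℝ, 0 < ρ → (ρ • z ∈ K ↔ z ∈ K)) :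
    stdGaussian V K = (volume : Measure V).toSphere {θ | (θ : V) ∈ K} * radialMass V := by
  have hK' : MeasurableSet {θ : sphere (0 : V) 1 | (θ : V) ∈ K} :=
    hK.preimage measurable_subtype_coe
  rw [← lintegral_indicator_one hK, lintegral_stdGaussian_polar _ (measurable_one.indicator hK),
    ← lintegral_indicator_one hK', ← lintegral_mul_const]
  · refine lintegral_congr fun θ => ?_
    rw [radialMass, ← lintegral_const_mul _ (measurable_radialDensity V)]
    refine setLIntegral_congr_fun measurableSet_Ioi fun ρ hρ => ?_
    have : (ρ • (θ : V) ∈ K ↔ (θ : V) ∈ K) := hc _ _ hρ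
    by_cases h : (θ : V) ∈ K
    · simp [Set.indicator, this, h, radialDensity]
    · simp [Set.indicator, this, h]
  · exact measurable_one.indicator hK'

theorem radialMass_spec : (volume : Measure V).toSphere Set.univ * radialMass V = 1 := by
  have := stdGaussian_cone (V := V) MeasurableSet.univ (by simp)
  rw [measure_univ] at this
  simpa using this.symm

theorem radialMass_ne_top : radialMass V ≠ ∞ := by
  intro h
  have := radialMass_spec (V := V)
  rw [h] at this
  by_cases h0 : (volume : Measure V).toSphere Set.univ = 0
  · simp [h0] at this
  · rw [ENNReal.mul_top h0] at this
    exact ENNReal.top_ne_one this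

theorem radialMass_ne_zero : radialMass V ≠ 0 := by
  intro h
  have := radialMass_spec (V := V)
  simp [h] at this

end Radial

section Shadow
variable {ι : Type*}

theorem aeval_linePoly (P : MvPolynomial ι ℝ) (z u : ι → ℝ) (ζ : ℂ) :
    Polynomial.aeval ζ (linePoly P z u) = aeval (fun i => (z i : ℂ) + ζ * u i) P := by
  rw [linePoly, MvPolynomial.comp_aeval_apply]
  congr 2
  ext i
  simp
  ring

/-- The pairs `(z, u)` for which `P (z + ζ u)` has a complex root `ζ` with `‖ζ‖ ≤ r`. -/
def rootPairs (P : MvPolynomial ι ℝ) (r : ℝ) : Set (EuclideanSpace ℝ ι × EuclideanSpace ℝ ι) :=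
  {p | ∃ ζ : ℂ, ‖ζ‖ ≤ r ∧ Polynomial.aeval ζ (linePoly P p.1 p.2) = 0}

theorem isClosed_rootPairs (P : MvPolynomial ι ℝ) (r : ℝ) : IsClosed (rootPairs P r) := by
  have hc : IsClosed {q : closedBall (0 : ℂ) r × (EuclideanSpace ℝ ι × EuclideanSpace ℝ ι) |
      aeval (fun i => (q.2.1 i : ℂ) + q.1 * q.2.2 i) P = 0} := by
    refine isClosed_eq ?_ continuous_const
    simp only [aeval_def, ← eval_map]
    refine (MvPolynomial.continuous_eval _).comp (continuous_pi fun i => ?_)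
    fun_prop
  have := isClosedMap_snd_of_compactSpace _ hc
  convert this using 1
  ext p
  simp only [rootPairs, Set.mem_ofPred_eq, Set.mem_image, Prod.exists, exists_eq_right,
    Subtype.exists, mem_closedBall_zero_iff, aeval_linePoly, exists_prop]

variable [Fintype ι]

theorem stdGaussian_rootPairs_slice_ge {P : MvPolynomial ι ℝ} {δ : ℕ} (hP : P.IsHomogeneous δ)
    {r ε ρ : ℝ} (hr : 0 < r) (hρ : 0 < ρ) {θ w : EuclideanSpace ℝ ι} (hw : eval w P = 0)
    (hwθ : ‖w - θ‖ ≤ ε) :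
    1 ≤ stdGaussian (EuclideanSpace ℝ ι) {u | (ρ • θ, u) ∈ rootPairs P r} +
      ENNReal.ofReal (2 * Real.exp 1 * ε / (Real.sqrt (2 * Real.pi) * r) * ρ) := by
  obtain ⟨z, hzdef⟩ : ∃ z, z = ρ • θ := ⟨_, rfl⟩
  rw [← hzdef]
  by_cases hz : eval z P = 0
  · have : {u | (z, u) ∈ rootPairs P r} = Set.univ := by
      refine Set.eq_univ_of_forall fun u => ⟨0, by simpa using hr.le, ?_⟩
      have : Polynomial.aeval (0 : ℂ) (linePoly P (z) u) =
          algebraMap ℝ ℂ ((linePoly P (z) u).eval 0) := by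
        rw [← Polynomial.aeval_algebraMap_apply_eq_algebraMap_eval, map_zero]
      change Polynomial.aeval (0 : ℂ) (linePoly P z u) = 0
      simp only [this, eval_linePoly, zero_mul, add_zero, hz, map_zero]
    rw [this, measure_univ]
    exact le_self_add
  · have h0 : eval (z + ρ • (w - θ)).ofLp P = 0 := by
      have : z + ρ • (w - θ) = ρ • w := by rw [hzdef, ← smul_add]; simp
      rw [this, WithLp.ofLp_smul, eval_smul_of_isHomogeneous hP, hw, mul_zero]
    have := stdGaussian_no_root_le P (z) (ρ • (w - θ)) hz h0 hr
    have hcompl : {u | (z, u) ∈ rootPairs P r}ᶜ = {u : EuclideanSpace ℝ ι | ∀ ζ : ℂ, ‖ζ‖ ≤ r →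
        Polynomial.aeval ζ (linePoly P (z) u) ≠ 0} := by
      ext u
      simp [rootPairs]
    rw [← hcompl] at this
    have hm : MeasurableSet {u | (z, u) ∈ rootPairs P r} :=
      (isClosed_rootPairs P r).measurableSet.preimage (by fun_prop)
    rw [← prob_add_prob_compl (μ := stdGaussian (EuclideanSpace ℝ ι)) hm]
    gcongr
    refine this.trans ?_
    rw [← ENNReal.ofReal_mul (by positivity)]
    apply ENNReal.ofReal_le_ofReal
    rw [norm_smul, Real.norm_of_nonneg hρ.le]
    calc _ = (Real.sqrt (2 * Real.pi))⁻¹ * (2 * Real.exp 1 * (ρ * ‖w - θ‖ / r)) := rfl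
      _ ≤ (Real.sqrt (2 * Real.pi))⁻¹ * (2 * Real.exp 1 * (ρ * ε / r)) := by gcongr
      _ = _ := by field_simp

theorem toSphere_mul_radialMass_le [Nonempty ι] {P : MvPolynomial ι ℝ} {δ : ℕ}
    (hP : P.IsHomogeneous δ) {ε r : ℝ} (hε : 0 < ε)
    (hr : r = 4 * Real.exp 1 * ε * Real.sqrt (Fintype.card ι) / Real.sqrt (2 * Real.pi))
    {K : Set (EuclideanSpace ℝ ι)} (hK : MeasurableSet K)
    (hc : ∀ z, ∀ ρ : ℝ, 0 < ρ → (ρ • z ∈ K ↔ z ∈ K)) :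
    (volume : Measure (EuclideanSpace ℝ ι)).toSphere
        {θ | (θ : EuclideanSpace ℝ ι) ∈ K ∧ ∃ w : EuclideanSpace ℝ ι, eval w P = 0 ∧ ‖w - θ‖ ≤ ε} *
      (radialMass (EuclideanSpace ℝ ι) / 2) ≤
    ((stdGaussian (EuclideanSpace ℝ ι)).prod (stdGaussian (EuclideanSpace ℝ ι)))
      {p | p.1 ∈ K ∧ p ∈ rootPairs P r} := by
  have hM : 1 ≤ Module.finrank ℝ (EuclideanSpace ℝ ι) := by
    rw [finrank_euclideanSpace]; exact Fintype.card_pos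
  have hG := (isClosed_rootPairs P r).measurableSet
  have hS : MeasurableSet {p : EuclideanSpace ℝ ι × EuclideanSpace ℝ ι |
      p.1 ∈ K ∧ p ∈ rootPairs P r} := (hK.preimage measurable_fst).inter hG
  have hr0 : 0 < r := by
    rw [hr]
    have : (0 : ℝ) < Fintype.card ι := by exact_mod_cast Fintype.card_pos
    positivity
  rw [Measure.prod_apply hS, lintegral_stdGaussian_polar _ (measurable_measure_prodMk_left hS)]
  set F : sphere (0 : EuclideanSpace ℝ ι) 1 → ℝ≥0∞ := fun θ =>
    ∫⁻ ρ in Set.Ioi (0 : ℝ), ENNReal.ofReal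
      (ρ ^ (Module.finrank ℝ (EuclideanSpace ℝ ι) - 1)) * (ENNReal.ofReal
        (gaussConst (EuclideanSpace ℝ ι) * Real.exp (-(1 / 2) * ρ ^ 2)) *
        stdGaussian (EuclideanSpace ℝ ι) (Prod.mk (ρ • (θ : EuclideanSpace ℝ ι)) ⁻¹'
          {p | p.1 ∈ K ∧ p ∈ rootPairs P r})) with hF
  have hFm : Measurable F := by
    refine Measurable.lintegral_prod_right' (f := fun q : sphere (0 : EuclideanSpace ℝ ι) 1 × ℝ =>
      ENNReal.ofReal (q.2 ^ (Module.finrank ℝ (EuclideanSpace ℝ ι) - 1)) * (ENNReal.ofReal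
        (gaussConst (EuclideanSpace ℝ ι) * Real.exp (-(1 / 2) * q.2 ^ 2)) *
        stdGaussian (EuclideanSpace ℝ ι) (Prod.mk (q.2 • (q.1 : EuclideanSpace ℝ ι)) ⁻¹'
          {p | p.1 ∈ K ∧ p ∈ rootPairs P r}))) ?_
    have := (measurable_measure_prodMk_left (ν := stdGaussian (EuclideanSpace ℝ ι)) hS).comp
      (show Measurable fun q : sphere (0 : EuclideanSpace ℝ ι) 1 × ℝ =>
        q.2 • (q.1 : EuclideanSpace ℝ ι) by fun_prop)
    exact Measurable.mul (by fun_prop) (Measurable.mul (by fun_prop) this)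
  have hsub : {θ : sphere (0 : EuclideanSpace ℝ ι) 1 | (θ : EuclideanSpace ℝ ι) ∈ K ∧
      ∃ w : EuclideanSpace ℝ ι, eval w P = 0 ∧ ‖w - θ‖ ≤ ε} ⊆
      {θ | radialMass (EuclideanSpace ℝ ι) / 2 ≤ F θ} := by
    rintro θ ⟨hθ, w, hw, hwθ⟩
    change _ ≤ F θ
    have hfin : radialMass (EuclideanSpace ℝ ι) / 2 ≠ ∞ :=
      ENNReal.div_ne_top radialMass_ne_top two_ne_zero
    refine ENNReal.le_of_add_le_add_right hfin ?_
    rw [ENNReal.add_halves]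
    have hlin := lintegral_radialDensity_linear_le hM
    refine le_trans ?_ (add_le_add_right hlin _)
    have := measurable_radialDensity (EuclideanSpace ℝ ι)
    rw [hF, ← lintegral_add_right _ (by fun_prop),
      radialMass]
    refine setLIntegral_mono' measurableSet_Ioi fun ρ hρ => ?_
    have hslice := stdGaussian_rootPairs_slice_ge hP hr0 hρ hw hwθ
    have hset : Prod.mk (ρ • (θ : EuclideanSpace ℝ ι)) ⁻¹' {p | p.1 ∈ K ∧ p ∈ rootPairs P r} =
        {u | (ρ • (θ : EuclideanSpace ℝ ι), u) ∈ rootPairs P r} := by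
      ext u
      simp [(hc θ ρ hρ).2 hθ]
    rw [hset, ← mul_assoc]
    change _ ≤ radialDensity _ ρ * _ + radialDensity _ ρ * _
    rw [← mul_add]
    have e : ρ / (2 * Real.sqrt (Module.finrank ℝ (EuclideanSpace ℝ ι))) =
        2 * Real.exp 1 * ε / (Real.sqrt (2 * Real.pi) * r) * ρ := by
      have : (0 : ℝ) < Fintype.card ι := by exact_mod_cast Fintype.card_pos
      rw [finrank_euclideanSpace, hr]
      field_simp
      norm_num
    rw [e]
    exact (mul_one _).symm.le.trans (by gcongr)
  refine le_trans ?_ (mul_meas_ge_le_lintegral hFm (radialMass (EuclideanSpace ℝ ι) / 2))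
  rw [mul_comm]
  gcongr

end Shadow

theorem sin_sq_le_of_norm_le (τ : ℂ) :
    ∃ θ : ℝ, ∀ r φ : ℝ, 0 < r → r < 1 →
      ‖(Real.sin φ : ℂ) - τ * Real.cos φ‖ ≤ r * ‖(Real.cos φ : ℂ) + τ * Real.sin φ‖ →
      Real.sin (φ - θ) ^ 2 ≤ r ^ 2 * Real.cos (φ - θ) ^ 2 := by
  obtain ⟨w, hw⟩ : ∃ w : ℂ, w = ⟨(1 - (τ.re ^ 2 + τ.im ^ 2)) / 2, τ.re⟩ := ⟨_, rfl⟩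
  refine ⟨w.arg / 2, fun r φ hr hr1 h => ?_⟩
  set T : ℝ := 1 + (τ.re ^ 2 + τ.im ^ 2) with hT
  have hT0 : 0 < T := by positivity
  set s := Real.sin φ
  set c := Real.cos φ
  have hsc : s ^ 2 + c ^ 2 = 1 := Real.sin_sq_add_cos_sq φ
  have hQ : ‖(s : ℂ) - τ * c‖ ^ 2 = (s - τ.re * c) ^ 2 + (τ.im * c) ^ 2 := by
    rw [← Complex.normSq_eq_norm_sq, Complex.normSq_apply]
    simp
    ring
  have hR : ‖(c : ℂ) + τ * s‖ ^ 2 = (c + τ.re * s) ^ 2 + (τ.im * s) ^ 2 := by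
    rw [← Complex.normSq_eq_norm_sq, Complex.normSq_apply]
    simp
    ring
  have h2 : ‖(s : ℂ) - τ * c‖ ^ 2 ≤ r ^ 2 * ‖(c : ℂ) + τ * s‖ ^ 2 := by
    rw [← mul_pow]
    gcongr
  rw [hQ, hR] at h2
  set ψ := φ - w.arg / 2 with hψ
  have hL : ‖w‖ ≤ T / 2 := by
    rw [← abs_of_nonneg (norm_nonneg w), ← abs_of_pos (half_pos hT0), ← sq_le_sq,
      ← Complex.normSq_eq_norm_sq, Complex.normSq_apply, hw, hT]
    simp only
    nlinarith [sq_nonneg τ.im]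
  have hcos : ‖w‖ * Real.cos (2 * ψ) =
      (1 - (τ.re ^ 2 + τ.im ^ 2)) / 2 * (2 * c ^ 2 - 1) + τ.re * (2 * s * c) := by
    have e : 2 * ψ = 2 * φ - w.arg := by rw [hψ]; ring
    have h1 := Complex.norm_mul_cos_arg w
    have h3 := Complex.norm_mul_sin_arg w
    rw [e, Real.cos_sub, Real.cos_two_mul, Real.sin_two_mul]
    calc _ = (‖w‖ * Real.cos w.arg) * (2 * c ^ 2 - 1) + (‖w‖ * Real.sin w.arg) * (2 * s * c) := by
          ring
      _ = _ := by rw [h1, h3, hw]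
  have hQ' : (s - τ.re * c) ^ 2 + (τ.im * c) ^ 2 = T / 2 - ‖w‖ * Real.cos (2 * ψ) := by
    rw [hcos, hT]
    have : s ^ 2 = 1 - c ^ 2 := by linarith
    linear_combination this
  have hR' : (c + τ.re * s) ^ 2 + (τ.im * s) ^ 2 = T / 2 + ‖w‖ * Real.cos (2 * ψ) := by
    rw [hcos, hT]
    have : s ^ 2 = 1 - c ^ 2 := by linarith
    linear_combination (τ.re ^ 2 + τ.im ^ 2) * this
  rw [hQ', hR'] at h2
  have hr2 : r ^ 2 < 1 := by nlinarith
  have hpos : 0 ≤ Real.cos (2 * ψ) := by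
    by_contra hneg
    have : ‖w‖ * Real.cos (2 * ψ) ≤ 0 :=
      mul_nonpos_of_nonneg_of_nonpos (norm_nonneg _) (not_le.1 hneg).le
    nlinarith
  have h4 : T / 2 * (1 - Real.cos (2 * ψ)) ≤ r ^ 2 * (T / 2 * (1 + Real.cos (2 * ψ))) := by
    have : ‖w‖ * Real.cos (2 * ψ) ≤ T / 2 * Real.cos (2 * ψ) := by gcongr
    nlinarith [sq_nonneg r]
  rw [Real.cos_two_mul] at h4
  have h5 := Real.sin_sq_add_cos_sq ψ
  have h6 : T * Real.sin ψ ^ 2 ≤ T * (r ^ 2 * Real.cos ψ ^ 2) := by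
    have : Real.sin ψ ^ 2 = 1 - Real.cos ψ ^ 2 := by linarith
    rw [this]
    linarith
  exact le_of_mul_le_mul_left h6 hT0

theorem abs_le_of_sin_sq_le {r x : ℝ} (hr : 0 < r) (hx1 : -(Real.pi / 2) ≤ x)
    (hx2 : x ≤ Real.pi / 2) (h : Real.sin x ^ 2 ≤ r ^ 2 * Real.cos x ^ 2) : |x| ≤ r := by
  have h1 := Real.sin_sq_add_cos_sq x
  have hc : 0 < Real.cos x := by
    refine lt_of_le_of_ne (Real.cos_nonneg_of_mem_Icc ⟨hx1, hx2⟩) fun h0 => ?_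
    rw [← h0] at h h1
    nlinarith
  have h2 : |Real.sin x| ≤ r * Real.cos x := by
    rw [← abs_of_pos (mul_pos hr hc), ← sq_le_sq, mul_pow]
    exact h
  have hx1' : -(Real.pi / 2) < x := lt_of_le_of_ne hx1 fun h0 => by
    rw [← h0, Real.cos_neg, Real.cos_pi_div_two] at hc; exact lt_irrefl _ hc
  have hx2' : x < Real.pi / 2 := lt_of_le_of_ne hx2 fun h0 => by
    rw [h0, Real.cos_pi_div_two] at hc; exact lt_irrefl _ hc
  have h3 : |Real.tan x| ≤ r := by
    rw [Real.tan_eq_sin_div_cos, abs_div, abs_of_pos hc, div_le_iff₀ hc]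
    exact h2
  refine le_trans ?_ h3
  rcases le_total 0 x with h0 | h0
  · rw [abs_of_nonneg h0]
    exact (Real.le_tan h0 hx2').trans (le_abs_self _)
  · rw [abs_of_nonpos h0]
    refine (Real.le_tan (x := -x) (by linarith) (by linarith)).trans ?_
    rw [Real.tan_neg]
    exact neg_le_abs _

theorem volume_sin_sq_le {r : ℝ} (hr : 0 < r) (θ : ℝ) :
    volume ({φ : ℝ | Real.sin (φ - θ) ^ 2 ≤ r ^ 2 * Real.cos (φ - θ) ^ 2} ∩
      Set.Ioc (-Real.pi) (-Real.pi + 2 * Real.pi)) ≤ ENNReal.ofReal (4 * r) := by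
  have hm : MeasurableSet {φ : ℝ | Real.sin (φ - θ) ^ 2 ≤ r ^ 2 * Real.cos (φ - θ) ^ 2} :=
    measurableSet_le (by fun_prop) (by fun_prop)
  have hinv : ∀ g : AddSubgroup.zmultiples (2 * Real.pi), (fun φ => g +ᵥ φ) ⁻¹'
      {φ : ℝ | Real.sin (φ - θ) ^ 2 ≤ r ^ 2 * Real.cos (φ - θ) ^ 2} =
      {φ : ℝ | Real.sin (φ - θ) ^ 2 ≤ r ^ 2 * Real.cos (φ - θ) ^ 2} := by
    rintro ⟨g, hg⟩
    obtain ⟨k, rfl⟩ := AddSubgroup.mem_zmultiples_iff.1 hg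
    ext φ
    have e : k • (2 * Real.pi) + φ - θ = φ - θ + k * (2 * Real.pi) := by
      rw [zsmul_eq_mul]; ring
    change Real.sin (k • (2 * Real.pi) + φ - θ) ^ 2 ≤
      r ^ 2 * Real.cos (k • (2 * Real.pi) + φ - θ) ^ 2 ↔ _
    rw [e, Real.sin_add_int_mul_two_pi, Real.cos_add_int_mul_two_pi]
    rfl
  have key := IsAddFundamentalDomain.measure_set_eq
    (isAddFundamentalDomain_Ioc Real.two_pi_pos (-Real.pi) volume)
    (isAddFundamentalDomain_Ioc Real.two_pi_pos (θ - Real.pi / 2) volume) hm hinv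
  rw [key]
  refine (measure_mono (t := Set.Icc (θ - r) (θ + r) ∪
    Set.Icc (θ + Real.pi - r) (θ + Real.pi + r)) ?_).trans ?_
  · rintro φ ⟨h, h1, h2⟩
    change Real.sin (φ - θ) ^ 2 ≤ r ^ 2 * Real.cos (φ - θ) ^ 2 at h
    rcases le_total (φ - θ) (Real.pi / 2) with h3 | h3
    · have := abs_le.1 (abs_le_of_sin_sq_le hr (by linarith) h3 h)
      exact Or.inl ⟨by linarith, by linarith⟩
    · have := abs_le.1 (abs_le_of_sin_sq_le (x := φ - θ - Real.pi) hr (by linarith)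
        (by linarith) (by rwa [Real.sin_sub_pi, Real.cos_sub_pi, neg_sq, neg_sq]))
      exact Or.inr ⟨by linarith, by linarith⟩
  · refine (measure_union_le _ _).trans ?_
    rw [Real.volume_Icc, Real.volume_Icc, ← ENNReal.ofReal_add (by linarith) (by linarith)]
    exact ENNReal.ofReal_le_ofReal (by linarith)

section Rotation
variable {ι : Type*}

theorem aeval_smul_add {P : MvPolynomial ι ℝ} {δ : ℕ} (hP : P.IsHomogeneous δ) (s : ℂ)
    (y : ι → ℂ) : aeval (fun i => s * y i) P = s ^ δ * aeval y P := by
  have := eval_smul_of_isHomogeneous (hP.map (algebraMap ℝ ℂ)) s y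
  rw [eval_map, eval_map] at this
  exact this

variable [Fintype ι]

theorem stdGaussian_zeroSet {P : MvPolynomial ι ℝ} {δ : ℕ} (hP : P.IsHomogeneous δ)
    (hP0 : P ≠ 0) (hδ : 1 ≤ δ) :
    stdGaussian (EuclideanSpace ℝ ι) {u | eval u P = 0} = 0 := by
  obtain ⟨v, hv⟩ : ∃ v : EuclideanSpace ℝ ι, eval v P ≠ 0 := by
    by_contra! hcon
    exact hP0 (MvPolynomial.funext fun x => by simpa using hcon (WithLp.toLp 2 x))
  have hv0 : v ≠ 0 := by
    rintro rfl
    apply hv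
    have := eval_smul_of_isHomogeneous hP (0 : ℝ) (0 : ι → ℝ)
    rw [zero_smul, zero_pow (by omega), zero_mul] at this
    exact this
  have hn : 0 < ‖v‖ := norm_pos_iff.2 hv0
  have hu : eval (‖v‖⁻¹ • v).ofLp P ≠ 0 := by
    rw [WithLp.ofLp_smul, eval_smul_of_isHomogeneous hP]
    positivity
  have hcl : IsClosed {u : EuclideanSpace ℝ ι | eval u P = 0} :=
    isClosed_eq ((MvPolynomial.continuous_eval P).comp (PiLp.continuous_ofLp 2 _))
      continuous_const
  have := stdGaussian_le_of_slices hcl.measurableSet (u := ‖v‖⁻¹ • v) (b := 0)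
    (by rw [norm_smul, norm_inv, norm_norm, inv_mul_cancel₀ hn.ne']) fun w => ?_
  · simpa using this
  · have hne : linePoly P w (‖v‖⁻¹ • v).ofLp ≠ 0 := fun h0 => by
      apply hu
      rw [← coeff_linePoly hP w, h0, Polynomial.coeff_zero]
    refine le_of_eq (Set.Finite.measure_zero (((linePoly P w
      (‖v‖⁻¹ • v).ofLp).roots.toFinset.finite_toSet).subset fun τ hτ => ?_) _)
    change eval (w + τ • ‖v‖⁻¹ • v).ofLp P = 0 at hτ
    simp only [Finset.mem_coe, Multiset.mem_toFinset]
    rw [Polynomial.mem_roots hne, Polynomial.IsRoot, eval_linePoly, ← hτ]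
    rfl

theorem exists_root_of_rotation_mem {P : MvPolynomial ι ℝ} {δ : ℕ} (hP : P.IsHomogeneous δ)
    {r : ℝ} (hr1 : r < 1) {z u : EuclideanSpace ℝ ι} (hu : eval u P ≠ 0) {c s : ℝ}
    (hcs : c ^ 2 + s ^ 2 = 1) (h : (c • z + s • u, -s • z + c • u) ∈ rootPairs P r) :
    ∃ τ ∈ ((linePoly P z u).aroots ℂ).toFinset, ‖(s : ℂ) - τ * c‖ ≤ r * ‖(c : ℂ) + τ * s‖ := by
  obtain ⟨ζ, hζ, h⟩ := h
  rw [aeval_linePoly] at h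
  have hne : linePoly P z u ≠ 0 := fun h0 => by
    apply hu
    rw [← coeff_linePoly hP z, h0, Polynomial.coeff_zero]
  have e : (fun i => (((c • z + s • u : EuclideanSpace ℝ ι) i : ℝ) : ℂ) +
      ζ * ((-s • z + c • u : EuclideanSpace ℝ ι) i : ℝ)) =
      fun i => (c - ζ * s) * (z i : ℂ) + (s + ζ * c) * u i := by
    ext i
    simp
    ring
  have hζ2 : 1 + ζ ^ 2 ≠ 0 := fun h0 => by
    have : ζ ^ 2 = -1 := by linear_combination h0
    have h2 : ‖ζ‖ ^ 2 = 1 := by rw [← norm_pow, this]; simp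
    nlinarith [norm_nonneg ζ]
  have hcs' : (c : ℂ) ^ 2 + (s : ℂ) ^ 2 = 1 := by exact_mod_cast hcs
  have h' : aeval (fun i => ((c : ℂ) - ζ * s) * (z i : ℂ) + (s + ζ * c) * u i) P = 0 := by
    rw [← e]; exact h
  by_cases hX : (c : ℂ) - ζ * s = 0
  · exfalso
    simp only [hX, zero_mul, zero_add] at h'
    rw [aeval_smul_add hP] at h'
    rcases mul_eq_zero.1 h' with h1 | h1
    · have hY : (s : ℂ) + ζ * c = 0 := by
        by_contra hY
        exact pow_ne_zero _ hY h1
      apply hζ2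
      linear_combination (c - s * ζ) * hX + (s + c * ζ) * hY - (1 + ζ ^ 2) * hcs'
    · apply hu
      have := MvPolynomial.aeval_algebraMap_apply ℂ u.ofLp P
      have h2 : aeval (fun i => ((u i : ℝ) : ℂ)) P = ((eval u P : ℝ) : ℂ) := by
        rw [← MvPolynomial.coe_aeval_eq_eval]
        exact this
      rw [h2] at h1
      exact_mod_cast h1
  · refine ⟨(s + ζ * c) / (c - ζ * s), ?_, ?_⟩
    · rw [Multiset.mem_toFinset, Polynomial.mem_aroots]
      refine ⟨hne, ?_⟩
      rw [aeval_linePoly]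
      have e2 : (fun i => ((c : ℂ) - ζ * s) * (z i : ℂ) + (s + ζ * c) * u i) =
          fun i => ((c : ℂ) - ζ * s) * ((z i : ℂ) + (s + ζ * c) / (c - ζ * s) * u i) := by
        ext i
        field_simp
      rw [e2, aeval_smul_add hP] at h'
      exact (mul_eq_zero.1 h').resolve_left (pow_ne_zero _ hX)
    · have e3 : (s : ℂ) - (s + ζ * c) / (c - ζ * s) * c =
          -ζ * (c + (s + ζ * c) / (c - ζ * s) * s) := by
        have hτ : (s + ζ * c) / (c - ζ * s) * (c - ζ * s) = s + ζ * c := div_mul_cancel₀ _ hX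
        linear_combination -hτ
      rw [e3, norm_mul, norm_neg]
      gcongr

theorem volume_rotation_mem_rootPairs_le {P : MvPolynomial ι ℝ} {δ : ℕ}
    (hP : P.IsHomogeneous δ) {r : ℝ} (hr : 0 < r) (hr1 : r < 1) {z u : EuclideanSpace ℝ ι}
    (hu : eval u P ≠ 0) :
    volume ({φ : ℝ | (Real.cos φ • z + Real.sin φ • u, -Real.sin φ • z + Real.cos φ • u) ∈
      rootPairs P r} ∩ Set.Ioc (-Real.pi) (-Real.pi + 2 * Real.pi)) ≤
      ENNReal.ofReal (4 * δ * r) := by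
  choose θ hθ using sin_sq_le_of_norm_le
  have hsub : ({φ : ℝ | (Real.cos φ • z + Real.sin φ • u,
      -Real.sin φ • z + Real.cos φ • u) ∈ rootPairs P r} ∩
        Set.Ioc (-Real.pi) (-Real.pi + 2 * Real.pi)) ⊆
      ⋃ τ ∈ ((linePoly P z u).aroots ℂ).toFinset,
        ({φ : ℝ | Real.sin (φ - θ τ) ^ 2 ≤ r ^ 2 * Real.cos (φ - θ τ) ^ 2} ∩
          Set.Ioc (-Real.pi) (-Real.pi + 2 * Real.pi)) := by
    rintro φ ⟨h, hφ⟩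
    obtain ⟨τ, hτ, hle⟩ := exists_root_of_rotation_mem hP hr1 hu (Real.cos_sq_add_sin_sq φ) h
    exact Set.mem_biUnion (Finset.mem_coe.2 hτ) ⟨hθ τ r φ hr hr1 hle, hφ⟩
  refine (measure_mono hsub).trans ((measure_biUnion_finset_le _ _).trans ?_)
  refine (Finset.sum_le_sum fun τ _ => volume_sin_sq_le hr (θ τ)).trans ?_
  rw [Finset.sum_const, nsmul_eq_mul, ← ENNReal.ofReal_natCast,
    ← ENNReal.ofReal_mul (by positivity)]
  apply ENNReal.ofReal_le_ofReal
  have hcard : (((linePoly P z u).aroots ℂ).toFinset.card : ℝ) ≤ δ := by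
    have h1 := Multiset.toFinset_card_le ((linePoly P z u).aroots ℂ)
    have h2 := Polynomial.card_roots' ((linePoly P z u).map (algebraMap ℝ ℂ))
    have h3 := Polynomial.natDegree_map_le (f := algebraMap ℝ ℂ) (p := linePoly P z u)
    have h4 := natDegree_linePoly_le hP z.ofLp u.ofLp
    exact_mod_cast h1.trans (h2.trans (h3.trans h4))
  nlinarith

end Rotation

section Hit
variable {V : Type*} [NormedAddCommGroup V] [InnerProductSpace ℝ V]

/-- The pairs `(z, u)` whose rotations `cos φ • z + sin φ • u` meet `K`. -/
def hitPairs (K : Set V) : Set (V × V) :=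
  {p | ∃ φ : ℝ, Real.cos φ • p.1 + Real.sin φ • p.2 ∈ K}

theorem isClosed_exists_rotation_mem {X : Type*} [TopologicalSpace X] {z u : X → V}
    (hz : Continuous z) (hu : Continuous u) {K : Set (X × V)} (hK : IsClosed K) :
    IsClosed {x | ∃ φ : ℝ, (x, Real.cos φ • z x + Real.sin φ • u x) ∈ K} := by
  have hc : IsClosed {q : Set.Icc (-Real.pi) Real.pi × X |
      (q.2, Real.cos q.1 • z q.2 + Real.sin q.1 • u q.2) ∈ K} :=
    hK.preimage (by fun_prop)
  have := isClosedMap_snd_of_compactSpace _ hc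
  convert this using 1
  ext x
  constructor
  · rintro ⟨φ, hφ⟩
    obtain ⟨ψ, hψ, hc, hs⟩ : ∃ ψ ∈ Set.Icc (-Real.pi) Real.pi,
        Real.cos ψ = Real.cos φ ∧ Real.sin ψ = Real.sin φ := by
      have hmem := toIocMod_mem_Ioc Real.two_pi_pos (-Real.pi) φ
      refine ⟨_, ⟨hmem.1.le, by linarith [hmem.2]⟩, ?_⟩
      rw [toIocMod, zsmul_eq_mul, Real.cos_sub_int_mul_two_pi, Real.sin_sub_int_mul_two_pi]
      exact ⟨rfl, rfl⟩
    refine ⟨(⟨ψ, hψ⟩, x), ?_, rfl⟩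
    change (x, Real.cos ψ • z x + Real.sin ψ • u x) ∈ K
    rw [hc, hs]
    exact hφ
  · rintro ⟨⟨φ, y⟩, h, rfl⟩
    exact ⟨φ, h⟩

theorem isClosed_hitPairs {K : Set V} (hK : IsClosed K) : IsClosed (hitPairs K) := by
  have := isClosed_exists_rotation_mem (X := V × V) continuous_fst continuous_snd
    (K := Set.univ ×ˢ K) (isClosed_univ.prod hK)
  simpa [hitPairs] using this

end Hit

theorem stdGaussian_rootPairs_le {ι : Type*} [Fintype ι] {P : MvPolynomial ι ℝ} {δ : ℕ}
    (hP : P.IsHomogeneous δ) (hP0 : P ≠ 0) (hδ : 1 ≤ δ) {r : ℝ} (hr : 0 < r) (hr1 : r < 1)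
    {K : Set (EuclideanSpace ℝ ι)} (hK : MeasurableSet K) :
    ((stdGaussian (EuclideanSpace ℝ ι)).prod (stdGaussian (EuclideanSpace ℝ ι)))
      {p | p.1 ∈ K ∧ p ∈ rootPairs P r} ≤ ENNReal.ofReal (2 * δ * r / Real.pi) *
      ((stdGaussian (EuclideanSpace ℝ ι)).prod (stdGaussian (EuclideanSpace ℝ ι)))
        (hitPairs K) := by
  set Γ := (stdGaussian (EuclideanSpace ℝ ι)).prod (stdGaussian (EuclideanSpace ℝ ι)) with hΓ
  set S : Set (EuclideanSpace ℝ ι × EuclideanSpace ℝ ι) := {p | p.1 ∈ K ∧ p ∈ rootPairs P r}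
  set I : Set ℝ := Set.Ioc (-Real.pi) (-Real.pi + 2 * Real.pi) with hI
  have hS : MeasurableSet S :=
    (hK.preimage measurable_fst).inter (isClosed_rootPairs P r).measurableSet
  have hae : ∀ᵐ p ∂Γ, eval p.2 P ≠ 0 := by
    have h0 : ∀ᵐ u ∂stdGaussian (EuclideanSpace ℝ ι), eval u.ofLp P ≠ 0 := by
      rw [ae_iff]
      simpa using stdGaussian_zeroSet hP hP0 hδ
    exact (Measure.quasiMeasurePreserving_snd (μ := stdGaussian (EuclideanSpace ℝ ι))
      (ν := stdGaussian (EuclideanSpace ℝ ι))).ae h0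
  have hrot : Measurable fun q : ℝ × (EuclideanSpace ℝ ι × EuclideanSpace ℝ ι) =>
      (Real.cos q.1 • q.2.1 + Real.sin q.1 • q.2.2,
        -Real.sin q.1 • q.2.1 + Real.cos q.1 • q.2.2) := by fun_prop
  have key : Γ S * ENNReal.ofReal (2 * Real.pi) ≤ ENNReal.ofReal (4 * δ * r) * Γ (hitPairs K) := by
    calc Γ S * ENNReal.ofReal (2 * Real.pi) = ∫⁻ φ in I, Γ S := by
          rw [setLIntegral_const, hI, Real.volume_Ioc]; congr 2; ring
      _ = ∫⁻ φ in I, (∫⁻ p, S.indicator 1 (Real.cos φ • p.1 + Real.sin φ • p.2,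
            -Real.sin φ • p.1 + Real.cos φ • p.2) ∂Γ) := by
          refine lintegral_congr fun φ => ?_
          rw [← lintegral_indicator_one hS]
          conv_lhs => rw [hΓ, ← stdGaussian_prod_map_rotation _ _ (Real.cos_sq_add_sin_sq φ)]
          rw [lintegral_map (measurable_one.indicator hS) (by fun_prop)]
      _ = ∫⁻ p, (∫⁻ φ in I, S.indicator 1 (Real.cos φ • p.1 + Real.sin φ • p.2,
            -Real.sin φ • p.1 + Real.cos φ • p.2)) ∂Γ :=
          lintegral_lintegral_swap
            (((measurable_one.indicator hS).comp hrot).aemeasurable)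
      _ ≤ ∫⁻ p, (hitPairs K).indicator (fun _ => ENNReal.ofReal (4 * δ * r)) p ∂Γ := by
          refine lintegral_mono_ae (hae.mono fun p hp => ?_)
          have hSp : MeasurableSet {φ : ℝ | (Real.cos φ • p.1 + Real.sin φ • p.2,
              -Real.sin φ • p.1 + Real.cos φ • p.2) ∈ S} := hS.preimage (by fun_prop)
          have e : ∫⁻ φ in I, S.indicator 1 (Real.cos φ • p.1 + Real.sin φ • p.2,
              -Real.sin φ • p.1 + Real.cos φ • p.2) = volume ({φ : ℝ | (Real.cos φ • p.1 +
                Real.sin φ • p.2, -Real.sin φ • p.1 + Real.cos φ • p.2) ∈ S} ∩ I) := by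
            rw [← Measure.restrict_apply hSp, ← lintegral_indicator_one hSp]
            rfl
          rw [e]
          by_cases hh : p ∈ hitPairs K
          · rw [Set.indicator_of_mem hh]
            refine le_trans (measure_mono ?_)
              (volume_rotation_mem_rootPairs_le hP hr hr1 (z := p.1) hp)
            exact Set.inter_subset_inter_left _ fun φ hφ => hφ.2
          · rw [Set.indicator_of_notMem hh]
            refine le_of_eq (measure_mono_null (t := ∅) ?_ measure_empty)
            rintro φ ⟨hφ, -⟩
            exact hh ⟨φ, hφ.1⟩
      _ ≤ _ := lintegral_indicator_const_le _ _
  have hpi := Real.pi_pos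
  have e2 : ENNReal.ofReal (4 * δ * r) =
      ENNReal.ofReal (2 * δ * r / Real.pi) * ENNReal.ofReal (2 * Real.pi) := by
    rw [← ENNReal.ofReal_mul (by positivity)]
    congr 1
    field_simp
    ring
  rw [e2, mul_right_comm] at key
  exact (ENNReal.mul_le_mul_iff_left (by simpa using hpi) ENNReal.ofReal_ne_top).1 key

section Tail
variable {V : Type*} [NormedAddCommGroup V] [InnerProductSpace ℝ V] [FiniteDimensional ℝ V]
  [MeasurableSpace V] [BorelSpace V]

theorem lintegral_Ioi_mul_exp (R : ℝ) (hR : 0 ≤ R) :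
    ∫⁻ ρ in Set.Ioi R, ENNReal.ofReal (ρ * Real.exp (-(1 / 2) * ρ ^ 2)) =
      ENNReal.ofReal (Real.exp (-(1 / 2) * R ^ 2)) := by
  have hd : ∀ x ∈ Set.Ici R, HasDerivAt (fun x : ℝ => -Real.exp (-(1 / 2) * x ^ 2))
      (x * Real.exp (-(1 / 2) * x ^ 2)) x := by
    intro x _
    have := (((hasDerivAt_pow 2 x).const_mul (-(1 / 2) : ℝ)).exp).neg
    refine this.congr_deriv ?_
    simp only [Nat.cast_ofNat]
    ring
  have hnn : ∀ x ∈ Set.Ioi R, 0 ≤ x * Real.exp (-(1 / 2) * x ^ 2) := fun x hx =>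
    mul_nonneg (hR.trans (le_of_lt hx)) (Real.exp_pos _).le
  have ht : Filter.Tendsto (fun x : ℝ => -Real.exp (-(1 / 2) * x ^ 2)) Filter.atTop (nhds 0) := by
    rw [← neg_zero]
    refine (Real.tendsto_exp_atBot.comp ?_).neg
    exact (Filter.tendsto_pow_atTop two_ne_zero).const_mul_atTop_of_neg (by norm_num)
  rw [← ofReal_integral_eq_lintegral_ofReal (integrableOn_Ioi_deriv_of_nonneg' hd hnn ht),
    integral_Ioi_of_hasDerivAt_of_nonneg' hd hnn ht]
  · simp
  · exact (ae_restrict_iff' measurableSet_Ioi).2 (Filter.Eventually.of_forall hnn)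

theorem stdGaussian_norm_ge [Nontrivial V] {R : ℝ} (hR : 0 ≤ R) :
    stdGaussian V {y | R ≤ ‖y‖} =
      (volume : Measure V).toSphere Set.univ * ∫⁻ ρ in Set.Ioi R, radialDensity V ρ := by
  have hm : MeasurableSet {y : V | R ≤ ‖y‖} := measurableSet_le (by fun_prop) (by fun_prop)
  rw [← lintegral_indicator_one hm, lintegral_stdGaussian_polar _ (measurable_one.indicator hm)]
  have hin : ∀ θ : sphere (0 : V) 1, ∫⁻ ρ in Set.Ioi (0 : ℝ),
      ENNReal.ofReal (ρ ^ (Module.finrank ℝ V - 1)) * (ENNReal.ofReal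
        (gaussConst V * Real.exp (-(1 / 2) * ρ ^ 2)) *
          {y : V | R ≤ ‖y‖}.indicator 1 (ρ • (θ : V))) = ∫⁻ ρ in Set.Ioi R, radialDensity V ρ := by
    intro θ
    rw [setLIntegral_congr (Ioi_ae_eq_Ici (a := R)), ← lintegral_indicator measurableSet_Ioi,
      ← lintegral_indicator measurableSet_Ici]
    refine lintegral_congr_ae ?_
    have : ∀ᵐ ρ : ℝ, ρ ≠ 0 := by simp [ae_iff]
    refine this.mono fun ρ hρ => ?_
    by_cases h : R ≤ ρ
    · have hp : 0 < ρ := lt_of_le_of_ne (hR.trans h) hρ.symm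
      have hn : ρ • (θ : V) ∈ {y : V | R ≤ ‖y‖} := by
        simp [norm_smul, abs_of_pos hp, h]
      simp only [Set.indicator_of_mem (show ρ ∈ Set.Ioi 0 from hp),
        Set.indicator_of_mem (show ρ ∈ Set.Ici R from h), Set.indicator_of_mem hn]
      simp [radialDensity]
    · rw [Set.indicator_of_notMem (show ρ ∉ Set.Ici R from h)]
      by_cases hp : 0 < ρ
      · have hn : ρ • (θ : V) ∉ {y : V | R ≤ ‖y‖} := by
          simpa [norm_smul, abs_of_pos hp] using h
        simp [Set.indicator_of_notMem hn]
      · rw [Set.indicator_of_notMem (show ρ ∉ Set.Ioi 0 from hp)]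
  rw [lintegral_congr hin, lintegral_const, mul_comm]

theorem stdGaussian_norm_ge_of_finrank_eq_two (h2 : Module.finrank ℝ V = 2) {R : ℝ} (hR : 0 ≤ R) :
    stdGaussian V {y | R ≤ ‖y‖} = ENNReal.ofReal (Real.exp (-(1 / 2) * R ^ 2)) := by
  have : Nontrivial V := Module.nontrivial_of_finrank_pos (R := ℝ) (by omega)
  have hint : ∀ R : ℝ, 0 ≤ R → ∫⁻ ρ in Set.Ioi R, radialDensity V ρ =
      ENNReal.ofReal (gaussConst V) * ENNReal.ofReal (Real.exp (-(1 / 2) * R ^ 2)) := by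
    intro R hR
    rw [← lintegral_Ioi_mul_exp R hR, ← lintegral_const_mul _ (by fun_prop)]
    refine setLIntegral_congr_fun measurableSet_Ioi fun ρ hρ => ?_
    have hρ0 : 0 ≤ ρ := hR.trans (le_of_lt hρ)
    have := (gaussConst_pos V).le
    rw [radialDensity, h2, ← ENNReal.ofReal_mul (by positivity), ← ENNReal.ofReal_mul this]
    congr 1
    simp
    ring
  have h0 := radialMass_spec (V := V)
  rw [radialMass, hint 0 le_rfl] at h0
  rw [stdGaussian_norm_ge hR, hint R hR]
  calc _ = ((volume : Measure V).toSphere Set.univ * (ENNReal.ofReal (gaussConst V) *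
        ENNReal.ofReal (Real.exp (-(1 / 2) * 0 ^ 2)))) *
          ENNReal.ofReal (Real.exp (-(1 / 2) * R ^ 2)) := by
        simp; ring
    _ = _ := by rw [h0, one_mul]

end Tail

section CapCone

variable {V : Type*} [NormedAddCommGroup V] [InnerProductSpace ℝ V]

/-- The double cone of the vectors at sine-distance at most `σ` from the line of `F`. -/
def capCone (σ : ℝ) (F : V) : Set V :=
  {z | (1 - σ ^ 2) * ‖z‖ ^ 2 * ‖F‖ ^ 2 ≤ inner ℝ z F ^ 2}

theorem isClosed_capCone (σ : ℝ) (F : V) : IsClosed (capCone σ F) :=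
  isClosed_le (by fun_prop) (by fun_prop)

theorem smul_mem_capCone {σ c : ℝ} (hc : c ≠ 0) {F z : V} :
    c • z ∈ capCone σ F ↔ z ∈ capCone σ F := by
  have hc2 : 0 < c ^ 2 := by positivity
  simp only [capCone, Set.mem_ofPred_eq, inner_smul_left, norm_smul, mul_pow, Real.norm_eq_abs,
    sq_abs, RCLike.conj_to_real]
  rw [← mul_le_mul_iff_right₀ hc2 (b := (1 - σ ^ 2) * ‖z‖ ^ 2 * ‖F‖ ^ 2)]
  constructor <;> intro h <;> linarith

theorem capCone_smul {σ c : ℝ} (hc : c ≠ 0) (F : V) : capCone σ (c • F) = capCone σ F := by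
  ext z
  have hc2 : 0 < c ^ 2 := by positivity
  simp only [capCone, Set.mem_ofPred_eq, inner_smul_right, norm_smul, mul_pow, Real.norm_eq_abs,
    sq_abs]
  rw [← mul_le_mul_iff_right₀ hc2 (b := (1 - σ ^ 2) * ‖z‖ ^ 2 * ‖F‖ ^ 2)]
  constructor <;> intro h <;> linarith

theorem map_mem_capCone (T : V ≃ₗᵢ[ℝ] V) {σ : ℝ} {F z : V} :
    T z ∈ capCone σ (T F) ↔ z ∈ capCone σ F := by
  simp [capCone]

theorem linearIndependent_of_notMem_hitPairs {p : V × V} (hp : p ∉ hitPairs ({0} : Set V)) :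
    LinearIndependent ℝ ![p.1, p.2] := by
  rw [LinearIndependent.pair_iff]
  intro s t hst
  by_contra hne
  have hρ : (s : ℂ) + t * Complex.I ≠ 0 := by
    intro h
    apply hne
    have h1 := congrArg Complex.re h
    have h2 := congrArg Complex.im h
    simpa using And.intro h1 h2
  set w : ℂ := (s : ℂ) + t * Complex.I with hw
  have hn : ‖w‖ ≠ 0 := norm_ne_zero_iff.2 hρ
  refine hp ⟨w.arg, ?_⟩
  change Real.cos w.arg • p.1 + Real.sin w.arg • p.2 = 0
  rw [Complex.cos_arg hρ, Complex.sin_arg]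
  have h1 : w.re = s := by simp [hw]
  have h2 : w.im = t := by simp [hw]
  rw [h1, h2, div_eq_inv_mul, div_eq_inv_mul, mul_smul, mul_smul, ← smul_add, hst, smul_zero]

variable [FiniteDimensional ℝ V] [MeasurableSpace V] [BorelSpace V]

theorem stdGaussian_hitPairs_capCone_eq {σ : ℝ} {F G : V} (hF : F ≠ 0) (hG : G ≠ 0) :
    ((stdGaussian V).prod (stdGaussian V)) (hitPairs (capCone σ F)) =
      ((stdGaussian V).prod (stdGaussian V)) (hitPairs (capCone σ G)) := by
  have hF' : ‖F‖ ≠ 0 := norm_ne_zero_iff.2 hF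
  have hG' : ‖G‖ ≠ 0 := norm_ne_zero_iff.2 hG
  have hn : ‖F‖ = ‖(‖F‖ / ‖G‖) • G‖ := by
    rw [norm_smul, norm_div, norm_norm, norm_norm, div_mul_cancel₀ _ hG']
  set T : V ≃ₗᵢ[ℝ] V := Submodule.reflection (ℝ ∙ (F - (‖F‖ / ‖G‖) • G))ᗮ with hT
  have hTF : T F = (‖F‖ / ‖G‖) • G := Submodule.reflection_sub hn
  rw [← capCone_smul (div_ne_zero hF' hG') G, ← hTF]
  have hTm : Measurable T := T.continuous.measurable
  have hm : ((stdGaussian V).prod (stdGaussian V)).map (Prod.map T T) =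
      (stdGaussian V).prod (stdGaussian V) := by
    rw [← Measure.map_prod_map _ _ hTm hTm, stdGaussian_map]
  conv_rhs => rw [← hm]
  rw [Measure.map_apply (hTm.prodMap hTm) (isClosed_hitPairs (isClosed_capCone _ _)).measurableSet]
  congr 1
  ext p
  simp only [hitPairs, Set.mem_preimage, Set.mem_ofPred_eq, Prod.map, ← map_smul, ← map_add,
    map_mem_capCone]

theorem ae_notMem_hitPairs_zero (hV : 2 ≤ Module.finrank ℝ V) :
    ∀ᵐ p ∂(stdGaussian V).prod (stdGaussian V), p ∉ hitPairs ({0} : Set V) := by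
  have hnull : ∀ z : V, stdGaussian V (ℝ ∙ z : Submodule ℝ V) = 0 := by
    intro z
    refine stdGaussian_absolutelyContinuous (Measure.addHaar_submodule volume _ fun h => ?_)
    have := finrank_span_le_card (R := ℝ) ({z} : Set V)
    rw [h, finrank_top] at this
    simp at this
    omega
  have hm : MeasurableSet (hitPairs ({0} : Set V)) :=
      (isClosed_hitPairs isClosed_singleton).measurableSet
  rw [ae_iff]
  simp only [not_not]
  change ((stdGaussian V).prod (stdGaussian V)) (hitPairs {0}) = 0
  rw [Measure.measure_prod_null hm]
  have h0 : ∀ᵐ z ∂stdGaussian V, z ≠ 0 := by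
    rw [ae_iff]
    simpa using hnull 0
  refine h0.mono fun z hz => measure_mono_null ?_ (hnull z)
  rintro u ⟨φ, hφ⟩
  have hφ : Real.cos φ • z + Real.sin φ • u = 0 := hφ
  have hs : Real.sin φ ≠ 0 := by
    intro hs
    have hc : Real.cos φ ≠ 0 := by
      intro hc
      have := Real.sin_sq_add_cos_sq φ
      rw [hs, hc] at this
      norm_num at this
    rw [hs, zero_smul, add_zero] at hφ
    exact (smul_ne_zero hc hz) hφ
  refine Submodule.mem_span_singleton.2 ⟨-(Real.sin φ)⁻¹ * Real.cos φ, ?_⟩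
  have : (Real.sin φ)⁻¹ • (Real.cos φ • z + Real.sin φ • u) = 0 := by rw [hφ, smul_zero]
  rw [smul_add, smul_smul, smul_smul, inv_mul_cancel₀ hs, one_smul] at this
  rw [neg_mul, neg_smul, ← eq_neg_of_add_eq_zero_right this]

theorem stdGaussian_capCone_hit_le {σ : ℝ} (h0 : 0 < σ) (h1 : σ ≤ 1) {p : V × V}
    (hp : p ∉ hitPairs ({0} : Set V)) :
    stdGaussian V {F | p ∈ hitPairs (capCone σ F)} ≤
      ENNReal.ofReal (σ ^ (Module.finrank ℝ V - 2)) := by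
  set K : Submodule ℝ V := Submodule.span ℝ (Set.range ![p.1, p.2]) with hK
  have hz : p.1 ∈ K := Submodule.subset_span ⟨0, rfl⟩
  have hu : p.2 ∈ K := Submodule.subset_span ⟨1, rfl⟩
  have hK2 : Module.finrank ℝ K = 2 := by
    simpa using finrank_span_eq_card (linearIndependent_of_notMem_hitPairs hp)
  have hKp : Module.finrank ℝ Kᗮ = Module.finrank ℝ V - 2 := by
    have := K.finrank_add_finrank_orthogonal
    omega
  set k : ℝ := Real.sqrt (1 - σ ^ 2) / σ with hk
  have hk0 : 0 ≤ k := by positivity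
  have hσ : 0 ≤ 1 - σ ^ 2 := by nlinarith
  have hk2 : k ^ 2 = (1 - σ ^ 2) / σ ^ 2 := by rw [hk, div_pow, Real.sq_sqrt hσ]
  have hm : MeasurableSet {F : V | p ∈ hitPairs (capCone σ F)} := by
    have := isClosed_exists_rotation_mem (X := V) (z := fun _ => p.1) (u := fun _ => p.2)
      continuous_const continuous_const
      (K := {q : V × V | (1 - σ ^ 2) * ‖q.2‖ ^ 2 * ‖q.1‖ ^ 2 ≤ inner ℝ q.2 q.1 ^ 2})
      (isClosed_le (by fun_prop) (by fun_prop))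
    exact this.measurableSet
  have hm2 : MeasurableSet {q : K × Kᗮ | k * ‖q.2‖ ≤ ‖q.1‖} :=
    measurableSet_le (by fun_prop) (by fun_prop)
  have hsub : ∀ q : K × Kᗮ, p ∈ hitPairs (capCone σ ((q.1 : V) + q.2)) → k * ‖q.2‖ ≤ ‖q.1‖ := by
    rintro ⟨a, b⟩ ⟨φ, hφ⟩
    set y : V := Real.cos φ • p.1 + Real.sin φ • p.2 with hy
    have hyK : y ∈ K := K.add_mem (K.smul_mem _ hz) (K.smul_mem _ hu)
    have hy0 : y ≠ 0 := fun h => hp ⟨φ, h⟩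
    have hφ : (1 - σ ^ 2) * ‖y‖ ^ 2 * ‖(a : V) + b‖ ^ 2 ≤ inner ℝ y ((a : V) + b) ^ 2 := hφ
    have hyb : inner ℝ y (b : V) = 0 := Submodule.inner_right_of_mem_orthogonal hyK b.2
    have hab : inner ℝ (a : V) (b : V) = 0 := Submodule.inner_right_of_mem_orthogonal a.2 b.2
    rw [inner_add_right, hyb, add_zero, norm_add_sq_real (a : V), hab] at hφ
    have hcs : inner ℝ y (a : V) ^ 2 ≤ ‖y‖ ^ 2 * ‖(a : V)‖ ^ 2 := by
      rw [← mul_pow, ← sq_abs]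
      exact pow_le_pow_left₀ (abs_nonneg _) (abs_real_inner_le_norm _ _) 2
    have hypos : 0 < ‖y‖ ^ 2 := by positivity
    have h3 : ‖y‖ ^ 2 * ((1 - σ ^ 2) * ‖(b : V)‖ ^ 2) ≤ ‖y‖ ^ 2 * (σ ^ 2 * ‖(a : V)‖ ^ 2) := by
      nlinarith
    have h4 := le_of_mul_le_mul_left h3 hypos
    change k * ‖(b : V)‖ ≤ ‖(a : V)‖
    refine abs_le_of_sq_le_sq' ?_ (norm_nonneg _) |>.2
    rw [mul_pow, hk2, div_mul_eq_mul_div, div_le_iff₀ (by positivity)]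
    linarith
  rw [← stdGaussian_map_add K, Measure.map_apply (by fun_prop) hm]
  refine (measure_mono hsub).trans ?_
  change ((stdGaussian K).prod (stdGaussian Kᗮ)) {q : K × Kᗮ | k * ‖q.2‖ ≤ ‖q.1‖} ≤ _
  rw [Measure.prod_apply_symm hm2]
  have hin : ∀ b : Kᗮ, stdGaussian K ((fun a => (a, b)) ⁻¹' {q : K × Kᗮ | k * ‖q.2‖ ≤ ‖q.1‖}) =
      ENNReal.ofReal (Real.exp (-(k ^ 2 / 2) * ‖b‖ ^ 2)) := by
    intro b
    have := stdGaussian_norm_ge_of_finrank_eq_two hK2 (R := k * ‖b‖) (by positivity)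
    rw [show -(k ^ 2 / 2) * ‖b‖ ^ 2 = -(1 / 2) * (k * ‖b‖) ^ 2 by ring, ← this]
    rfl
  rw [lintegral_congr hin, lintegral_stdGaussian_exp, hKp]
  refine le_of_eq ?_
  congr 1
  have h5 : 1 + k ^ 2 = σ ^ (-2 : ℝ) := by
    rw [hk2, Real.rpow_neg h0.le, Real.rpow_two]
    field_simp
    ring
  rw [h5, ← Real.rpow_mul h0.le, ← Real.rpow_natCast]
  congr 1
  ring

theorem stdGaussian_hitPairs_capCone_le (hV : 2 ≤ Module.finrank ℝ V) {σ : ℝ} (h0 : 0 < σ)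
    (h1 : σ ≤ 1) {f : V} (hf : f ≠ 0) :
    ((stdGaussian V).prod (stdGaussian V)) (hitPairs (capCone σ f)) ≤
      ENNReal.ofReal (σ ^ (Module.finrank ℝ V - 2)) := by
  set Γ := (stdGaussian V).prod (stdGaussian V) with hΓ
  have hc : MeasurableSet {q : V × (V × V) | q.2 ∈ hitPairs (capCone σ q.1)} := by
    have := isClosed_exists_rotation_mem (X := V × (V × V)) (z := fun x => x.2.1)
      (u := fun x => x.2.2) (by fun_prop) (by fun_prop)
      (K := {q : (V × (V × V)) × V |
        (1 - σ ^ 2) * ‖q.2‖ ^ 2 * ‖q.1.1‖ ^ 2 ≤ inner ℝ q.2 q.1.1 ^ 2})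
      (isClosed_le (by fun_prop) (by fun_prop))
    exact this.measurableSet
  have hae : ∀ᵐ F ∂stdGaussian V, F ≠ 0 := by
    rw [ae_iff]
    refine stdGaussian_absolutelyContinuous ?_
    have : Nontrivial V := Module.nontrivial_of_finrank_pos (R := ℝ) (by omega)
    simp
  calc Γ (hitPairs (capCone σ f)) = ∫⁻ _F, Γ (hitPairs (capCone σ f)) ∂stdGaussian V := by simp
    _ = ∫⁻ F, Γ (hitPairs (capCone σ F)) ∂stdGaussian V :=
        lintegral_congr_ae (hae.mono fun F hF => stdGaussian_hitPairs_capCone_eq hf hF)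
    _ = ((stdGaussian V).prod Γ) {q | q.2 ∈ hitPairs (capCone σ q.1)} :=
        (Measure.prod_apply hc).symm
    _ = ∫⁻ p, stdGaussian V {F | p ∈ hitPairs (capCone σ F)} ∂Γ := Measure.prod_apply_symm hc
    _ ≤ ∫⁻ _p, ENNReal.ofReal (σ ^ (Module.finrank ℝ V - 2)) ∂Γ :=
        lintegral_mono_ae ((ae_notMem_hitPairs_zero hV).mono fun p hp =>
          stdGaussian_capCone_hit_le h0 h1 hp)
    _ = _ := by simp [hΓ]

end CapCone

section CapMass

theorem lintegral_exp_sq_add_linear_ge {a : ℝ} (ha : 0 < a) :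
    ENNReal.ofReal (1 / a - 1 / a ^ 3) ≤
      ∫⁻ s in Set.Ioi (0 : ℝ), ENNReal.ofReal (Real.exp (-(1 / 2) * s ^ 2 - a * s)) := by
  have e1 := Real.integral_rpow_mul_exp_neg_mul_Ioi (a := 1) one_pos ha
  have e3 := Real.integral_rpow_mul_exp_neg_mul_Ioi (a := 3) (by norm_num) ha
  have hG3 : Real.Gamma 3 = 2 := by
    rw [show (3 : ℝ) = ((2 : ℕ) : ℝ) + 1 by norm_num, Real.Gamma_nat_eq_factorial]
    simp
  norm_num [hG3] at e1 e3
  have i1 : IntegrableOn (fun t : ℝ => Real.exp (-(a * t))) (Set.Ioi 0) :=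
    Integrable.of_integral_ne_zero (by rw [e1]; positivity)
  have i3 : IntegrableOn (fun t : ℝ => t ^ 2 * Real.exp (-(a * t))) (Set.Ioi 0) :=
    Integrable.of_integral_ne_zero (by rw [e3]; positivity)
  have hb : ∀ s : ℝ, Real.exp (-(1 / 2) * s ^ 2 - a * s) ≤ Real.exp (-(a * s)) := fun s =>
    Real.exp_le_exp.2 (by nlinarith [sq_nonneg s])
  have i0 : IntegrableOn (fun s : ℝ => Real.exp (-(1 / 2) * s ^ 2 - a * s)) (Set.Ioi 0) := by
    refine Integrable.mono' i1 (by fun_prop) (Filter.Eventually.of_forall fun s => ?_)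
    rw [Real.norm_of_nonneg (Real.exp_pos _).le]
    exact hb s
  rw [← ofReal_integral_eq_lintegral_ofReal i0
    (Filter.Eventually.of_forall fun s => (Real.exp_pos _).le)]
  refine ENNReal.ofReal_le_ofReal ?_
  calc 1 / a - 1 / a ^ 3 = ∫ t in Set.Ioi (0 : ℝ),
        (Real.exp (-(a * t)) - 1 / 2 * (t ^ 2 * Real.exp (-(a * t)))) := by
        rw [integral_sub i1 (i3.const_mul _), integral_const_mul, e1, e3]
        field_simp
    _ ≤ _ := by
        refine setIntegral_mono (i1.sub (i3.const_mul _)) i0 fun s => ?_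
        change Real.exp (-(a * s)) - 1 / 2 * (s ^ 2 * Real.exp (-(a * s))) ≤ _
        rw [sub_eq_add_neg (-(1 / 2) * s ^ 2), Real.exp_add]
        nlinarith [Real.exp_pos (-(a * s)), Real.add_one_le_exp (-(1 / 2) * s ^ 2)]

theorem lintegral_Ioi_exp_sq_ge {a R : ℝ} (ha : 0 < a) :
    ∫⁻ s in Set.Ioi (0 : ℝ), ENNReal.ofReal (Real.exp (-(1 / 2) * s ^ 2 - a / 2 * s)) *
        ENNReal.ofReal (Real.exp (-(1 / 2) * (1 + s / a) * R ^ 2)) ≤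
      ∫⁻ y in Set.Ioi R, ENNReal.ofReal (Real.exp (-(1 / 2) * y ^ 2)) := by
  have e : ∫⁻ y in Set.Ioi R, ENNReal.ofReal (Real.exp (-(1 / 2) * y ^ 2)) =
      ∫⁻ s in Set.Ioi (0 : ℝ), ENNReal.ofReal (Real.exp (-(1 / 2) * (s + R) ^ 2)) := by
    rw [← lintegral_indicator measurableSet_Ioi, ← lintegral_indicator measurableSet_Ioi,
      ← lintegral_add_right_eq_self _ R]
    refine lintegral_congr fun s => ?_
    by_cases h : 0 < s
    · rw [Set.indicator_of_mem (show s ∈ Set.Ioi 0 from h),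
        Set.indicator_of_mem (show s + R ∈ Set.Ioi R by simpa using h)]
    · rw [Set.indicator_of_notMem (show s ∉ Set.Ioi 0 from h),
        Set.indicator_of_notMem (show s + R ∉ Set.Ioi R by simpa using h)]
  rw [e]
  refine setLIntegral_mono (by fun_prop) fun s hs => ?_
  rw [← ENNReal.ofReal_mul (Real.exp_pos _).le, ← Real.exp_add]
  refine ENNReal.ofReal_le_ofReal (Real.exp_le_exp.2 ?_)
  have hs : 0 < s := hs
  have h : R * s ≤ R ^ 2 * s / (2 * a) + a / 2 * s := by
    rw [div_add' _ _ _ (by positivity), le_div_iff₀ (by positivity)]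
    nlinarith [mul_nonneg hs.le (sq_nonneg (R - a))]
  have h2 : (1 / 2) * (1 + s / a) * R ^ 2 = (1 / 2) * R ^ 2 + R ^ 2 * s / (2 * a) := by
    field_simp
  nlinarith

variable {V : Type*} [NormedAddCommGroup V] [InnerProductSpace ℝ V] [FiniteDimensional ℝ V]
  [MeasurableSpace V] [BorelSpace V]

theorem stdGaussian_norm_ge_of_finrank_eq_one (h1 : Module.finrank ℝ V = 1) {R : ℝ} (hR : 0 ≤ R) :
    stdGaussian V {y | R ≤ ‖y‖} = ENNReal.ofReal (Real.sqrt (2 / Real.pi)) *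
      ∫⁻ y in Set.Ioi R, ENNReal.ofReal (Real.exp (-(1 / 2) * y ^ 2)) := by
  have : Nontrivial V := Module.nontrivial_of_finrank_pos (R := ℝ) (by omega)
  have hint : ∀ R : ℝ, ∫⁻ ρ in Set.Ioi R, radialDensity V ρ = ENNReal.ofReal (gaussConst V) *
      ∫⁻ y in Set.Ioi R, ENNReal.ofReal (Real.exp (-(1 / 2) * y ^ 2)) := by
    intro R
    rw [← lintegral_const_mul _ (by fun_prop)]
    refine lintegral_congr fun ρ => ?_
    rw [radialDensity, h1, ← ENNReal.ofReal_mul (gaussConst_pos V).le]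
    simp
  have h0 := radialMass_spec (V := V)
  rw [radialMass, hint 0] at h0
  have hg : ∫⁻ y in Set.Ioi (0 : ℝ), ENNReal.ofReal (Real.exp (-(1 / 2) * y ^ 2)) =
      ENNReal.ofReal (Real.sqrt (Real.pi / (1 / 2)) / 2) := by
    rw [← integral_gaussian_Ioi, ofReal_integral_eq_lintegral_ofReal]
    · exact (integrable_exp_neg_mul_sq (by norm_num)).integrableOn
    · exact Filter.Eventually.of_forall fun s => (Real.exp_pos _).le
  have hp : Real.sqrt (2 / Real.pi) * (Real.sqrt (Real.pi / (1 / 2)) / 2) = 1 := by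
    have := Real.pi_pos
    rw [← mul_div_assoc, ← Real.sqrt_mul (by positivity),
      show 2 / Real.pi * (Real.pi / (1 / 2)) = 2 ^ 2 by field_simp,
      Real.sqrt_sq (by norm_num)]
    norm_num
  have hc : (volume : Measure V).toSphere Set.univ * ENNReal.ofReal (gaussConst V) =
      ENNReal.ofReal (Real.sqrt (2 / Real.pi)) := by
    rw [hg, ← mul_assoc] at h0
    calc _ = (volume : Measure V).toSphere Set.univ * ENNReal.ofReal (gaussConst V) *
        ENNReal.ofReal (Real.sqrt (2 / Real.pi) * (Real.sqrt (Real.pi / (1 / 2)) / 2)) := by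
          rw [hp]; simp
      _ = (volume : Measure V).toSphere Set.univ * ENNReal.ofReal (gaussConst V) *
        ENNReal.ofReal (Real.sqrt (Real.pi / (1 / 2)) / 2) *
          ENNReal.ofReal (Real.sqrt (2 / Real.pi)) := by
          rw [ENNReal.ofReal_mul (Real.sqrt_nonneg _)]; ring
      _ = _ := by rw [h0, one_mul]
  rw [stdGaussian_norm_ge hR, hint R, ← mul_assoc, hc]

theorem stdGaussian_capCone_ge {N : ℕ} (hV : Module.finrank ℝ V = N + 1) (hN : 1 ≤ N) {σ : ℝ}
    (h0 : 0 < σ) (h1 : σ ≤ 1) {f : V} (hf : f ≠ 0) :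
    ENNReal.ofReal (Real.sqrt (2 / Real.pi) * (σ ^ N *
      (1 / Real.sqrt N - 1 / Real.sqrt N ^ 3))) ≤ stdGaussian V (capCone σ f) := by
  set K : Submodule ℝ V := ℝ ∙ f with hK
  have hK1 : Module.finrank ℝ K = 1 := finrank_span_singleton hf
  have hKp : Module.finrank ℝ Kᗮ = N := by
    have := K.finrank_add_finrank_orthogonal
    omega
  set k : ℝ := Real.sqrt (1 - σ ^ 2) / σ with hk
  have hk0 : 0 ≤ k := by positivity
  have hσ : 0 ≤ 1 - σ ^ 2 := by nlinarith
  have hk2 : k ^ 2 = (1 - σ ^ 2) / σ ^ 2 := by rw [hk, div_pow, Real.sq_sqrt hσ]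
  have hm2 : MeasurableSet {q : K × Kᗮ | k * ‖q.2‖ ≤ ‖q.1‖} :=
    measurableSet_le (by fun_prop) (by fun_prop)
  have hsub : ∀ q : K × Kᗮ, k * ‖q.2‖ ≤ ‖q.1‖ → (q.1 : V) + q.2 ∈ capCone σ f := by
    rintro ⟨⟨a, ha⟩, b⟩ h
    obtain ⟨c, rfl⟩ := Submodule.mem_span_singleton.1 ha
    have h : k * ‖(b : V)‖ ≤ ‖c • f‖ := h
    have hbf : inner ℝ (b : V) f = 0 :=
      Submodule.inner_left_of_mem_orthogonal (Submodule.mem_span_singleton_self f) b.2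
    change (1 - σ ^ 2) * ‖c • f + (b : V)‖ ^ 2 * ‖f‖ ^ 2 ≤ inner ℝ (c • f + (b : V)) f ^ 2
    rw [inner_add_left, hbf, add_zero, norm_add_sq_real, inner_smul_left, inner_smul_left,
      real_inner_comm, hbf, real_inner_self_eq_norm_sq]
    have h2 : (k * ‖(b : V)‖) ^ 2 ≤ ‖c • f‖ ^ 2 := pow_le_pow_left₀ (by positivity) h 2
    rw [mul_pow, hk2, div_mul_eq_mul_div, div_le_iff₀ (by positivity)] at h2
    rw [norm_smul, mul_pow, Real.norm_eq_abs, sq_abs] at *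
    simp only [RCLike.conj_to_real]
    nlinarith [mul_le_mul_of_nonneg_right h2 (sq_nonneg ‖f‖)]
  have hN0 : (0 : ℝ) < N := by exact_mod_cast hN
  set a : ℝ := Real.sqrt N with ha
  have ha0 : 0 < a := Real.sqrt_pos.2 hN0
  have ha2 : a * a = N := Real.mul_self_sqrt hN0.le
  have hmc : MeasurableSet (capCone σ f) := (isClosed_capCone σ f).measurableSet
  have hmeas : Measurable fun q : Kᗮ × ℝ =>
      ENNReal.ofReal (Real.exp (-(1 / 2) * q.2 ^ 2 - a / 2 * q.2)) *
        ENNReal.ofReal (Real.exp (-(1 / 2) * (1 + q.2 / a) * (k * ‖q.1‖) ^ 2)) := by fun_prop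
  rw [← stdGaussian_map_add K, Measure.map_apply (by fun_prop) hmc]
  refine le_trans ?_ (measure_mono hsub)
  change _ ≤ ((stdGaussian K).prod (stdGaussian Kᗮ)) {q : K × Kᗮ | k * ‖q.2‖ ≤ ‖q.1‖}
  rw [Measure.prod_apply_symm hm2]
  have hin : ∀ b : Kᗮ, stdGaussian K ((fun a => (a, b)) ⁻¹' {q : K × Kᗮ | k * ‖q.2‖ ≤ ‖q.1‖}) =
      ENNReal.ofReal (Real.sqrt (2 / Real.pi)) *
        ∫⁻ y in Set.Ioi (k * ‖b‖), ENNReal.ofReal (Real.exp (-(1 / 2) * y ^ 2)) := fun b =>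
    stdGaussian_norm_ge_of_finrank_eq_one hK1 (R := k * ‖b‖) (by positivity)
  rw [lintegral_congr hin, lintegral_const_mul' _ _ ENNReal.ofReal_ne_top,
    ENNReal.ofReal_mul (Real.sqrt_nonneg _)]
  refine mul_le_mul_right ?_ _
  calc ENNReal.ofReal (σ ^ N * (1 / a - 1 / a ^ 3))
      ≤ ENNReal.ofReal (σ ^ N) * ∫⁻ s in Set.Ioi (0 : ℝ),
          ENNReal.ofReal (Real.exp (-(1 / 2) * s ^ 2 - a * s)) := by
        rw [ENNReal.ofReal_mul (by positivity)]
        exact mul_le_mul_right (lintegral_exp_sq_add_linear_ge ha0) _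
    _ = ∫⁻ s in Set.Ioi (0 : ℝ), ENNReal.ofReal (σ ^ N) *
          ENNReal.ofReal (Real.exp (-(1 / 2) * s ^ 2 - a * s)) :=
        (lintegral_const_mul _ (by fun_prop)).symm
    _ ≤ ∫⁻ s in Set.Ioi (0 : ℝ), ENNReal.ofReal (Real.exp (-(1 / 2) * s ^ 2 - a / 2 * s)) *
          ENNReal.ofReal ((1 + (k * Real.sqrt (1 + s / a)) ^ 2) ^
            (-(Module.finrank ℝ Kᗮ / 2 : ℝ))) := by
        refine setLIntegral_mono (by fun_prop) fun s hs => ?_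
        have hs : 0 < s := hs
        have hsa : 0 ≤ s / a := by positivity
        rw [← ENNReal.ofReal_mul (by positivity), ← ENNReal.ofReal_mul (by positivity), hKp,
          mul_pow, Real.sq_sqrt (by positivity)]
        refine ENNReal.ofReal_le_ofReal ?_
        have hbase : 1 + k ^ 2 * (1 + s / a) ≤ σ ^ (-2 : ℝ) * Real.exp (s / a) := by
          have h5 : σ ^ (-2 : ℝ) = 1 + k ^ 2 := by
            rw [hk2, Real.rpow_neg h0.le, Real.rpow_two]
            field_simp
            ring
          rw [h5]
          nlinarith [Real.add_one_le_exp (s / a), sq_nonneg k]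
        have hpow : σ ^ N * Real.exp (-(a / 2 * s)) ≤
            (1 + k ^ 2 * (1 + s / a)) ^ (-(N / 2 : ℝ)) := by
          refine le_trans (le_of_eq ?_) (Real.rpow_le_rpow_of_nonpos (by positivity) hbase
            (by simp; positivity))
          rw [Real.mul_rpow (by positivity) (Real.exp_pos _).le, ← Real.rpow_mul h0.le,
            ← Real.exp_mul, ← Real.rpow_natCast]
          congr 2
          · ring
          · rw [← ha2]; field_simp
        calc σ ^ N * Real.exp (-(1 / 2) * s ^ 2 - a * s) =
            Real.exp (-(1 / 2) * s ^ 2 - a / 2 * s) * (σ ^ N * Real.exp (-(a / 2 * s))) := by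
              rw [mul_left_comm, ← Real.exp_add]; congr 2; ring
          _ ≤ _ := mul_le_mul_of_nonneg_left hpow (Real.exp_pos _).le
    _ = ∫⁻ s in Set.Ioi (0 : ℝ), (∫⁻ b : Kᗮ,
          ENNReal.ofReal (Real.exp (-(1 / 2) * s ^ 2 - a / 2 * s)) *
          ENNReal.ofReal (Real.exp (-(1 / 2) * (1 + s / a) * (k * ‖b‖) ^ 2)) ∂stdGaussian Kᗮ) := by
        refine setLIntegral_congr_fun measurableSet_Ioi fun s hs => ?_
        have hs : 0 < s := hs
        have hsa : 0 ≤ s / a := by positivity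
        rw [lintegral_const_mul' _ _ ENNReal.ofReal_ne_top, ← lintegral_stdGaussian_exp]
        congr 1
        refine lintegral_congr fun b => ?_
        rw [mul_pow, Real.sq_sqrt (by positivity)]
        congr 2
        ring
    _ = ∫⁻ b : Kᗮ, (∫⁻ s in Set.Ioi (0 : ℝ),
          ENNReal.ofReal (Real.exp (-(1 / 2) * s ^ 2 - a / 2 * s)) *
          ENNReal.ofReal (Real.exp (-(1 / 2) * (1 + s / a) * (k * ‖b‖) ^ 2))) ∂stdGaussian Kᗮ :=
        (lintegral_lintegral_swap hmeas.aemeasurable).symm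
    _ ≤ _ := lintegral_mono fun b => lintegral_Ioi_exp_sq_ge ha0

end CapMass

/-- Smoothed tube estimate around a real hypersurface cone. -/
theorem toSphere_capCone_tube_le {N : ℕ} (hN : 2 ≤ N)
    {P : MvPolynomial (Fin (N + 1)) ℝ} {δ : ℕ} (hP : P.IsHomogeneous δ) (hP0 : P ≠ 0)
    (hδ : 1 ≤ δ) {ε : ℝ} (hε : 0 < ε)
    (hr1 : 4 * Real.exp 1 * ε * Real.sqrt (N + 1) / Real.sqrt (2 * Real.pi) < 1)
    {σ : ℝ} (h0 : 0 < σ) (h1 : σ ≤ 1) {f : EuclideanSpace ℝ (Fin (N + 1))} (hf : f ≠ 0) :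
    (volume : Measure (EuclideanSpace ℝ (Fin (N + 1)))).toSphere
        {θ | (θ : EuclideanSpace ℝ (Fin (N + 1))) ∈ capCone σ f ∧
          ∃ w : EuclideanSpace ℝ (Fin (N + 1)), eval w P = 0 ∧ ‖w - θ‖ ≤ ε} ≤
      ENNReal.ofReal (8 * Real.exp 1 * N * Real.sqrt N * Real.sqrt (N + 1) /
          (Real.pi * (N - 1)) * δ * ε / σ) *
        (volume : Measure (EuclideanSpace ℝ (Fin (N + 1)))).toSphere
          {θ | (θ : EuclideanSpace ℝ (Fin (N + 1))) ∈ capCone σ f} := by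
  have hfr : Module.finrank ℝ (EuclideanSpace ℝ (Fin (N + 1))) = N + 1 := finrank_euclideanSpace_fin
  have hfr2 : 2 ≤ Module.finrank ℝ (EuclideanSpace ℝ (Fin (N + 1))) := by rw [hfr]; omega
  have hm : MeasurableSet (capCone σ f) := (isClosed_capCone σ f).measurableSet
  have hcone : ∀ z : EuclideanSpace ℝ (Fin (N + 1)), ∀ ρ : ℝ, 0 < ρ →
      (ρ • z ∈ capCone σ f ↔ z ∈ capCone σ f) :=
    fun z ρ hρ => smul_mem_capCone hρ.ne'
  have hpi := Real.pi_pos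
  set r := 4 * Real.exp 1 * ε * Real.sqrt (N + 1) / Real.sqrt (2 * Real.pi) with hr
  have hrpos : 0 < r := by positivity
  have hup := (toSphere_mul_radialMass_le hP hε (by simp [hr]) hm hcone).trans
    ((stdGaussian_rootPairs_le hP hP0 hδ hrpos hr1 hm).trans
      (mul_le_mul_right (stdGaussian_hitPairs_capCone_le hfr2 h0 h1 hf) _))
  have hlow := stdGaussian_capCone_ge hfr (by omega) h0 h1 hf
  rw [stdGaussian_cone hm hcone] at hlow
  set A := (volume : Measure (EuclideanSpace ℝ (Fin (N + 1)))).toSphere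
    {θ | (θ : EuclideanSpace ℝ (Fin (N + 1))) ∈ capCone σ f ∧
          ∃ w : (EuclideanSpace ℝ (Fin (N + 1))), eval w P = 0 ∧ ‖w - θ‖ ≤ ε}
  set B := (volume : Measure (EuclideanSpace ℝ (Fin (N + 1)))).toSphere
    {θ | (θ : EuclideanSpace ℝ (Fin (N + 1))) ∈ capCone σ f}
  have hN1 : (2 : ℝ) ≤ N := by exact_mod_cast hN
  have hN1' : (0 : ℝ) < N - 1 := by linarith
  set k := 8 * Real.exp 1 * N * Real.sqrt N * Real.sqrt (N + 1) /
          (Real.pi * (N - 1)) * δ * ε / σ with hk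
  have hk0 : 0 ≤ k := by positivity
  have hnum : k * (Real.sqrt (2 / Real.pi) * (σ ^ N *
      (1 / Real.sqrt N - 1 / Real.sqrt N ^ 3))) = 2 * (2 * δ * r / Real.pi * σ ^ (N - 1)) := by
    obtain ⟨M, rfl⟩ : ∃ M, N = M + 1 := ⟨N - 1, by omega⟩
    have hs : Real.sqrt ((M + 1 : ℕ) : ℝ) ^ 2 = ((M + 1 : ℕ) : ℝ) := Real.sq_sqrt (by positivity)
    have hs0 : 0 < Real.sqrt ((M + 1 : ℕ) : ℝ) := Real.sqrt_pos.2 (by positivity)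
    have e1 : 1 / Real.sqrt ((M + 1 : ℕ) : ℝ) - 1 / Real.sqrt ((M + 1 : ℕ) : ℝ) ^ 3 =
        (((M + 1 : ℕ) : ℝ) - 1) / (((M + 1 : ℕ) : ℝ) * Real.sqrt ((M + 1 : ℕ) : ℝ)) := by
      have : ∀ s : ℝ, 0 < s → 1 / s - 1 / s ^ 3 = (s ^ 2 - 1) / (s ^ 2 * s) := fun s hs => by
        field_simp
      rw [this _ hs0, hs]
    have e2 : Real.sqrt (2 / Real.pi) = 2 / Real.sqrt (2 * Real.pi) := by
      rw [_root_.eq_div_iff (by positivity), ← Real.sqrt_mul (by positivity),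
        show 2 / Real.pi * (2 * Real.pi) = 2 ^ 2 by field_simp, Real.sqrt_sq (by norm_num)]
    rw [e1, e2, hk, hr, Nat.add_sub_cancel, pow_succ]
    field_simp
    norm_num
  have hA : A * radialMass (EuclideanSpace ℝ (Fin (N + 1))) ≤
      ENNReal.ofReal k * B * radialMass (EuclideanSpace ℝ (Fin (N + 1))) := by
    calc A * radialMass (EuclideanSpace ℝ (Fin (N + 1))) =
          2 * (A * (radialMass (EuclideanSpace ℝ (Fin (N + 1))) / 2)) := by
          rw [mul_left_comm, ENNReal.mul_div_cancel two_ne_zero (by simp)]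
      _ ≤ 2 * (ENNReal.ofReal (2 * δ * r / Real.pi) *
            ENNReal.ofReal (σ ^ (Module.finrank ℝ (EuclideanSpace ℝ (Fin (N + 1))) - 2))) :=
          mul_le_mul_right hup _
      _ = ENNReal.ofReal k * ENNReal.ofReal (Real.sqrt (2 / Real.pi) * (σ ^ N *
            (1 / Real.sqrt N - 1 / Real.sqrt N ^ 3))) := by
          rw [← ENNReal.ofReal_mul hk0, hnum, hfr, ENNReal.ofReal_mul (by norm_num),
            ENNReal.ofReal_mul (by positivity)]
          simp
      _ ≤ ENNReal.ofReal k * (B * radialMass (EuclideanSpace ℝ (Fin (N + 1)))) :=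
          mul_le_mul_right hlow _
      _ = _ := (mul_assoc _ _ _).symm
  have hnt : Nontrivial (EuclideanSpace ℝ (Fin (N + 1))) :=
    Module.nontrivial_of_finrank_pos (R := ℝ) (by omega)
  exact (ENNReal.mul_le_mul_iff_left radialMass_ne_zero radialMass_ne_top).1 hA

section Constants

variable {n : ℕ} {d : Fin n → ℕ}

theorem discriminant_degree_le (hn : 2 ≤ n) (hd : ∀ i, 1 ≤ d i) {δ : ℕ}
    (h : ((∀ i, d i = 1) ∧ δ ≤ n) ∨
      ∀ a, (∀ i, a ≤ d i) → δ * a ≤ (n + 1) * ((∑ i, (d i - 1)) * ∏ i, d i)) :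
    δ ≤ n ^ 2 * Finset.univ.sup d * ∏ i, d i := by
  set D := Finset.univ.sup d with hD
  have hdD : ∀ i, d i ≤ D := fun i => Finset.le_sup (f := d) (Finset.mem_univ i)
  have hD1 : 1 ≤ D := (hd ⟨0, by omega⟩).trans (hdD _)
  have hP : 1 ≤ ∏ i, d i := Finset.one_le_prod' fun i _ => hd i
  rcases h with ⟨-, h⟩ | h
  · calc δ ≤ n := h
      _ ≤ n ^ 2 := Nat.le_self_pow two_ne_zero n
      _ ≤ n ^ 2 * D := Nat.le_mul_of_pos_right _ hD1
      _ ≤ _ := Nat.le_mul_of_pos_right _ hP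
  · by_cases h2 : ∀ i, 2 ≤ d i
    · have hs : ∑ i, (d i - 1) ≤ n * D := by
        refine (Finset.sum_le_card_nsmul _ _ D fun i _ => (Nat.sub_le _ _).trans (hdD i)).trans ?_
        simp
      have h3 : (n + 1) * ((∑ i, (d i - 1)) * ∏ i, d i) ≤ (2 * n) * ((n * D) * ∏ i, d i) :=
        Nat.mul_le_mul (by omega) (Nat.mul_le_mul_right _ hs)
      have h4 := (h 2 h2).trans h3
      nlinarith
    · push Not at h2
      obtain ⟨j, hj⟩ := h2
      have hj1 : d j = 1 := le_antisymm (by omega) (hd j)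
      obtain ⟨m, rfl⟩ : ∃ m, n = m + 1 := ⟨n - 1, by omega⟩
      have hs : ∑ i, (d i - 1) ≤ m * D := by
        rw [← Finset.add_sum_erase _ _ (Finset.mem_univ j), hj1]
        refine (Nat.zero_add _).le.trans ((Finset.sum_le_card_nsmul _ _ D
          fun i _ => (Nat.sub_le _ _).trans (hdD i)).trans ?_)
        simp
      have h4 := h 1 hd
      have h5 : (m + 1 + 1) * ((∑ i, (d i - 1)) * ∏ i, d i) ≤
          (m + 1 + 1) * ((m * D) * ∏ i, d i) :=
        Nat.mul_le_mul_left _ (Nat.mul_le_mul_right _ hs)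
      have h6 : (m + 1 + 1) * ((m * D) * ∏ i, d i) = ((m + 1 + 1) * m) * (D * ∏ i, d i) := by ring
      have h7 : ((m + 1 + 1) * m) * (D * ∏ i, d i) ≤ (m + 1) ^ 2 * (D * ∏ i, d i) :=
        Nat.mul_le_mul_right _ (by nlinarith)
      rw [mul_assoc]
      omega

theorem tube_const_le {x : ℝ} (hx : 2 ≤ x) :
    8 * Real.exp 1 * x * Real.sqrt x * Real.sqrt (x + 1) / (Real.pi * (x - 1)) ≤
      7 * x * (x + 1 / 2) / (x - 1) := by
  have hsq : Real.sqrt x * Real.sqrt (x + 1) ≤ x + 1 / 2 := by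
    rw [← Real.sqrt_mul (by linarith)]
    exact Real.sqrt_le_iff.2 ⟨by linarith, by nlinarith⟩
  have he : 8 * Real.exp 1 ≤ 7 * Real.pi := by
    linarith [Real.exp_one_lt_d9, Real.pi_gt_d6]
  have hx1 : 0 < x - 1 := by linarith
  rw [div_le_div_iff₀ (by positivity) hx1]
  have h1 : 8 * Real.exp 1 * x * Real.sqrt x * Real.sqrt (x + 1) ≤
      7 * Real.pi * x * (x + 1 / 2) := by
    calc _ = 8 * Real.exp 1 * x * (Real.sqrt x * Real.sqrt (x + 1)) := by ring
      _ ≤ _ := by gcongr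
  nlinarith [mul_le_mul_of_nonneg_right h1 hx1.le]

theorem five_le_of_two_le (hn : 2 ≤ n) (hd : ∀ i, 1 ≤ d i) {N : ℕ}
    (hN : N + 1 = ∑ i, Nat.choose (d i + n) n) : 5 ≤ N := by
  have h : ∀ i ∈ Finset.univ, n + 1 ≤ Nat.choose (d i + n) n := fun i _ =>
    calc n + 1 = Nat.choose (1 + n) n := by rw [add_comm 1 n, Nat.choose_succ_self_right]
      _ ≤ _ := Nat.choose_le_choose _ (by have := hd i; omega)
  have := Finset.card_nsmul_le_sum _ _ _ h
  simp only [Finset.card_univ, Fintype.card_fin, smul_eq_mul] at this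
  nlinarith

theorem tube_const_mul_degree_le (hn : 1 ≤ n) (hd : ∀ i, 1 ≤ d i) {N : ℕ}
    (hN : N + 1 = ∑ i, Nat.choose (d i + n) n) (hN2 : 2 ≤ N) {δ : ℕ}
    (h : ((∀ i, d i = 1) ∧ δ ≤ n) ∨
      ∀ a, (∀ i, a ≤ d i) → δ * a ≤ (n + 1) * ((∑ i, (d i - 1)) * ∏ i, d i)) :
    8 * Real.exp 1 * N * Real.sqrt N * Real.sqrt (N + 1) / (Real.pi * (N - 1)) * δ ≤
      13 * n ^ 2 * ((Finset.univ.sup d : ℕ) : ℝ) * (∏ i, (d i : ℝ)) * N := by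
  have hNr : (2 : ℝ) ≤ N := by exact_mod_cast hN2
  refine (mul_le_mul_of_nonneg_right (tube_const_le hNr) (Nat.cast_nonneg δ)).trans ?_
  have hN1 : (0 : ℝ) < N - 1 := by linarith
  rw [div_mul_eq_mul_div, div_le_iff₀ hN1]
  obtain hn2 | rfl : 2 ≤ n ∨ n = 1 := by omega
  · have h5 : (5 : ℝ) ≤ N := by exact_mod_cast five_le_of_two_le hn2 hd hN
    have hδ : (δ : ℝ) ≤ n ^ 2 * ((Finset.univ.sup d : ℕ) : ℝ) * ∏ i, (d i : ℝ) := by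
      exact_mod_cast discriminant_degree_le hn2 hd h
    set X : ℝ := n ^ 2 * ((Finset.univ.sup d : ℕ) : ℝ) * ∏ i, (d i : ℝ) with hX
    have hX0 : 0 ≤ X := (Nat.cast_nonneg δ).trans hδ
    have h1 : 7 * (N : ℝ) * (N + 1 / 2) ≤ 13 * N * (N - 1) := by nlinarith
    calc 7 * (N : ℝ) * (N + 1 / 2) * δ ≤ 13 * N * (N - 1) * X := by gcongr
      _ = _ := by rw [hX]; ring
  · have hND : N = d 0 := by
      simp at hN
      omega
    have hsup : Finset.univ.sup d = N := by simp [hND]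
    have hprod : ∏ i, (d i : ℝ) = N := by simp [hND]
    rw [hsup, hprod]
    have hδ : (δ : ℝ) ≤ 2 * (N - 1) := by
      rcases h with ⟨h, -⟩ | h
      · have := h 0
        omega
      · have h1 := h N (fun i => by rw [hND, Subsingleton.elim i 0])
        simp only [univ_unique, Fin.default_eq_zero, sum_singleton, prod_singleton, ← hND] at h1
        have h2 : δ ≤ 2 * (N - 1) := by
          refine Nat.le_of_mul_le_mul_right (h1.trans (le_of_eq ?_)) (by omega : 0 < N)
          ring
        have h3 : ((N - 1 : ℕ) : ℝ) = N - 1 := by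
          rw [Nat.cast_sub (by omega)]; simp
        rw [← h3]
        exact_mod_cast h2
    calc 7 * (N : ℝ) * (N + 1 / 2) * δ ≤ 7 * (N : ℝ) * (N + 1 / 2) * (2 * (N - 1)) := by gcongr
      _ ≤ _ := by
        have : 14 * ((N : ℝ) + 1 / 2) ≤ 13 * N * N := by nlinarith
        have := mul_le_mul_of_nonneg_right this (by positivity : 0 ≤ (N : ℝ) * (N - 1))
        push_cast
        nlinarith

theorem tube_radius_lt_one {N : ℕ} (hN : 2 ≤ N) {t : ℝ} (ht : 5 * N ≤ t) :
    4 * Real.exp 1 * (1 / t) * Real.sqrt (N + 1) / Real.sqrt (2 * Real.pi) < 1 := by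
  have hNr : (2 : ℝ) ≤ N := by exact_mod_cast hN
  have ht0 : 0 < t := by linarith
  have hpi := Real.pi_gt_d6
  have h1 : (5 / 2 : ℝ) ≤ Real.sqrt (2 * Real.pi) := Real.le_sqrt_of_sq_le (by linarith)
  have h2 : Real.sqrt (N + 1 : ℝ) ≤ N := Real.sqrt_le_iff.2 ⟨by linarith, by nlinarith⟩
  rw [div_lt_one (by linarith), mul_one_div, div_mul_eq_mul_div, div_lt_iff₀ ht0]
  calc 4 * Real.exp 1 * Real.sqrt (N + 1 : ℝ) ≤ 4 * Real.exp 1 * N := by gcongr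
    _ < 5 / 2 * (5 * N) := by nlinarith [Real.exp_one_lt_d9]
    _ ≤ _ := by gcongr

theorem exists_linForm_of_isHomogeneous_one {m : ℕ} {p : MvPolynomial (Fin m) ℝ}
    (hp : p.IsHomogeneous 1) : ∃ a, p = linForm a := by
  have : p ∈ homogeneousSubmodule (Fin m) ℝ 1 := hp
  rw [homogeneousSubmodule_one_eq_span_X] at this
  obtain ⟨a, rfl⟩ := (Submodule.mem_span_range_iff_exists_fun ℝ).1 this
  exact ⟨a, by simp [linForm, MvPolynomial.smul_eq_C_mul]⟩

theorem eq_zero_of_degenerate_binary_linear {d : Fin 1 → ℕ} (hd : ∀ i, d i = 1)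
    {g : Fin 1 → MvPolynomial (Fin (1 + 1)) ℝ} (hg : IsSystem d g) (h : Degenerate g) : g = 0 := by
  obtain ⟨x, v, hx, hv, hxv, h⟩ := h
  funext i
  obtain ⟨a, ha⟩ := exists_linForm_of_isHomogeneous_one (hd i ▸ hg i)
  obtain ⟨h1, h2⟩ := h i
  rw [ha, eval_linForm] at h1
  rw [ha, dEval_linForm] at h2
  replace hx : x 0 ^ 2 + x 1 ^ 2 = 1 := (Fin.sum_univ_two _).symm.trans hx
  replace hv : v 0 ^ 2 + v 1 ^ 2 = 1 := (Fin.sum_univ_two _).symm.trans hv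
  replace hxv : v 0 * x 0 + v 1 * x 1 = 0 := (Fin.sum_univ_two _).symm.trans hxv
  replace h1 : a 0 * x 0 + a 1 * x 1 = 0 := (Fin.sum_univ_two _).symm.trans h1
  replace h2 : a 0 * v 0 + a 1 * v 1 = 0 := (Fin.sum_univ_two _).symm.trans h2
  have hdet : (x 0 * v 1 - x 1 * v 0) ^ 2 = 1 := by
    linear_combination (v 0 ^ 2 + v 1 ^ 2) * hx + hv - (v 0 * x 0 + v 1 * x 1) * hxv
  have hne : x 0 * v 1 - x 1 * v 0 ≠ 0 := fun h => by rw [h] at hdet; norm_num at hdet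
  have ha0 : a 0 = 0 := by
    refine (mul_eq_zero.1 ?_).resolve_left hne
    linear_combination v 1 * h1 - x 1 * h2
  have ha1 : a 1 = 0 := by
    refine (mul_eq_zero.1 ?_).resolve_left hne
    linear_combination x 0 * h2 - v 0 * h1
  rw [ha, linForm]
  exact (Fin.sum_univ_two _).trans (by simp [ha0, ha1])

section Pullback
variable {M : ℕ} (φ : EuclideanSpace ℝ (Fin M) →ₗ[ℝ] (Fin n → MvPolynomial (Fin (n + 1)) ℝ))

/-- The polynomial function `v ↦ P (coefs (φ v))`. -/
noncomputable def pullback (P : MvPolynomial (Idx d) ℝ) : MvPolynomial (Fin M) ℝ :=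
  aeval (fun j => linForm fun k => coefs d (φ (EuclideanSpace.single k 1)) j) P

theorem isHomogeneous_pullback {P : MvPolynomial (Idx d) ℝ} {δ : ℕ} (hP : P.IsHomogeneous δ) :
    (pullback φ P).IsHomogeneous δ := by
  rw [← one_mul δ]
  exact hP.aeval _ fun j =>
    isHomogeneous_linForm fun k => coefs d (φ (EuclideanSpace.single k 1)) j

theorem eval_pullback (P : MvPolynomial (Idx d) ℝ) (v : EuclideanSpace ℝ (Fin M)) :
    eval v (pullback φ P) = eval (coefs d (φ v)) P := by
  have hv : φ v = ∑ k, v k • φ (EuclideanSpace.single k 1) := by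
    conv_lhs => rw [← (EuclideanSpace.basisFun (Fin M) ℝ).sum_repr v]
    simp
  rw [pullback, ← coe_aeval_eq_eval, RingHom.coe_coe, ← AlgHom.comp_apply, comp_aeval,
    aeval_eq_eval]
  congr 2
  funext j
  rw [aeval_eq_eval, eval_linForm, hv]
  simp [coefs, mul_comm, coeff_sum]

theorem pullback_ne_zero (hφsurj : ∀ g, IsSystem d g → ∃ v, φ v = g)
    {P : MvPolynomial (Idx d) ℝ} (hP : P ≠ 0) : pullback φ P ≠ 0 := by
  intro h
  refine hP (MvPolynomial.funext fun c => ?_)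
  obtain ⟨v, hv⟩ := hφsurj _ (isHomogeneous_sys c)
  rw [map_zero, ← coefs_sys c, ← hv, ← eval_pullback, h, map_zero]

end Pullback

theorem sqrt_one_sub_inner_sq_le_iff {E : Type*} [NormedAddCommGroup E] [InnerProductSpace ℝ E]
    {f θ : E} (hf : ‖f‖ = 1) (hθ : ‖θ‖ = 1) {σ : ℝ} (hσ : 0 ≤ σ) :
    Real.sqrt (1 - inner ℝ θ f ^ 2) ≤ σ ↔ θ ∈ capCone σ f := by
  rw [Real.sqrt_le_iff, capCone, Set.mem_ofPred_eq, hf, hθ]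
  constructor
  · intro h
    linarith [h.2]
  · intro h
    exact ⟨hσ, by linarith⟩

/-- A sphere point of large `κ̃` is close to the zero set of any polynomial that vanishes on the
degenerate systems. -/
theorem exists_root_of_kappa_ge {M : ℕ} (hn : 1 ≤ n) (hd : ∀ i, 1 ≤ d i)
    (φ : EuclideanSpace ℝ (Fin M) →ₗ[ℝ] (Fin n → MvPolynomial (Fin (n + 1)) ℝ))
    (hφsys : ∀ v, IsSystem d (φ v)) (hφiso : ∀ v, bwNormSys (φ v) = ‖v‖)
    (hφsurj : ∀ g, IsSystem d g → ∃ v, φ v = g) {Q : MvPolynomial (Fin M) ℝ}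
    (hQ : ∀ v, Degenerate (φ v) → eval v Q = 0) {t : ℝ} (ht : 0 < t)
    {θ : EuclideanSpace ℝ (Fin M)} (hθ : ‖θ‖ = 1) (hk : ENNReal.ofReal t ≤ kappa d (φ θ)) :
    ∃ w : EuclideanSpace ℝ (Fin M), eval w Q = 0 ∧ ‖w - θ‖ ≤ 1 / t := by
  set Z : Set (EuclideanSpace ℝ (Fin M)) := {w | eval w Q = 0} with hZ
  have hnear : ∀ ε, 1 / t < ε → ∃ w ∈ Z, dist θ w < ε := by
    intro ε hε
    obtain ⟨g, hg, hdg, hlt⟩ := exists_degenerate_near_of_kappa hd (hφsys θ) hn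
      ((hφiso θ).trans hθ) ht hε hk
    obtain ⟨w, rfl⟩ := hφsurj g hg
    refine ⟨w, hQ w hdg, ?_⟩
    rwa [← map_sub, hφiso, ← dist_eq_norm] at hlt
  have hcl : IsClosed Z := by
    refine isClosed_eq ?_ continuous_const
    exact (MvPolynomial.continuous_eval Q).comp (PiLp.continuous_ofLp 2 _)
  obtain ⟨w₀, hw₀, -⟩ := hnear (1 / t + 1) (by linarith)
  obtain ⟨w, hw, hdist⟩ := hcl.exists_infDist_eq_dist ⟨w₀, hw₀⟩ θ
  refine ⟨w, hw, ?_⟩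
  rw [← dist_eq_norm, dist_comm, ← hdist]
  refine le_of_forall_gt_imp_ge_of_dense fun ε hε => ?_
  obtain ⟨w', hw', hlt⟩ := hnear ε hε
  exact (infDist_le_dist_of_mem hw').trans hlt.le

theorem two_le_sum_choose (hn : 1 ≤ n) (hd : ∀ i, 1 ≤ d i) :
    2 ≤ ∑ i, Nat.choose (d i + n) n := by
  refine le_trans ?_ (Finset.single_le_sum (f := fun i => Nat.choose (d i + n) n)
    (fun _ _ => Nat.zero_le _) (Finset.mem_univ (⟨0, hn⟩ : Fin n)))
  calc 2 ≤ n + 1 := by omega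
    _ = Nat.choose (1 + n) n := by rw [add_comm 1 n, Nat.choose_succ_self_right]
    _ ≤ _ := Nat.choose_le_choose _ (by have := hd ⟨0, hn⟩; omega)

theorem five_mul_le_of_threshold_le (hn : 1 ≤ n) (hd : ∀ i, 1 ≤ d i) {N : ℕ} {σ t : ℝ}
    (h0 : 0 < σ) (h1 : σ ≤ 1) (ht : (4 * n * (∏ i, (d i : ℝ)) ^ 2 + 1) * N / σ ≤ t) :
    5 * (N : ℝ) ≤ t := by
  have hP : (1 : ℝ) ≤ ∏ i, (d i : ℝ) := by
    exact_mod_cast Finset.one_le_prod' (s := Finset.univ) fun i _ => hd i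
  have hn' : (1 : ℝ) ≤ n := by exact_mod_cast hn
  calc 5 * (N : ℝ) = (4 * 1 * 1 ^ 2 + 1) * N := by ring
    _ ≤ (4 * n * (∏ i, (d i : ℝ)) ^ 2 + 1) * N := by gcongr
    _ ≤ (4 * n * (∏ i, (d i : ℝ)) ^ 2 + 1) * N / σ := le_div_self (by positivity) h0 h1
    _ ≤ t := ht

/-- For a single binary linear form `κ̃` is identically one. -/
theorem kappa_lt_of_binary_linear {d : Fin 1 → ℕ} (hd : ∀ i, d i = 1)
    {f : Fin 1 → MvPolynomial (Fin (1 + 1)) ℝ} (hf : IsSystem d f) (hf1 : bwNormSys f = 1)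
    {t : ℝ} (ht : 1 < t) : kappa d f < ENNReal.ofReal t := by
  by_contra! hk
  obtain ⟨g, hg, hdg, hlt⟩ := exists_degenerate_near_of_kappa (fun i => (hd i).ge) hf le_rfl hf1
    (by linarith) ((div_lt_one (by linarith)).2 ht) hk
  rw [eq_zero_of_degenerate_binary_linear hd hg hdg, sub_zero, hf1] at hlt
  exact lt_irrefl _ hlt

end Constants

end SmoothedKappa

/-- **Smoothed analysis of `κ̃`, probability tail bound.**  Identify `H_d` with
`ℝ^{N+1}` (with the Bombieri–Weyl norm) via any linear isometry `φ`; the uniform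
probability distribution on the projective ball `B(f, σ) ⊆ ℙ(H_d)` is realized as
the normalized uniform (surface) measure on `{g ∈ S(H_d) : d_ℙ(g, f) ≤ σ}`, where
`d_ℙ(g, f) = √(1 - ⟪g, f⟫²)` is the projective (sine) distance of unit vectors.
For every `σ ∈ (0,1]` and `t ≥ (4n𝒟² + 1)N/σ`:
`sup_f Prob_{g ∈ B(f,σ)} {κ̃(g) ≥ t} ≤ 13 n² D 𝒟 N / (σ t)`. -/
theorem smoothed_analysis_kappa_prob {n : ℕ} (hn : 1 ≤ n) (d : Fin n → ℕ)
    (hd : ∀ i, 1 ≤ d i) (N : ℕ) (hN : N + 1 = ∑ i, Nat.choose (d i + n) n)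
    (φ : EuclideanSpace ℝ (Fin (N + 1)) →ₗ[ℝ] (Fin n → MvPolynomial (Fin (n + 1)) ℝ))
    (hφsys : ∀ v, IsSystem d (φ v))
    (hφiso : ∀ v, bwNormSys (φ v) = ‖v‖)
    (hφsurj : ∀ g, IsSystem d g → ∃ v, φ v = g)
    (σ : ℝ) (hσ : σ ∈ Set.Ioc (0 : ℝ) 1) (t : ℝ)
    (ht : (4 * n * (∏ i, (d i : ℝ)) ^ 2 + 1) * N / σ ≤ t)
    (f : EuclideanSpace ℝ (Fin (N + 1))) (hf : ‖f‖ = 1) :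
    (volume : Measure (EuclideanSpace ℝ (Fin (N + 1)))).toSphere
        {g : Metric.sphere (0 : EuclideanSpace ℝ (Fin (N + 1))) 1 |
          Real.sqrt (1 - (inner (𝕜 := ℝ) (g : EuclideanSpace ℝ (Fin (N + 1))) f) ^ 2) ≤ σ ∧
          ENNReal.ofReal t ≤ kappa d (φ g)} /
      (volume : Measure (EuclideanSpace ℝ (Fin (N + 1)))).toSphere
        {g : Metric.sphere (0 : EuclideanSpace ℝ (Fin (N + 1))) 1 |
          Real.sqrt (1 - (inner (𝕜 := ℝ) (g : EuclideanSpace ℝ (Fin (N + 1))) f) ^ 2) ≤ σ}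
      ≤ ENNReal.ofReal
          (13 * n ^ 2 * ((Finset.univ.sup d : ℕ) : ℝ) * (∏ i, (d i : ℝ)) * N / (σ * t)) := by
  obtain ⟨h0, h1⟩ := hσ
  have hN1 : 1 ≤ N := by
    have := SmoothedKappa.two_le_sum_choose hn hd
    omega
  have hNr : (1 : ℝ) ≤ N := by exact_mod_cast hN1
  have ht5 := SmoothedKappa.five_mul_le_of_threshold_le hn hd h0 h1 ht
  have ht0 : 0 < t := by linarith
  rcases hN1.eq_or_lt with rfl | hN2
  · obtain rfl : n = 1 := by
      by_contra hne
      have := SmoothedKappa.five_le_of_two_le (by omega : 2 ≤ n) hd hN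
      omega
    have hd1 : ∀ i, d i = 1 := by
      intro i
      simp only [Finset.univ_unique, Finset.sum_singleton, Nat.choose_one_right] at hN
      rw [Subsingleton.elim i default]
      omega
    refine le_of_eq_of_le ?_ zero_le
    rw [ENNReal.div_eq_zero_iff]
    left
    refine (congrArg _ ?_).trans measure_empty
    refine Set.eq_empty_of_forall_notMem fun θ hθ => ?_
    exact (SmoothedKappa.kappa_lt_of_binary_linear hd1 (hφsys θ)
      ((hφiso θ).trans (norm_eq_of_mem_sphere θ)) (by push_cast at ht5; linarith)).not_ge hθ.2
  · obtain ⟨δ, P, hP0, hP, hδ, hdeg, hvan⟩ := SmoothedKappa.exists_discriminant hn hd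
    have hQ : ∀ v, SmoothedKappa.Degenerate (φ v) →
        eval v (SmoothedKappa.pullback φ P) = 0 := fun v hv => by
      rw [SmoothedKappa.eval_pullback]
      exact hvan _ (hφsys v) hv
    have hcap : ∀ θ : Metric.sphere (0 : EuclideanSpace ℝ (Fin (N + 1))) 1,
        Real.sqrt (1 - (inner (𝕜 := ℝ) (θ : EuclideanSpace ℝ (Fin (N + 1))) f) ^ 2) ≤ σ ↔
          (θ : EuclideanSpace ℝ (Fin (N + 1))) ∈ SmoothedKappa.capCone σ f := fun θ =>
      SmoothedKappa.sqrt_one_sub_inner_sq_le_iff hf (norm_eq_of_mem_sphere θ) h0.le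
    have htube := SmoothedKappa.toSphere_capCone_tube_le hN2
      (SmoothedKappa.isHomogeneous_pullback φ hP) (SmoothedKappa.pullback_ne_zero φ hφsurj hP0)
      hδ (one_div_pos.2 ht0) (SmoothedKappa.tube_radius_lt_one hN2 ht5) h0 h1
      (norm_pos_iff.1 (hf ▸ one_pos))
    have hconst := SmoothedKappa.tube_const_mul_degree_le hn hd hN hN2 hdeg
    simp only [hcap]
    refine ENNReal.div_le_of_le_mul (le_trans (measure_mono ?_)
      (htube.trans (mul_le_mul_left (ENNReal.ofReal_le_ofReal ?_) _)))
    · exact fun θ hθ => ⟨hθ.1, SmoothedKappa.exists_root_of_kappa_ge hn hd φ hφsys hφiso hφsurj hQ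
        ht0 (norm_eq_of_mem_sphere θ) hθ.2⟩
    · refine le_of_eq_of_le ?_ (div_le_div_of_nonneg_right hconst (mul_pos h0 ht0).le)
      field_simp
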